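/- (Completeness Lemma.) Let Γ ⊆ ℝ³ be a smooth Jordan curve parametrized by γ : 𝕊¹ → ℝ³. Let P and P′ be polygons with closure(Int P′) ⊆ Int P, let X be a conformal minimal immersion defined on an open neighborhood of closure(Int P), and let r, ε > 0 satisfy: (1) X(closure(Int P) \ Int P′) ⊆ T(Γ, r); (2) the loop X restricted to P′ is freely homotopic to γ within T(Γ, r). Then for every s > 0 there exist a polygon P̃ and a conformal minimal immersion X̃ defined on an open neighborhood of closure(Int P̃) such that: (a.1) Int P′ ⊆ Int P̃ and closure(Int P̃) ⊆ Int P; (a.2) ‖X(z) − X̃(z)‖ < ε for all z ∈ Int P′; (a.3) dist_{(closure(Int P̃), X̃)}(z, P′) > s for every z ∈ P̃; (a.4) X̃(closure(Int P̃) \ Int P′) ⊆ T(Γ, R), where R = √((2s)² + r²) + ε; (a.5) the loops X restricted to P′ and X̃ restricted to P′ are freely homotopic within T(Γ, R); (a.6) the loop X̃ restricted to P̃ is freely homotopic to γ within T(Γ, R). -/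

import Mathlib

open Set Metric Function

noncomputable section

/-- ℝ³, identified with `EuclideanSpace ℝ (Fin 3)`. -/
abbrev R3 := EuclideanSpace ℝ (Fin 3)

/-- A real function on `ℂ ≃ ℝ²` is harmonic on a set if its Laplacian vanishes there. -/
def HarmOn (f : ℂ → ℝ) (Ω : Set ℂ) : Prop :=
  ∀ z ∈ Ω,
    fderiv ℝ (fun w => fderiv ℝ f w 1) z 1 +
      fderiv ℝ (fun w => fderiv ℝ f w Complex.I) z Complex.I = 0

/-- A conformal minimal immersion on an open set `Ω ⊆ ℂ`: a smooth map whose coordinate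
functions are harmonic and whose real derivative at each point of `Ω` is a positive scalar
multiple of a linear isometry (hence injective and conformal). -/
def ConfMinImmOn (X : ℂ → R3) (Ω : Set ℂ) : Prop :=
  ContDiffOn ℝ (⊤ : ℕ∞) X Ω ∧
  (∀ i : Fin 3, HarmOn (fun z => X z i) Ω) ∧
  ∀ z ∈ Ω, ∃ c : ℝ, 0 < c ∧ ∀ v : ℂ, ‖fderiv ℝ X z v‖ = c * ‖v‖

/-- A path `γ : [0,1) → Ω` that eventually leaves every compact subset of `Ω`. -/
def DivergentPath (Ω : Set ℂ) (γ : ℝ → ℂ) : Prop :=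
  ContinuousOn γ (Ico 0 1) ∧ MapsTo γ (Ico 0 1) Ω ∧
  ∀ K : Set ℂ, IsCompact K → K ⊆ Ω →
    ∃ t₀ ∈ Ico (0:ℝ) 1, ∀ t ∈ Ico t₀ 1, γ t ∉ K

/-- Completeness of an immersion `X` on `Ω`: every divergent path has image of infinite
total variation (length). -/
def CompleteOn (X : ℂ → R3) (Ω : Set ℂ) : Prop :=
  ∀ γ : ℝ → ℂ, DivergentPath Ω γ → eVariationOn (X ∘ γ) (Ico 0 1) = ⊤

/-- Properness of `ψ : Ω → D`: preimages of compact subsets of `D` are compact. -/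
def ProperIn (ψ : ℂ → R3) (Ω : Set ℂ) (D : Set R3) : Prop :=
  ∀ K : Set R3, IsCompact K → K ⊆ D → IsCompact (Ω ∩ ψ ⁻¹' K)

/-- The limit set of a map on the open unit disk. -/
def limitSet (ψ : ℂ → R3) : Set R3 :=
  closure (ψ '' ball (0:ℂ) 1) \ ψ '' ball (0:ℂ) 1

/-- A regular strictly convex bounded domain: a nonempty bounded convex open set satisfying
uniform interior and exterior sphere conditions. -/
def RegStrictConvexDomain (C : Set R3) : Prop :=
  C.Nonempty ∧ IsOpen C ∧ Convex ℝ C ∧ Bornology.IsBounded C ∧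
  ∃ r R : ℝ, 0 < r ∧ r ≤ R ∧
    ∀ p ∈ frontier C,
      (∃ x, p ∈ sphere x r ∧ closedBall x r ⊆ closure C) ∧
      (∃ y, p ∈ sphere y R ∧ closure C ⊆ closedBall y R)

/-- `R` is a uniform exterior sphere radius for `E`. -/
def ExtSphereRadius (E : Set R3) (R : ℝ) : Prop :=
  0 < R ∧ ∀ p ∈ frontier E, ∃ y, p ∈ sphere y R ∧ closure E ⊆ closedBall y R

/-- `γ : ℝ → ℝ³`, `1`-periodic, parametrizes a smooth Jordan curve: it is `C^∞`, injective on
a period, and has nowhere-vanishing derivative. -/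
def SmoothJordan (γ : ℝ → R3) : Prop :=
  ContDiff ℝ (⊤ : ℕ∞) γ ∧ Periodic γ 1 ∧
  (∀ s ∈ Ico (0:ℝ) 1, ∀ t ∈ Ico (0:ℝ) 1, γ s = γ t → s = t) ∧
  ∀ t, deriv γ t ≠ 0

/-- `p : ℝ → ℂ`, `1`-periodic, parametrizes a polygon: an injective piecewise-linear loop. -/
def PolygonParam (p : ℝ → ℂ) : Prop :=
  Continuous p ∧ Periodic p 1 ∧
  (∀ s ∈ Ico (0:ℝ) 1, ∀ t ∈ Ico (0:ℝ) 1, p s = p t → s = t) ∧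
  ∃ n : ℕ, 0 < n ∧ ∀ k : ℕ, k < n → ∀ s ∈ Icc ((k:ℝ)/n) ((k+1)/n),
    p s = p (k/n) + (((s - k/n) * n) : ℝ) • (p ((k+1)/n) - p (k/n))

/-- The interior region of a polygon `P ⊆ ℂ`: the union of the bounded connected components
of the complement of `P`. -/
def polyInt (P : Set ℂ) : Set ℂ :=
  {z | z ∉ P ∧ Bornology.IsBounded (connectedComponentIn Pᶜ z)}

/-- The intrinsic distance, induced by `X`, within `W` from a point `z` to a set `S`:
the infimum of the lengths (total variations) of `X ∘ α` over continuous paths `α` in `W`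
joining `z` to `S`. -/
def intrinsicDist (X : ℂ → R3) (W : Set ℂ) (z : ℂ) (S : Set ℂ) : ENNReal :=
  ⨅ (α : ℝ → ℂ) (_ : ContinuousOn α (Icc 0 1)) (_ : MapsTo α (Icc 0 1) W)
    (_ : α 0 = z) (_ : α 1 ∈ S), eVariationOn (X ∘ α) (Icc 0 1)

/-- Two `1`-periodic loops in `ℝ³` are freely homotopic within a set `T`. -/
def HomotopicLoopsIn (T : Set R3) (f g : ℝ → R3) : Prop :=
  ∃ H : ℝ × ℝ → R3, Continuous H ∧
    (∀ t, H (t, 0) = f t) ∧ (∀ t, H (t, 1) = g t) ∧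
    (∀ t s, H (t + 1, s) = H (t, s)) ∧
    ∀ t s, s ∈ Icc (0:ℝ) 1 → H (t, s) ∈ T

/-- The inner parallel body `E₋ₜ` of a convex open set. -/
def innerParallel (E : Set R3) (t : ℝ) : Set R3 :=
  {x ∈ E | t < infDist x Eᶜ}

/-- The operator `2 i ∂/∂z̄`. -/
def dbar (u : ℂ → ℂ) (z : ℂ) : ℂ := Complex.I * fderiv ℝ u z 1 - fderiv ℝ u z Complex.I

lemma integral_square_inv {R : ℝ} (hR : 0 < R) :
    ∃ c : ℂ, c ≠ 0 ∧
    (∫ x : ℝ in -R..R, ((x + (-R : ℝ) * Complex.I : ℂ))⁻¹) -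
      (∫ x : ℝ in -R..R, ((x + (R : ℝ) * Complex.I : ℂ))⁻¹) +
      Complex.I • (∫ y : ℝ in -R..R, (((R : ℝ) + y * Complex.I : ℂ))⁻¹) -
      Complex.I • (∫ y : ℝ in -R..R, (((-R : ℝ) + y * Complex.I : ℂ))⁻¹) = c := by
  have hz1 : ∀ (x : ℝ) (s : ℝ), s ≠ 0 → ((x : ℂ) + (s : ℝ) * Complex.I) ≠ 0 := by
    intro x s hs h
    have := congrArg Complex.im h
    simp at this
    exact hs this
  have hz2 : ∀ (x : ℝ) (s : ℝ), s ≠ 0 → ((s : ℂ) + (x : ℝ) * Complex.I) ≠ 0 := by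
    intro x s hs h
    have := congrArg Complex.re h
    simp at this
    exact hs this
  have hq : ∀ x : ℝ, 0 < x ^ 2 + R ^ 2 := fun x => by positivity
  have hqc : ∀ x : ℝ, ((x : ℂ) ^ 2 + R ^ 2) ≠ 0 := fun x => by exact_mod_cast (hq x).ne'
  have hi1 : ∀ s : ℝ, s ≠ 0 → IntervalIntegrable
      (fun x : ℝ => ((x + (s : ℝ) * Complex.I : ℂ))⁻¹) MeasureTheory.volume (-R) R := by
    intro s hs
    apply Continuous.intervalIntegrable
    exact Continuous.inv₀ (by fun_prop) (fun x => hz1 x s hs)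
  have hi2 : ∀ s : ℝ, s ≠ 0 → IntervalIntegrable
      (fun x : ℝ => (((s : ℝ) + x * Complex.I : ℂ))⁻¹) MeasureTheory.volume (-R) R := by
    intro s hs
    apply Continuous.intervalIntegrable
    exact Continuous.inv₀ (by fun_prop) (fun x => hz2 x s hs)
  have hJ : 0 < ∫ x : ℝ in -R..R, 2 * R / (x ^ 2 + R ^ 2) := by
    apply intervalIntegral.intervalIntegral_pos_of_pos
    · apply Continuous.intervalIntegrable
      exact Continuous.div (by fun_prop) (by fun_prop) (fun x => (hq x).ne')
    · intro x; have := hq x; positivity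
    · linarith
  refine ⟨2 * Complex.I * (∫ x : ℝ in -R..R, 2 * R / (x ^ 2 + R ^ 2) : ℝ), ?_, ?_⟩
  · have : ((∫ x : ℝ in -R..R, 2 * R / (x ^ 2 + R ^ 2) : ℝ) : ℂ) ≠ 0 := by exact_mod_cast hJ.ne'
    simp only [ne_eq, mul_eq_zero, OfNat.ofNat_ne_zero, Complex.I_ne_zero, this, or_self,
      not_false_eq_true]
  · rw [add_sub_assoc, ← smul_sub, ← intervalIntegral.integral_sub (hi1 _ (by linarith [hR]))
      (hi1 _ hR.ne'), ← intervalIntegral.integral_sub (hi2 _ hR.ne') (hi2 _ (by linarith [hR])),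
      ← intervalIntegral.integral_ofReal, smul_eq_mul, ← intervalIntegral.integral_const_mul,
      ← intervalIntegral.integral_const_mul, ← intervalIntegral.integral_add]
    · apply intervalIntegral.integral_congr
      intro x _
      have h1 := hz1 x R hR.ne'
      have h2 := hz1 x (-R) (by linarith)
      have h3 := hz2 x R hR.ne'
      have h4 := hz2 x (-R) (by linarith)
      have h5 := hqc x
      have e1 : ((x : ℂ) + (-R : ℝ) * Complex.I) * (x + (R : ℝ) * Complex.I) = x ^ 2 + R ^ 2 := by
        push_cast; linear_combination (-(R : ℂ) ^ 2) * Complex.I_sq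
      have e2 : (((-R : ℝ) : ℂ) + x * Complex.I) * ((R : ℝ) + x * Complex.I) = -(x ^ 2 + R ^ 2) := by
        push_cast; linear_combination ((x : ℂ) ^ 2) * Complex.I_sq
      simp only
      rw [inv_sub_inv h2 h1, inv_sub_inv h3 h4, e1, mul_comm ((R : ℂ) + _), e2]
      push_cast
      field_simp
      ring
    · exact (hi1 _ (by linarith)).sub (hi1 _ hR.ne')
    · exact ((hi2 _ hR.ne').sub (hi2 _ (by linarith))).const_mul _

lemma contDiff_dbar_continuous {u : ℂ → ℂ} (hu : ContDiff ℝ 1 u) : Continuous (dbar u) := by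
  have h := hu.continuous_fderiv one_ne_zero
  unfold dbar
  fun_prop

lemma dbar_tsupport {u : ℂ → ℂ} (z : ℂ) (hz : z ∉ tsupport u) : dbar u z = 0 := by
  have : fderiv ℝ u z = 0 := by
    by_contra h
    exact hz (support_fderiv_subset ℝ h)
  simp [dbar, this]

lemma dbar_of_differentiableAt {u : ℂ → ℂ} {z : ℂ} (h : DifferentiableAt ℂ u z) :
    dbar u z = 0 := by
  have : fderiv ℝ u z = (fderiv ℂ u z).restrictScalars ℝ :=
    (h.hasFDerivAt.restrictScalars ℝ).fderiv
  unfold dbar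
  rw [this]
  simp only [ContinuousLinearMap.coe_restrictScalars']
  have h2 : fderiv ℂ u z Complex.I = Complex.I * fderiv ℂ u z 1 := by
    rw [← smul_eq_mul, ← map_smul]; simp
  rw [h2]; ring

lemma continuous_dbar_div {u : ℂ → ℂ} (hu : ContDiff ℝ 1 u)
    (h0 : ∀ᶠ z in nhds 0, DifferentiableAt ℂ u z) :
    Continuous (fun ζ => dbar u ζ / ζ) := by
  rw [continuous_iff_continuousAt]
  intro ζ
  by_cases h : ζ = 0
  · subst h
    have : (fun ζ => dbar u ζ / ζ) =ᶠ[nhds 0] fun _ => 0 := by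
      filter_upwards [h0] with z hz
      simp [dbar_of_differentiableAt hz]
    exact this.continuousAt
  · exact ContinuousAt.div (contDiff_dbar_continuous hu).continuousAt continuousAt_id h

lemma complex_integral_eq_iterated {F : ℂ → ℂ} (hF : Continuous F) {R : ℝ}
    (hs : ∀ z, F z ≠ 0 → ‖z‖ < R) :
    ∫ z, F z = ∫ x : ℝ in -R..R, ∫ y : ℝ in -R..R, F (x + y * Complex.I) := by
  have hcs : HasCompactSupport F := by
    apply HasCompactSupport.of_support_subset_isCompact (isCompact_closedBall (0 : ℂ) R)
    intro z hz
    simpa using (hs z hz).le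
  have hint : MeasureTheory.Integrable F := hF.integrable_of_hasCompactSupport hcs
  have hmp := Complex.volume_preserving_equiv_real_prod.symm
  rw [← hmp.integral_comp (MeasurableEquiv.measurableEmbedding _)]
  have hint2 : MeasureTheory.Integrable
      (fun p : ℝ × ℝ => F (Complex.measurableEquivRealProd.symm p))
      (MeasureTheory.volume.prod MeasureTheory.volume) :=
    (hmp.integrable_comp_emb (MeasurableEquiv.measurableEmbedding _)).2 hint
  rw [MeasureTheory.Measure.volume_eq_prod, MeasureTheory.integral_prod _ hint2]
  have key : ∀ x : ℝ, ∫ y : ℝ, F (Complex.measurableEquivRealProd.symm (x, y)) =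
      ∫ y : ℝ in -R..R, F (x + y * Complex.I) := by
    intro x
    have e : ∀ y : ℝ, (Complex.measurableEquivRealProd.symm (x, y) : ℂ) = x + y * Complex.I := by
      intro y
      rw [Complex.measurableEquivRealProd_symm_apply, Complex.mk_eq_add_mul_I]
    simp_rw [e]
    rw [intervalIntegral.integral_eq_integral_of_support_subset]
    intro y hy
    have h1 := hs _ hy
    have h2 := (Complex.abs_im_le_norm (x + y * Complex.I)).trans_lt h1
    simp [abs_lt] at h2
    exact ⟨h2.1, h2.2.le⟩
  simp_rw [key]
  rw [intervalIntegral.integral_eq_integral_of_support_subset]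
  intro x hx
  have : ∃ y : ℝ, F (x + y * Complex.I) ≠ 0 := by
    by_contra! h
    apply hx
    simp [h]
  obtain ⟨y, hy⟩ := this
  have h1 := hs _ hy
  have h2 := (Complex.abs_re_le_norm (x + y * Complex.I)).trans_lt h1
  simp [abs_lt] at h2
  exact ⟨h2.1, h2.2.le⟩

theorem cauchy_pompeiu_zero {R : ℝ} (hR : 0 < R) : ∃ c : ℂ, c ≠ 0 ∧
    ∀ u : ℂ → ℂ, ContDiff ℝ 1 u → (∀ z, z ∈ tsupport u → ‖z‖ < R) →
    (∀ᶠ z in nhds 0, DifferentiableAt ℂ u z) →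
    u 0 = c * ∫ ζ, dbar u ζ / ζ := by
  obtain ⟨c, hc, hcI⟩ := integral_square_inv hR
  refine ⟨-c⁻¹, by simpa using hc, fun u hu hs h0 => ?_⟩
  have hud : Differentiable ℝ u := hu.differentiable one_ne_zero
  have hcont := continuous_dbar_div hu h0
  have hF := complex_integral_eq_iterated hcont (fun z hz => hs z (by
    by_contra h
    exact hz (by simp [dbar_tsupport z h])))
  set f := dslope u 0 with hf
  have hfc : Continuous f := by
    rw [continuous_iff_continuousAt]
    intro z
    by_cases hz : z = 0
    · subst hz
      exact continuousAt_dslope_same.2 h0.self_of_nhds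
    · exact (continuousAt_dslope_of_ne hz).2 hud.continuous.continuousAt
  have hfe : ∀ z, z ≠ 0 → f z = z⁻¹ * (u z - u 0) := by
    intro z hz
    rw [hf, dslope_of_ne _ hz, slope_def_field]; simp [div_eq_inv_mul]
  have hfd : ∀ z : ℂ, z ≠ 0 → HasFDerivAt f
      (((z⁻¹ : ℂ) • (fderiv ℝ u z)) + (u z - u 0) • (((-(z^2)⁻¹ : ℂ) • (1 : ℂ →L[ℂ] ℂ)).restrictScalars ℝ)) z := by
    intro z hz
    have h1 : HasFDerivAt (fun z : ℂ => z⁻¹) (((-(z^2)⁻¹ : ℂ) • (1 : ℂ →L[ℂ] ℂ)).restrictScalars ℝ) z := by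
      have := (hasDerivAt_inv hz).hasFDerivAt.restrictScalars ℝ
      have e : ((-(z^2)⁻¹ : ℂ) • (1 : ℂ →L[ℂ] ℂ)) = ContinuousLinearMap.toSpanSingleton ℂ (-(z ^ 2)⁻¹) := by
        ext; simp
      rw [e]; exact this
    have h2 := h1.mul ((hud z).hasFDerivAt.sub_const (u 0))
    refine (h2.congr_of_eventuallyEq ?_)
    filter_upwards [isOpen_ne.mem_nhds hz] with w hw
    exact hfe w hw
  have hfd' : ∀ z : ℂ, z ≠ 0 → Complex.I • fderiv ℝ f z 1 - fderiv ℝ f z Complex.I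
      = dbar u z / z := by
    intro z hz
    rw [(hfd z hz).fderiv]
    simp [dbar]
    field_simp
    ring
  have hD0 : dbar u 0 / 0 = 0 := by simp
  have key := Complex.integral_boundary_rect_of_hasFDerivAt_real_off_countable f
    (fun z => if z = 0 then 0 else fderiv ℝ f z) ⟨-R, -R⟩ ⟨R, R⟩ {0} (countable_singleton _)
    hfc.continuousOn ?_ ?_
  · have e : ∀ z : ℂ, Complex.I • (if z = 0 then 0 else fderiv ℝ f z) 1
        - (if z = 0 then 0 else fderiv ℝ f z) Complex.I = dbar u z / z := by
      intro z
      by_cases hz : z = 0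
      · simp [hz]
      · simp only [hz, if_false]; exact hfd' z hz
    simp_rw [e] at key
    rw [← hF] at key
    have hb : ∀ z : ℂ, R ≤ ‖z‖ → f z = -u 0 * z⁻¹ := by
      intro z hz
      have hz0 : z ≠ 0 := by
        rintro rfl; simp at hz; linarith
      have : u z = 0 := by
        by_contra h
        exact absurd (hs z (subset_tsupport _ h)) (not_lt.2 hz)
      rw [hfe z hz0, this]; ring
    have hb1 : ∀ x s : ℝ, |s| = R → f (x + s * Complex.I) = -u 0 * ((x : ℂ) + s * Complex.I)⁻¹ := by
      intro x s hs
      apply hb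
      have := Complex.abs_im_le_norm ((x : ℂ) + s * Complex.I)
      simp at this
      linarith
    have hb2 : ∀ x s : ℝ, |s| = R → f (s + x * Complex.I) = -u 0 * ((s : ℂ) + x * Complex.I)⁻¹ := by
      intro x s hs
      apply hb
      have := Complex.abs_re_le_norm ((s : ℂ) + x * Complex.I)
      simp at this
      linarith
    simp_rw [hb1 _ (-R) (by simp [abs_of_pos hR]), hb1 _ R (abs_of_pos hR),
      hb2 _ (-R) (by simp [abs_of_pos hR]), hb2 _ R (abs_of_pos hR),
      intervalIntegral.integral_const_mul] at key
    have k2 : ∫ z, dbar u z / z = -u 0 * c := by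
      rw [← key, ← hcI]; simp only [smul_eq_mul]; ring
    rw [k2]
    field_simp
  · intro x hx
    have hx0 : x ≠ 0 := hx.2
    simp only [hx0, if_false]
    exact (hfd x hx0).differentiableAt.hasFDerivAt
  · have : (fun z : ℂ => Complex.I • (if z = 0 then 0 else fderiv ℝ f z) 1
        - (if z = 0 then 0 else fderiv ℝ f z) Complex.I) = fun z => dbar u z / z := by
      ext z
      by_cases hz : z = 0
      · simp [hz]
      · simp only [hz, if_false]; exact hfd' z hz
    simp only at this ⊢
    rw [this]
    apply hcont.continuousOn.integrableOn_compact
    exact isCompact_uIcc.reProdIm isCompact_uIcc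

lemma dbar_comp_add (u : ℂ → ℂ) (z ζ : ℂ) : dbar (fun w => u (z + w)) ζ = dbar u (z + ζ) := by
  unfold dbar
  rw [fderiv_comp_add_left]

theorem cauchy_pompeiu {K : Set ℂ} (hK : Bornology.IsBounded K) {u : ℂ → ℂ}
    (hu : ContDiff ℝ 1 u) (hc : HasCompactSupport u) : ∃ c : ℂ, c ≠ 0 ∧
    ∀ z ∈ K, (∀ᶠ w in nhds z, DifferentiableAt ℂ u w) →
    u z = c * ∫ ζ, dbar u ζ / (ζ - z) := by
  obtain ⟨R1, hR1⟩ := hK.exists_norm_le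
  obtain ⟨R2, hR2⟩ := hc.isCompact.isBounded.exists_norm_le
  obtain ⟨c, hc0, h⟩ := cauchy_pompeiu_zero (R := |R1| + |R2| + 1) (by positivity)
  refine ⟨c, hc0, fun z hz hd => ?_⟩
  have := h (fun w => u (z + w)) (by fun_prop) ?_ ?_
  · simp only [add_zero] at this
    rw [this]
    congr 1
    rw [← MeasureTheory.integral_add_left_eq_self (fun ζ => dbar u ζ / (ζ - z)) z]
    congr 1
    ext ζ
    rw [dbar_comp_add]; simp
  · intro w hw
    have h1 : z + w ∈ tsupport u := by
      have := tsupport_comp_subset_preimage u (f := fun w => z + w) (by fun_prop) hw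
      exact this
    have h2 := hR2 _ h1
    have h3 := hR1 _ hz
    have h4 : ‖w‖ ≤ ‖z + w‖ + ‖z‖ := by
      have := norm_sub_le (z + w) z
      simpa using this
    have := le_abs_self R1
    have := le_abs_self R2
    linarith
  · have ht : Filter.Tendsto (fun w => z + w) (nhds 0) (nhds z) := by
      have : ContinuousAt (fun w : ℂ => z + w) 0 := by fun_prop
      simpa [ContinuousAt] using this
    filter_upwards [ht.eventually hd] with w hw
    exact hw.comp w (by fun_prop)

/-- For a compact set with no bounded complementary components, Cauchy kernels are
limits of polynomials. -/
lemma cauchyKernel_mem_closure {L : Set ℂ} [CompactSpace L] {ζ : ℂ}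
    (hunb : ¬ Bornology.IsBounded (connectedComponentIn Lᶜ ζ)) (f : C(L, ℂ))
    (hf : ∀ z : L, f z = (ζ - z)⁻¹) :
    f ∈ (Algebra.adjoin ℂ {(⟨fun z : L => (z : ℂ), by fun_prop⟩ : C(L, ℂ))}).topologicalClosure := by
  set idL : C(L, ℂ) := ⟨fun z : L => (z : ℂ), by fun_prop⟩ with hid
  set S := (Algebra.adjoin ℂ {idL}).topologicalClosure with hS
  have hcl : IsClosed (S : Set C(L, ℂ)) := Subalgebra.isClosed_topologicalClosure _
  have hmem : idL ∈ S := Subalgebra.le_topologicalClosure _ (Algebra.subset_adjoin rfl)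
  set x : S := ⟨idL, hmem⟩
  have hspec : spectrum ℂ (x : C(L, ℂ)) = L := by
    rw [ContinuousMap.spectrum_eq_range]
    ext z; simp [x, hid]
  have hns : ζ ∉ spectrum ℂ x := by
    intro h
    have := Subalgebra.spectrum_isBounded_connectedComponentIn S x h
    rw [hspec] at this
    exact hunb this
  rw [spectrum.notMem_iff] at hns
  obtain ⟨v, hv⟩ := hns
  have h1 : ((v⁻¹ : Sˣ) : S) * (algebraMap ℂ S ζ - x) = 1 := by
    rw [← hv]; simp
  have h2 : (((v⁻¹ : Sˣ) : S) : C(L, ℂ)) = f := by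
    ext z
    rw [hf]
    have := congrArg (fun g : S => (g : C(L, ℂ)) z) h1
    simp [x, hid, Subalgebra.coe_mul] at this
    exact eq_inv_of_mul_eq_one_left this
  rw [← h2]
  exact Subtype.property _

lemma isPreconnected_exterior (R : ℝ) : IsPreconnected {z : ℂ | R < ‖z‖} := by
  have : {z : ℂ | R < ‖z‖} =
      (fun p : ℝ × ℝ => (p.1 : ℂ) * Complex.exp (p.2 * Complex.I)) '' ((Ioi R ∩ Ici 0) ×ˢ univ) := by
    ext z
    simp only [mem_ofPred_eq, mem_image, mem_prod, Prod.exists, mem_univ, and_true]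
    constructor
    · intro h
      exact ⟨‖z‖, z.arg, ⟨h, norm_nonneg z⟩, Complex.norm_mul_exp_arg_mul_I z⟩
    · rintro ⟨a, b, ⟨h1, h2⟩, rfl⟩
      rw [norm_mul, Complex.norm_exp_ofReal_mul_I, mul_one, Complex.norm_real, Real.norm_eq_abs]
      exact lt_of_lt_of_le h1 (le_abs_self a)
  rw [this]
  apply IsPreconnected.image
  · apply IsPreconnected.prod _ isPreconnected_univ
    exact ((ordConnected_Ioi.inter ordConnected_Ici).isPreconnected)
  · fun_prop

lemma not_isBounded_exterior (R : ℝ) : ¬ Bornology.IsBounded {z : ℂ | R < ‖z‖} := by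
  intro h
  obtain ⟨C, hC⟩ := h.exists_norm_le
  have h1 : ‖((|R| + |C| + 1 : ℝ) : ℂ)‖ = |R| + |C| + 1 := by
    rw [Complex.norm_real, Real.norm_eq_abs]; exact abs_of_nonneg (by positivity)
  have := hC ((|R| + |C| + 1 : ℝ) : ℂ) (by
    simp only [mem_ofPred_eq]; rw [h1]; have := le_abs_self R; have := abs_nonneg C; linarith)
  rw [h1] at this
  have := le_abs_self C
  have := abs_nonneg R
  linarith

/-- `G` has no bounded complementary component. -/
def NoHoles (G : Set ℂ) : Prop :=
  ∀ z, z ∉ G → ¬ Bornology.IsBounded (connectedComponentIn Gᶜ z)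

lemma NoHoles.exists_fill {G L : Set ℂ} (hG : NoHoles G) (hL : IsCompact L) (hLG : L ⊆ G) :
    ∃ M, IsCompact M ∧ L ⊆ M ∧ M ⊆ G ∧ NoHoles M := by
  set N : Set ℂ := {z | z ∉ L ∧ ¬ Bornology.IsBounded (connectedComponentIn Lᶜ z)} with hN
  have hcomp : ∀ z ∈ N, connectedComponentIn Lᶜ z ⊆ N := by
    intro z hz w hw
    refine ⟨connectedComponentIn_subset _ _ hw, ?_⟩
    rw [← connectedComponentIn_eq hw]
    exact hz.2
  have hNo : IsOpen N := by
    rw [isOpen_iff_mem_nhds]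
    intro z hz
    refine Filter.mem_of_superset ?_ (hcomp z hz)
    exact (hL.isClosed.isOpen_compl.connectedComponentIn).mem_nhds (mem_connectedComponentIn hz.1)
  refine ⟨Nᶜ, ?_, ?_, ?_, ?_⟩
  · apply isCompact_of_isClosed_isBounded hNo.isClosed_compl
    obtain ⟨R, hR⟩ := hL.isBounded.exists_norm_le
    rw [isBounded_iff_forall_norm_le]
    refine ⟨R, fun z hz => ?_⟩
    by_contra hlt
    push Not at hlt
    apply hz
    have hsub : {z : ℂ | R < ‖z‖} ⊆ Lᶜ := fun w hw hwL => absurd (hR w hwL) (not_le.2 hw)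
    refine ⟨hsub hlt, fun hb => not_isBounded_exterior R (hb.subset ?_)⟩
    exact (isPreconnected_exterior R).subset_connectedComponentIn hlt hsub
  · intro z hz hzN
    exact hzN.1 hz
  · intro z hz
    by_contra hzG
    apply hz
    refine ⟨fun h => hzG (hLG h), fun hb => hG z hzG (hb.subset ?_)⟩
    exact connectedComponentIn_mono _ (compl_subset_compl.2 hLG)
  · intro z hz hb
    rw [compl_compl] at hb
    have hz' : z ∈ N := by simpa using hz
    refine hz'.2 (hb.subset ?_)
    exact isPreconnected_connectedComponentIn.subset_connectedComponentIn
      (mem_connectedComponentIn hz'.1) (hcomp z hz')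

lemma exists_cutoff {M G : Set ℂ} (hM : IsCompact M) (hG : IsOpen G) (hMG : M ⊆ G) :
    ∃ χ : ℂ → ℝ, ContDiff ℝ 1 χ ∧ HasCompactSupport χ ∧ tsupport χ ⊆ G ∧
      ∃ O, IsOpen O ∧ M ⊆ O ∧ O ⊆ G ∧ ∀ z ∈ O, χ z = 1 := by
  obtain ⟨V, hVo, hMV, hVG, hVc⟩ := exists_open_between_and_isCompact_closure hM hG hMG
  obtain ⟨f, hf1, hf0, -⟩ := exists_contMDiffMap_one_nhds_of_subset_interior
    (modelWithCornersSelf ℝ ℂ) (n := 1) hM.isClosed (t := V) (by rwa [hVo.interior_eq])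
  have hts : tsupport f ⊆ closure V := closure_mono (fun z hz => by
    by_contra h; exact hz (hf0 z h))
  rw [eventually_nhdsSet_iff_exists] at hf1
  obtain ⟨O, hO, hMO, hO1⟩ := hf1
  refine ⟨f, ?_, ?_, hts.trans hVG, O ∩ G, hO.inter hG, subset_inter hMO hMG, inter_subset_right,
    fun z hz => hO1 z hz.1⟩
  · have := f.contMDiff
    rw [contMDiff_iff_contDiff] at this
    exact this
  · exact hVc.of_isClosed_subset (isClosed_tsupport _) hts

theorem runge_polynomial {G : Set ℂ} (hGo : IsOpen G) (hG : NoHoles G) {h : ℂ → ℂ}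
    (hh : DifferentiableOn ℂ h G) {L : Set ℂ} (hL : IsCompact L) (hLG : L ⊆ G) {ε : ℝ}
    (hε : 0 < ε) : ∃ P : Polynomial ℂ, ∀ z ∈ L, ‖P.eval z - h z‖ < ε := by
  obtain ⟨M, hM, hLM, hMG, hMN⟩ := hG.exists_fill hL hLG
  obtain ⟨χ, hχ, hχc, hχG, O, hO, hMO, hOG, hO1⟩ := exists_cutoff hM hGo hMG
  set u : ℂ → ℂ := fun z => (χ z : ℂ) * h z with hu
  have hud : ContDiff ℝ 1 u := by
    rw [contDiff_iff_contDiffAt]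
    intro z
    by_cases hz : z ∈ tsupport χ
    · have h1 : ContDiffAt ℂ 1 h z :=
        (hh.contDiffOn hGo).contDiffAt (hGo.mem_nhds (hχG hz))
      have h2 : ContDiffAt ℝ 1 h z := h1.restrict_scalars ℝ
      have h3 : ContDiffAt ℝ 1 (fun z => (χ z : ℂ)) z :=
        Complex.ofRealCLM.contDiff.contDiffAt.comp z hχ.contDiffAt
      exact h3.mul h2
    · have : u =ᶠ[nhds z] fun _ => 0 := by
        filter_upwards [(isClosed_tsupport χ).isOpen_compl.mem_nhds hz] with w hw
        simp [hu, image_eq_zero_of_notMem_tsupport hw]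
      exact contDiffAt_const.congr_of_eventuallyEq this
  have huc : HasCompactSupport u := by
    apply hχc.mono
    intro z hz hz'
    exact hz (by simp [hu, hz'])
  have huO : ∀ z ∈ O, ∀ᶠ w in nhds z, DifferentiableAt ℂ u w := by
    intro z hz
    filter_upwards [hO.mem_nhds hz] with w hw
    have : u =ᶠ[nhds w] h := by
      filter_upwards [hO.mem_nhds hw] with v hv
      simp [hu, hO1 v hv]
    exact (hh.differentiableAt (hGo.mem_nhds (hOG hw))).congr_of_eventuallyEq this
  have hDO : ∀ z ∈ O, dbar u z = 0 := fun z hz =>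
    dbar_of_differentiableAt (huO z hz).self_of_nhds
  have hDc : Continuous (dbar u) := contDiff_dbar_continuous hud
  obtain ⟨c, hc0, hc⟩ := cauchy_pompeiu hM.isBounded hud huc
  have : CompactSpace M := isCompact_iff_compactSpace.1 hM
  -- the kernel
  set k : C(ℂ × M, ℂ) := ⟨fun p => dbar u p.1 / (p.1 - p.2), by
    rw [continuous_iff_continuousAt]
    rintro ⟨ζ, z⟩
    by_cases hζ : ζ ∈ O
    · have : (fun p : ℂ × M => dbar u p.1 / (p.1 - p.2)) =ᶠ[nhds (ζ, z)] fun _ => 0 := by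
        filter_upwards [(hO.preimage continuous_fst).mem_nhds
          (show (ζ, z) ∈ Prod.fst ⁻¹' O from hζ)] with p hp
        simp [hDO p.1 hp]
      exact this.continuousAt
    · have hne : ζ - z ≠ 0 := by
        intro h0
        exact hζ (by rw [sub_eq_zero.1 h0]; exact hMO z.2)
      exact ContinuousAt.div (by fun_prop) (by fun_prop) hne⟩ with hk
  set A := (Algebra.adjoin ℂ {(⟨fun z : M => (z : ℂ), by fun_prop⟩ : C(M, ℂ))}).topologicalClosure
    with hA
  have : CompleteSpace A := (Subalgebra.isClosed_topologicalClosure _).completeSpace_coe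
  have hkA : ∀ ζ, k.curry ζ ∈ A := by
    intro ζ
    by_cases hζ : ζ ∈ O
    · have : k.curry ζ = 0 := by ext z; simp [hk, hDO ζ hζ]
      rw [this]; exact A.zero_mem
    · have hζM : ζ ∉ M := fun h => hζ (hMO h)
      set f : C(M, ℂ) := ⟨fun z => (ζ - z)⁻¹, by
        apply Continuous.inv₀ (by fun_prop)
        intro z h0
        exact hζM (by rw [sub_eq_zero.1 h0]; exact z.2)⟩ with hf
      have hfA : f ∈ A := cauchyKernel_mem_closure (hMN ζ hζM) f (fun z => rfl)
      have : k.curry ζ = (dbar u ζ) • f := by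
        ext z; simp [hk, hf, div_eq_mul_inv]
      rw [this]; exact A.smul_mem hfA _
  set κ : ℂ → A := fun ζ => ⟨k.curry ζ, hkA ζ⟩ with hκ
  have hκc : Continuous κ := Continuous.subtype_mk k.curry.continuous _
  have hκs : HasCompactSupport κ := by
    apply HasCompactSupport.of_support_subset_isCompact huc
    intro ζ hζ
    by_contra hn
    apply hζ
    have : k.curry ζ = 0 := by ext z; simp [hk, dbar_tsupport ζ hn]
    exact Subtype.ext this
  have hκi : MeasureTheory.Integrable κ := hκc.integrable_of_hasCompactSupport hκs
  have hmem : (⟨fun z : M => h z, (hh.continuousOn.mono hMG).domRestrict⟩ : C(M, ℂ)) ∈ A := by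
    have h1 : (⟨fun z : M => h z, (hh.continuousOn.mono hMG).domRestrict⟩ : C(M, ℂ)) =
        c • ((∫ ζ, κ ζ : A) : C(M, ℂ)) := by
      ext z
      have e1 : ((∫ ζ, κ ζ : A) : C(M, ℂ)) z = ∫ ζ, dbar u ζ / (ζ - z) := by
        have h2 := (((ContinuousMap.evalCLM ℂ z).comp
          (A.toSubmodule.subtypeL)).integral_comp_comm hκi)
        exact h2.symm
      rw [ContinuousMap.smul_apply, e1, smul_eq_mul, ← hc z z.2 (huO z (hMO z.2))]
      simp only [hu, hO1 z (hMO z.2), Complex.ofReal_one, one_mul]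
      rfl
    rw [h1]
    exact A.smul_mem (Subtype.property _) _
  rw [hA, ← SetLike.mem_coe, Subalgebra.topologicalClosure_coe, Metric.mem_closure_iff] at hmem
  obtain ⟨g, hg, hgd⟩ := hmem ε hε
  rw [SetLike.mem_coe, Algebra.adjoin_singleton_eq_range_aeval] at hg
  obtain ⟨P, rfl⟩ := hg
  refine ⟨P, fun z hz => ?_⟩
  have h1 := (ContinuousMap.dist_apply_le_dist (⟨z, hLM hz⟩ : M)).trans_lt hgd
  rw [dist_comm, dist_eq_norm] at h1
  have := Polynomial.aeval_algHom_apply (ContinuousMap.evalAlgHom ℂ ℂ (⟨z, hLM hz⟩ : M))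
    (⟨fun z : M => (z : ℂ), by fun_prop⟩ : C(M, ℂ)) P
  rw [ContinuousMap.evalAlgHom_apply, ContinuousMap.coe_mk, Polynomial.coe_aeval_eq_eval] at this
  rw [this]
  exact h1

lemma Polynomial.exists_primitive (P : Polynomial ℂ) : ∃ Q : Polynomial ℂ, Q.derivative = P := by
  induction P using Polynomial.induction_on' with
  | add p q hp hq =>
    obtain ⟨a, rfl⟩ := hp
    obtain ⟨b, rfl⟩ := hq
    exact ⟨a + b, by simp⟩
  | monomial n a =>
    refine ⟨Polynomial.monomial (n + 1) (a / (n + 1)), ?_⟩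
    rw [Polynomial.derivative_monomial]
    have : (n + 1 : ℂ) ≠ 0 := by exact_mod_cast n.succ_ne_zero
    simp [div_mul_cancel₀ _ this]

theorem NoHoles.exists_primitive {G : Set ℂ} (hGo : IsOpen G) (hGc : IsPreconnected G)
    (hG : NoHoles G) {h : ℂ → ℂ} (hh : DifferentiableOn ℂ h G) :
    ∃ H : ℂ → ℂ, ∀ z ∈ G, HasDerivAt H (h z) z := by
  rcases G.eq_empty_or_nonempty with rfl | ⟨z0, hz0⟩
  · exact ⟨0, by simp⟩
  obtain ⟨P, hP⟩ : ∃ P : ℕ → Polynomial ℂ,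
      TendstoLocallyUniformlyOn (fun n z => (P n).eval z) h Filter.atTop G := by
    have : LocallyCompactSpace G := hGo.locallyCompactSpace
    have : SigmaCompactSpace G := sigmaCompactSpace_of_locallyCompact_secondCountable
    set E := (default : CompactExhaustion G)
    have : ∀ n : ℕ, ∃ P : Polynomial ℂ, ∀ z ∈ ((↑) '' E n : Set ℂ), ‖P.eval z - h z‖ < 1 / (n + 1) := by
      intro n
      apply runge_polynomial hGo hG hh ((E.isCompact n).image continuous_subtype_val)
      · rintro _ ⟨z, -, rfl⟩; exact z.2
      · positivity
    choose P hP using this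
    refine ⟨P, ?_⟩
    rw [tendstoLocallyUniformlyOn_iff_forall_isCompact hGo]
    intro K hKG hK
    rw [Metric.tendstoUniformlyOn_iff]
    intro ε hε
    have hK' : IsCompact ((↑) ⁻¹' K : Set G) :=
      Topology.IsEmbedding.subtypeVal.isInducing.isCompact_preimage' hK (by simpa using hKG)
    obtain ⟨N, hN⟩ := E.exists_superset_of_isCompact hK'
    obtain ⟨N2, hN2⟩ := exists_nat_one_div_lt hε
    filter_upwards [Filter.eventually_ge_atTop (max N N2)] with n hn z hz
    have h1 : z ∈ ((↑) '' E n : Set ℂ) :=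
      ⟨⟨z, hKG hz⟩, E.subset ((le_max_left _ _).trans hn) (hN hz), rfl⟩
    rw [dist_comm, dist_eq_norm]
    refine (hP n z h1).trans_le (le_trans ?_ hN2.le)
    apply one_div_le_one_div_of_le (by positivity)
    have : (N2 : ℝ) ≤ n := by exact_mod_cast (le_max_right _ _).trans hn
    linarith
  choose Q0 hQ0 using fun n => (P n).exists_primitive
  set Q : ℕ → ℂ → ℂ := fun n z => (Q0 n).eval z - (Q0 n).eval z0 with hQ
  have hQd : ∀ n z, HasDerivAt (Q n) ((P n).eval z) z := by
    intro n z
    have := (Q0 n).hasDerivAt z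
    rw [hQ0] at this
    exact this.sub_const _
  set t := {y | y ∈ G ∧ Cauchy (Filter.map (fun n => Q n y) Filter.atTop)} with ht
  have hball : ∀ x ∈ G, ∃ ε > 0, ball x ε ⊆ G ∧
      UniformCauchySeqOn (fun n z => (P n).eval z) Filter.atTop (ball x ε) := by
    intro x hx
    obtain ⟨ε, hε, hεG⟩ := Metric.isOpen_iff.1 hGo x hx
    refine ⟨ε / 2, by positivity, (ball_subset_ball (by linarith)).trans hεG, ?_⟩
    have := (tendstoLocallyUniformlyOn_iff_forall_isCompact hGo).1 hP (closedBall x (ε / 2))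
      ((closedBall_subset_ball (by linarith)).trans hεG) (isCompact_closedBall _ _)
    exact (this.mono ball_subset_closedBall).uniformCauchySeqOn
  have hA : ∀ x y ε, y ∈ t → y ∈ ball x ε → ball x ε ⊆ G →
      UniformCauchySeqOn (fun n z => (P n).eval z) Filter.atTop (ball x ε) → ball x ε ⊆ t := by
    intro x y ε hy hyx hG' hu w hw
    refine ⟨hG' hw, ?_⟩
    exact cauchy_map_of_uniformCauchySeqOn_fderiv (𝕜 := ℂ) (s := ball x ε) isOpen_ball
      (convex_ball x ε).isPreconnected
      (f' := fun n z => ContinuousLinearMap.toSpanSingleton ℂ ((P n).eval z))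
      (by
        have := (ContinuousLinearMap.toSpanSingletonCLE (𝕜 := ℂ) (E := ℂ)).lipschitz.uniformContinuous.comp_uniformCauchySeqOn hu
        exact this)
      (fun n z _ => (hQd n z).hasFDerivAt) hyx hw hy.2
  have hsub : G ⊆ t := by
    apply hGc.subset_of_closure_inter_subset
    · rw [Metric.isOpen_iff]
      intro x hx
      obtain ⟨ε, hε, h1, h2⟩ := hball x hx.1
      exact ⟨ε, hε, hA x x ε hx (mem_ball_self hε) h1 h2⟩
    · refine ⟨z0, hz0, hz0, ?_⟩
      have : (fun n => Q n z0) = fun _ => 0 := by ext n; simp [hQ]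
      rw [this]
      exact (tendsto_const_nhds (x := (0:ℂ))).cauchy_map
    · rintro x ⟨hxt, hxG⟩
      obtain ⟨ε, hε, h1, h2⟩ := hball x hxG
      obtain ⟨y, hy, hxy⟩ := Metric.mem_closure_iff.1 hxt ε hε
      exact hA x y ε hy (by rwa [mem_ball, dist_comm]) h1 h2 (mem_ball_self hε)
  have hlim : ∀ x : ℂ, ∃ l, x ∈ G → Filter.Tendsto (fun n => Q n x) Filter.atTop (nhds l) := by
    intro x
    by_cases hx : x ∈ G
    · obtain ⟨l, hl⟩ := CompleteSpace.complete (hsub hx).2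
      exact ⟨l, fun _ => hl⟩
    · exact ⟨0, fun h => absurd h hx⟩
  choose H hH using hlim
  refine ⟨H, fun z hz => ?_⟩
  exact hasDerivAt_of_tendstoLocallyUniformlyOn hGo hP
    (Filter.Eventually.of_forall fun n x _ => hQd n x) (fun x hx => hH x hx) hz

theorem NoHoles.exists_log {G : Set ℂ} (hGo : IsOpen G) (hGc : IsPreconnected G)
    (hG : NoHoles G) {g : ℂ → ℂ} (hg : DifferentiableOn ℂ g G) (hg0 : ∀ z ∈ G, g z ≠ 0) :
    ∃ l : ℂ → ℂ, DifferentiableOn ℂ l G ∧ ∀ z ∈ G, Complex.exp (l z) = g z := by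
  rcases G.eq_empty_or_nonempty with rfl | ⟨z0, hz0⟩
  · exact ⟨0, by simp, by simp⟩
  have hgd : ∀ z ∈ G, HasDerivAt g (deriv g z) z := fun z hz =>
    (hg.differentiableAt (hGo.mem_nhds hz)).hasDerivAt
  obtain ⟨H, hH⟩ := hG.exists_primitive hGo hGc (h := fun z => deriv g z / g z)
    ((hg.deriv hGo).div hg hg0)
  set l : ℂ → ℂ := fun z => H z - H z0 + Complex.log (g z0) with hl
  have hld : ∀ z ∈ G, HasDerivAt l (deriv g z / g z) z := fun z hz =>
    ((hH z hz).sub_const _).add_const _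
  refine ⟨l, fun z hz => (hld z hz).differentiableAt.differentiableWithinAt, ?_⟩
  have hq : ∀ z ∈ G, HasDerivAt (fun z => Complex.exp (l z) / g z) 0 z := by
    intro z hz
    have := ((hld z hz).cexp.div (hgd z hz) (hg0 z hz))
    have h0 := hg0 z hz
    have e : (Complex.exp (l z) * (deriv g z / g z) * g z - Complex.exp (l z) * deriv g z) / g z ^ 2 = 0 := by
      rw [mul_assoc, div_mul_cancel₀ _ h0, sub_self, zero_div]
    rw [← e]
    exact this
  intro z hz
  have hc : Complex.exp (l z) / g z = Complex.exp (l z0) / g z0 := by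
    refine hGo.is_const_of_deriv_eq_zero hGc
      (fun w hw => (hq w hw).differentiableAt.differentiableWithinAt)
      (fun w hw => (hq w hw).deriv) hz hz0
  have : Complex.exp (l z0) = g z0 := by simp [hl, Complex.exp_log (hg0 z0 hz0)]
  rw [this, div_self (hg0 z0 hz0), div_eq_one_iff_eq (hg0 z hz)] at hc
  exact hc

/-- **Hurwitz's theorem.** -/
theorem hurwitz {G : Set ℂ} (hGo : IsOpen G) (hGc : IsPreconnected G) {ι : Type*}
    {l : Filter ι} [l.NeBot] {F : ι → ℂ → ℂ} {f : ℂ → ℂ}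
    (hF : ∀ n, DifferentiableOn ℂ (F n) G) (hF0 : ∀ n, ∀ z ∈ G, F n z ≠ 0)
    (hlim : TendstoLocallyUniformlyOn F f l G) :
    (∀ z ∈ G, f z ≠ 0) ∨ (∀ z ∈ G, f z = 0) := by
  by_contra! hcon
  obtain ⟨⟨a, haG, ha⟩, b, hbG, hb⟩ := hcon
  have hf : DifferentiableOn ℂ f G :=
    hlim.differentiableOn (Filter.Eventually.of_forall hF) hGo
  have hfa : AnalyticOnNhd ℂ f G := hf.analyticOnNhd hGo
  rcases (hfa a haG).eventually_eq_zero_or_eventually_ne_zero with h | h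
  · exact hb (hfa.eqOn_zero_of_preconnected_of_eventuallyEq_zero hGc haG h hbG)
  · rw [eventually_nhdsWithin_iff, Metric.eventually_nhds_iff] at h
    obtain ⟨ε, hε, h⟩ := h
    obtain ⟨δ, hδ, hδG⟩ := Metric.isOpen_iff.1 hGo a haG
    set ρ := min (ε / 2) (δ / 2) with hρ
    have hρ0 : 0 < ρ := by positivity
    have hρε : ρ < ε := (min_le_left _ _).trans_lt (by linarith)
    have hρδ : ρ < δ := (min_le_right _ _).trans_lt (by linarith)
    have hcG : closedBall a ρ ⊆ G := (closedBall_subset_ball hρδ).trans hδG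
    have hsne : (sphere a ρ).Nonempty := NormedSpace.sphere_nonempty.2 hρ0.le
    obtain ⟨z1, hz1, hmin⟩ := (isCompact_sphere a ρ).exists_isMinOn hsne
      (hf.continuousOn.mono (sphere_subset_closedBall.trans hcG)).norm
    set m := ‖f z1‖ with hm
    have hm0 : 0 < m := by
      rw [hm, norm_pos_iff]
      apply h (by rw [mem_sphere.1 hz1]; exact hρε)
      rintro rfl
      simp at hz1; linarith
    have hu := (tendstoLocallyUniformlyOn_iff_forall_isCompact hGo).1 hlim _ hcG
      (isCompact_closedBall a ρ)
    rw [Metric.tendstoUniformlyOn_iff] at hu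
    obtain ⟨n, hn⟩ := (hu (m / 2) (by positivity)).exists
    have h1 : ‖F n a‖ < m / 2 := by
      have := hn a (mem_closedBall_self hρ0.le)
      rwa [ha, dist_zero_left] at this
    have h2 : ∀ z ∈ sphere a ρ, m / 2 ≤ ‖F n z‖ := by
      intro z hz
      have e1 := hn z (sphere_subset_closedBall hz)
      have e2 : m ≤ ‖f z‖ := hmin hz
      have e3 := norm_sub_norm_le (f z) (F n z)
      rw [dist_eq_norm] at e1
      linarith
    have h3 : ‖(F n a)⁻¹‖ ≤ (m / 2)⁻¹ := by
      apply Complex.norm_le_of_forall_mem_frontier_norm_le (f := fun z => (F n z)⁻¹)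
        (U := ball a ρ) isBounded_ball
      · apply DifferentiableOn.diffContOnCl
        rw [closure_ball _ hρ0.ne']
        exact ((hF n).mono hcG).inv (fun z hz => hF0 n z (hcG hz))
      · intro z hz
        rw [frontier_ball _ hρ0.ne'] at hz
        rw [norm_inv]
        exact inv_anti₀ (by positivity) (h2 z hz)
      · exact subset_closure (mem_ball_self hρ0)
    rw [norm_inv] at h3
    have := (inv_le_inv₀ (norm_pos_iff.2 (hF0 n a haG)) (by positivity)).1 h3
    linarith

/-- The class of normalized injective holomorphic maps into the unit disc. -/
structure DiscMap (G : Set ℂ) (z0 : ℂ) (f : ℂ → ℂ) : Prop where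
  diff : DifferentiableOn ℂ f G
  inj : InjOn f G
  maps : MapsTo f G (ball 0 1)
  deriv_ne : ∀ z ∈ G, deriv f z ≠ 0
  zero : f z0 = 0

lemma DiscMap.limit {G : Set ℂ} (hGo : IsOpen G) (hGc : IsPreconnected G) {z0 : ℂ} (hz0 : z0 ∈ G)
    {F : ℕ → ℂ → ℂ} (hF : ∀ n, DiscMap G z0 (F n)) {M : ℝ} (hM : 0 < M)
    (hlimM : Filter.Tendsto (fun n => ‖deriv (F n) z0‖) Filter.atTop (nhds M)) :
    ∃ f, DiscMap G z0 f ∧ ‖deriv f z0‖ = M := by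
  set l : Ultrafilter ℕ := Ultrafilter.of Filter.atTop with hl
  have hpt : ∀ z, ∃ w, z ∈ G → Filter.Tendsto (fun n => F n z) l (nhds w) := by
    intro z
    by_cases hz : z ∈ G
    · obtain ⟨w, -, hw⟩ := isCompact_iff_ultrafilter_le_nhds.1 (isCompact_closedBall (0:ℂ) 1)
        (l.map (fun n => F n z)) (by
          rw [Filter.le_principal_iff, Ultrafilter.mem_coe, Ultrafilter.mem_map]
          exact Filter.univ_mem' (fun n => ball_subset_closedBall ((hF n).maps hz)))
      exact ⟨w, fun _ => hw⟩
    · exact ⟨0, fun h => absurd h hz⟩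
  choose f hf using hpt
  have hle : ∀ z ∈ G, ‖f z‖ ≤ 1 := by
    intro z hz
    exact le_of_tendsto (hf z hz).norm (Filter.Eventually.of_forall fun n => by
      simpa using (mem_ball_zero_iff.1 ((hF n).maps hz)).le)
  have hloc : TendstoLocallyUniformlyOn F f l G := by
    rw [Metric.tendstoLocallyUniformlyOn_iff]
    intro ε hε x hx
    obtain ⟨δ, hδ, hδG⟩ := Metric.isOpen_iff.1 hGo x hx
    have hlip : ∀ n, ∀ y ∈ ball x δ, dist (F n y) (F n x) ≤ 2 / δ * dist y x := by
      intro n y hy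
      apply Complex.dist_le_div_mul_dist_of_mapsTo_ball (((hF n).diff).mono hδG) _ hy
      intro w hw
      have h1 := mem_ball_zero_iff.1 ((hF n).maps (hδG hw))
      have h2 := mem_ball_zero_iff.1 ((hF n).maps hx)
      rw [mem_closedBall, dist_eq_norm]
      have := norm_sub_le (F n w) (F n x)
      linarith
    set η := min δ (ε / 4 * (δ / 2)) with hη
    have hη0 : 0 < η := by positivity
    have hsm : ∀ n, ∀ y ∈ ball x η, dist (F n y) (F n x) ≤ ε / 4 := by
      intro n y hy
      refine (hlip n y (ball_subset_ball (min_le_left _ _) hy)).trans ?_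
      have h3 : dist y x ≤ ε / 4 * (δ / 2) := (mem_ball.1 hy).le.trans (min_le_right _ _)
      calc 2 / δ * dist y x ≤ 2 / δ * (ε / 4 * (δ / 2)) := by gcongr
        _ = ε / 4 := by field_simp
    have hball : ball x η ⊆ G := (ball_subset_ball (min_le_left _ _)).trans hδG
    refine ⟨ball x η, mem_nhdsWithin_of_mem_nhds (ball_mem_nhds x hη0), ?_⟩
    have h4 : ∀ᶠ n in (l : Filter ℕ), dist (F n x) (f x) < ε / 4 :=
      (Metric.tendsto_nhds.1 (hf x hx)) _ (by positivity)
    filter_upwards [h4] with n hn y hy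
    have h5 : dist (f y) (f x) ≤ ε / 4 :=
      le_of_tendsto ((hf y (hball hy)).dist (hf x hx))
        (Filter.Eventually.of_forall fun m => hsm m y hy)
    have h6 := hsm n y hy
    have := dist_triangle4 (f y) (f x) (F n x) (F n y)
    rw [dist_comm (f x), dist_comm (F n x) (F n y)] at this
    linarith
  have hFd : ∀ᶠ n in (l : Filter ℕ), DifferentiableOn ℂ (F n) G :=
    Filter.Eventually.of_forall fun n => (hF n).diff
  have hfd : DifferentiableOn ℂ f G := hloc.differentiableOn hFd hGo
  have hder := hloc.deriv hFd hGo
  have hMeq : ‖deriv f z0‖ = M := by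
    have h1 : Filter.Tendsto (fun n => ‖deriv (F n) z0‖) l (nhds ‖deriv f z0‖) :=
      (hder.tendsto_at hz0).norm
    exact tendsto_nhds_unique h1 (hlimM.mono_left (Ultrafilter.of_le _))
  have hne0 : deriv f z0 ≠ 0 := by
    rw [← norm_pos_iff, hMeq]; exact hM
  have hf0 : f z0 = 0 := by
    refine tendsto_nhds_unique (hf z0 hz0) ?_
    simp_rw [fun n => (hF n).zero]
    exact tendsto_const_nhds
  have hnc : ∀ a c, a ∈ G → ¬ (f =ᶠ[nhds a] fun _ => c) := by
    intro a c ha h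
    have h2 : EqOn f (fun _ => c) G := (hfd.analyticOnNhd hGo).eqOn_of_preconnected_of_eventuallyEq
      (fun _ _ => analyticAt_const) hGc ha h
    apply hne0
    have h3 : f =ᶠ[nhds z0] fun _ => c := h2.eventuallyEq_of_mem (hGo.mem_nhds hz0)
    rw [h3.deriv_eq]; simp
  refine ⟨f, ⟨hfd, ?_, ?_, ?_, hf0⟩, hMeq⟩
  · intro a ha b hb hab
    by_contra hne
    obtain ⟨δ, hδ, hδG⟩ := Metric.isOpen_iff.1 (hGo.sdiff (isClosed_singleton (x := a))) b
      ⟨hb, fun h => hne h.symm⟩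
    have hconst : TendstoLocallyUniformlyOn (fun n _ => F n a) (fun _ => f a) (l : Filter ℕ)
        (ball b δ) := by
      rw [Metric.tendstoLocallyUniformlyOn_iff]
      intro ε hε x hx
      refine ⟨univ, Filter.univ_mem, ?_⟩
      filter_upwards [(Metric.tendsto_nhds.1 (hf a ha)) ε hε] with n hn y _
      rwa [dist_comm]
    have hs := (hloc.mono (fun z hz => (hδG hz).1)).sub hconst
    rcases hurwitz isOpen_ball (convex_ball b δ).isPreconnected
      (fun n => (((hF n).diff.mono (fun z hz => (hδG hz).1)).sub
        (differentiableOn_const (c := F n a))))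
      (fun n z hz h0 => (hδG hz).2 ((hF n).inj (hδG hz).1 ha (sub_eq_zero.1 h0))) hs with h | h
    · exact h b (mem_ball_self hδ) (by simp [hab])
    · apply hnc b (f a) hb
      filter_upwards [ball_mem_nhds b hδ] with z hz
      exact sub_eq_zero.1 (h z hz)
  · intro z hz
    rw [mem_ball_zero_iff]
    refine lt_of_le_of_ne (hle z hz) fun h1 => ?_
    have := Complex.norm_eqOn_of_isPreconnected_of_isMaxOn hGc hGo hfd hz
      (fun w hw => by simpa [h1] using hle w hw) hz0
    simp [hf0, h1] at this
  · rcases hurwitz hGo hGc (fun n => ((hF n).diff.deriv hGo)) (fun n => (hF n).deriv_ne) hder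
      with h | h
    · exact h
    · exact absurd (h z0 hz0) hne0

/-- The Möbius automorphism of the unit disc moving `a` to `0`. -/
def mobius (a w : ℂ) : ℂ := (w - a) / (1 - (starRingEnd ℂ) a * w)

lemma mobius_den_ne {a w : ℂ} (ha : ‖a‖ < 1) (hw : ‖w‖ < 1) : 1 - (starRingEnd ℂ) a * w ≠ 0 := by
  intro h
  have h1 : ‖(starRingEnd ℂ) a * w‖ = 1 := by
    rw [← sub_eq_zero.1 h]; simp
  rw [norm_mul, RCLike.norm_conj] at h1
  nlinarith [norm_nonneg a, norm_nonneg w]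

lemma norm_mobius_lt {a w : ℂ} (ha : ‖a‖ < 1) (hw : ‖w‖ < 1) : ‖mobius a w‖ < 1 := by
  have hd := mobius_den_ne ha hw
  rw [mobius, norm_div, div_lt_one (norm_pos_iff.2 hd)]
  apply lt_of_pow_lt_pow_left₀ 2 (norm_nonneg _)
  have e : ‖1 - (starRingEnd ℂ) a * w‖ ^ 2 - ‖w - a‖ ^ 2 = (1 - ‖a‖ ^ 2) * (1 - ‖w‖ ^ 2) := by
    simp only [Complex.sq_norm, Complex.normSq_apply, Complex.sub_re, Complex.sub_im,
      Complex.mul_re, Complex.mul_im, Complex.conj_re, Complex.conj_im, Complex.one_re,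
      Complex.one_im]
    ring
  have h1 : 0 < 1 - ‖a‖ ^ 2 := by nlinarith [norm_nonneg a]
  have h2 : 0 < 1 - ‖w‖ ^ 2 := by nlinarith [norm_nonneg w]
  nlinarith [mul_pos h1 h2]

lemma hasDerivAt_mobius {a w : ℂ} (ha : ‖a‖ < 1) (hw : ‖w‖ < 1) :
    HasDerivAt (mobius a) ((1 - ‖a‖ ^ 2 : ℝ) / (1 - (starRingEnd ℂ) a * w) ^ 2) w := by
  have h := ((hasDerivAt_id w).sub_const a).div
    (((hasDerivAt_id w).const_mul ((starRingEnd ℂ) a)).const_sub 1) (mobius_den_ne ha hw)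
  refine h.congr_deriv ?_
  congr 1
  have : ((‖a‖ ^ 2 : ℝ) : ℂ) = (starRingEnd ℂ) a * a := by
    rw [mul_comm, Complex.mul_conj, Complex.sq_norm]
  push_cast at this ⊢
  rw [this]; simp only [id]; ring

lemma mobius_deriv_ne {a w : ℂ} (ha : ‖a‖ < 1) (hw : ‖w‖ < 1) :
    ((1 - ‖a‖ ^ 2 : ℝ) : ℂ) / (1 - (starRingEnd ℂ) a * w) ^ 2 ≠ 0 := by
  apply div_ne_zero
  · rw [Complex.ofReal_ne_zero]
    nlinarith [norm_nonneg a]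
  · exact pow_ne_zero _ (mobius_den_ne ha hw)

lemma injOn_mobius {a : ℂ} (ha : ‖a‖ < 1) : InjOn (mobius a) (ball 0 1) := by
  intro w hw v hv h
  rw [mem_ball_zero_iff] at hw hv
  rw [mobius, mobius, div_eq_div_iff (mobius_den_ne ha hw) (mobius_den_ne ha hv)] at h
  have h1 : (w - v) * (1 - (starRingEnd ℂ) a * a) = 0 := by linear_combination h
  rcases mul_eq_zero.1 h1 with h2 | h2
  · exact sub_eq_zero.1 h2
  · exfalso
    rw [mul_comm, Complex.mul_conj, ← Complex.sq_norm] at h2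
    norm_cast at h2
    nlinarith [norm_nonneg a]

lemma DiscMap.exists_larger {G : Set ℂ} (hGo : IsOpen G) (hGc : IsPreconnected G)
    (hG : NoHoles G) {z0 : ℂ} (hz0 : z0 ∈ G) {f : ℂ → ℂ} (hf : DiscMap G z0 f) {a : ℂ}
    (ha : ‖a‖ < 1) (haf : a ∉ f '' G) :
    ∃ k, DiscMap G z0 k ∧ ‖deriv f z0‖ < ‖deriv k z0‖ := by
  have hfb : ∀ z ∈ G, ‖f z‖ < 1 := fun z hz => mem_ball_zero_iff.1 (hf.maps hz)
  have hfd : ∀ z ∈ G, HasDerivAt f (deriv f z) z := fun z hz =>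
    (hf.diff.differentiableAt (hGo.mem_nhds hz)).hasDerivAt
  set g : ℂ → ℂ := fun z => mobius a (f z) with hg
  have hgd : ∀ z ∈ G, HasDerivAt g (((1 - ‖a‖ ^ 2 : ℝ) : ℂ) /
      (1 - (starRingEnd ℂ) a * f z) ^ 2 * deriv f z) z := fun z hz =>
    (hasDerivAt_mobius ha (hfb z hz)).comp z (hfd z hz)
  have hg0 : ∀ z ∈ G, g z ≠ 0 := by
    intro z hz h
    rw [hg] at h
    rcases div_eq_zero_iff.1 h with h | h
    · exact haf ⟨z, hz, sub_eq_zero.1 h⟩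
    · exact mobius_den_ne ha (hfb z hz) h
  obtain ⟨l, hl, hle⟩ := hG.exists_log hGo hGc
    (fun z hz => (hgd z hz).differentiableAt.differentiableWithinAt) hg0
  set h : ℂ → ℂ := fun z => Complex.exp (l z / 2) with hh
  have hsq : ∀ z ∈ G, h z ^ 2 = g z := by
    intro z hz
    rw [hh, ← hle z hz]
    simp only
    rw [← Complex.exp_nat_mul]; congr 1; push_cast; ring
  have hhd : ∀ z ∈ G, HasDerivAt h (deriv h z) z := by
    intro z hz
    apply DifferentiableAt.hasDerivAt
    exact ((hl.differentiableAt (hGo.mem_nhds hz)).div_const 2).cexp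
  have hder : ∀ z ∈ G, 2 * h z * deriv h z = ((1 - ‖a‖ ^ 2 : ℝ) : ℂ) /
      (1 - (starRingEnd ℂ) a * f z) ^ 2 * deriv f z := by
    intro z hz
    have h1 : HasDerivAt g (2 * h z * deriv h z) z := by
      have := (hhd z hz).pow 2
      refine HasDerivAt.congr_of_eventuallyEq ?_
        (Filter.mem_of_superset (hGo.mem_nhds hz) fun w hw => (hsq w hw).symm)
      simpa [Pi.pow_def] using this
    exact h1.unique (hgd z hz)
  have hhn : ∀ z ∈ G, ‖h z‖ < 1 := by
    intro z hz
    have h1 : ‖h z‖ ^ 2 < 1 := by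
      rw [← norm_pow, hsq z hz]; exact norm_mobius_lt ha (hfb z hz)
    nlinarith [norm_nonneg (h z)]
  set b := h z0 with hb
  have hb1 : ‖b‖ < 1 := hhn z0 hz0
  have hb0 : 0 < ‖b‖ := by rw [norm_pos_iff]; exact Complex.exp_ne_zero _
  have hkd : ∀ z ∈ G, HasDerivAt (fun z => mobius b (h z)) (((1 - ‖b‖ ^ 2 : ℝ) : ℂ) /
      (1 - (starRingEnd ℂ) b * h z) ^ 2 * deriv h z) z := fun z hz =>
    (hasDerivAt_mobius hb1 (hhn z hz)).comp z (hhd z hz)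
  have hh' : ∀ z ∈ G, deriv h z ≠ 0 := by
    intro z hz h0
    have := hder z hz
    rw [h0, mul_zero] at this
    exact mul_ne_zero (mobius_deriv_ne ha (hfb z hz)) (hf.deriv_ne z hz) this.symm
  refine ⟨fun z => mobius b (h z), ⟨?_, ?_, ?_, ?_, ?_⟩, ?_⟩
  · exact fun z hz => (hkd z hz).differentiableAt.differentiableWithinAt
  · intro z hz w hw hzw
    have h1 := injOn_mobius hb1 (mem_ball_zero_iff.2 (hhn z hz)) (mem_ball_zero_iff.2 (hhn w hw)) hzw
    have h2 : g z = g w := by rw [← hsq z hz, ← hsq w hw, h1]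
    exact hf.inj hz hw (injOn_mobius ha (hf.maps hz) (hf.maps hw) h2)
  · exact fun z hz => mem_ball_zero_iff.2 (norm_mobius_lt hb1 (hhn z hz))
  · intro z hz
    rw [(hkd z hz).deriv]
    exact mul_ne_zero (mobius_deriv_ne hb1 (hhn z hz)) (hh' z hz)
  · simp [mobius, hb]
  · rw [(hkd z0 hz0).deriv]
    have hba : ‖b‖ ^ 2 = ‖a‖ := by
      rw [← norm_pow, hb, hsq z0 hz0, hg]; simp [mobius, hf.zero]
    have e1 := congrArg norm (hder z0 hz0)
    rw [hf.zero, ← hb] at e1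
    have hbc : (1 - (starRingEnd ℂ) b * b) = ((1 - ‖b‖ ^ 2 : ℝ) : ℂ) := by
      rw [mul_comm, Complex.mul_conj, ← Complex.sq_norm]; push_cast; ring
    rw [← hb, hbc]
    simp only [mul_zero, sub_zero, one_pow, div_one, norm_mul, norm_div, norm_pow,
      Complex.norm_real, Real.norm_eq_abs] at e1 ⊢
    rw [← hba] at e1
    have p1 : 0 < 1 - ‖b‖ ^ 2 := by nlinarith
    have p2 : 0 < 1 - (‖b‖ ^ 2) ^ 2 := by nlinarith
    rw [abs_of_pos p1]
    rw [abs_of_pos p2, Complex.norm_ofNat] at e1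
    have hf0 : 0 < ‖deriv f z0‖ := norm_pos_iff.2 (hf.deriv_ne z0 hz0)
    have e2 : (1 - ‖b‖ ^ 2) / (1 - ‖b‖ ^ 2) ^ 2 * ‖deriv h z0‖ =
        (1 + ‖b‖ ^ 2) / (2 * ‖b‖) * ‖deriv f z0‖ := by
      field_simp
      have : (1 - ‖b‖ ^ 2) * (2 * ‖b‖ * ‖deriv h z0‖ ) = (1 - ‖b‖ ^ 2) * ((1 - ‖b‖ ^ 2) * (1+ ‖b‖^2) * ‖deriv f z0‖) := by
        rw [e1]; ring
      have := mul_left_cancel₀ p1.ne' this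
      linarith
    rw [e2]
    apply lt_mul_of_one_lt_left hf0
    rw [one_lt_div (by positivity)]
    nlinarith [sq_nonneg (1 - ‖b‖), mul_pos (sub_pos.2 hb1) (sub_pos.2 hb1)]

/-- **Riemann mapping theorem** for bounded connected open sets without holes. -/
theorem NoHoles.riemann_map {G : Set ℂ} (hG : NoHoles G) (hGo : IsOpen G)
    (hGc : IsPreconnected G) (hGb : Bornology.IsBounded G) {z0 : ℂ} (hz0 : z0 ∈ G) :
    ∃ f, DiscMap G z0 f ∧ f '' G = ball 0 1 := by
  obtain ⟨δ, hδ, hδG⟩ := Metric.isOpen_iff.1 hGo z0 hz0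
  set S : Set ℝ := {x | ∃ f, DiscMap G z0 f ∧ ‖deriv f z0‖ = x} with hS
  have hbdd : BddAbove S := by
    refine ⟨1 / δ, ?_⟩
    rintro _ ⟨f, hf, rfl⟩
    apply Complex.norm_deriv_le_div_of_mapsTo_ball (hf.diff.mono hδG) _ hδ
    rw [hf.zero]
    exact (hf.maps.mono_left hδG).mono_right ball_subset_closedBall
  obtain ⟨D, hD⟩ := hGb.subset_ball z0
  have hD0 : 0 < D := by
    have := hD hz0
    simpa using this
  have hid : ∀ z : ℂ, HasDerivAt (fun z : ℂ => (z - z0) / D) (1 / (D:ℂ)) z := fun z =>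
    ((hasDerivAt_id z).sub_const z0).div_const _
  have hDC : (D : ℂ) ≠ 0 := by exact_mod_cast hD0.ne'
  have hne : (1 / D) ∈ S := by
    refine ⟨fun z => (z - z0) / D, ⟨?_, ?_, ?_, ?_, by simp⟩, ?_⟩
    · exact fun z _ => (hid z).differentiableAt.differentiableWithinAt
    · intro z _ w _ h
      simpa [div_left_inj' hDC] using h
    · intro z hz
      have := hD hz
      rw [mem_ball, dist_eq_norm] at this
      rw [mem_ball_zero_iff, norm_div, Complex.norm_real, Real.norm_eq_abs, abs_of_pos hD0,
        div_lt_one hD0]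
      exact this
    · intro z _
      rw [(hid z).deriv]; simp [hDC]
    · rw [(hid z0).deriv]; simp [abs_of_pos hD0]
  obtain ⟨u, -, hu, huS⟩ := exists_seq_tendsto_sSup ⟨_, hne⟩ hbdd
  choose F hF hFu using huS
  have hM : 0 < sSup S := (by positivity : 0 < 1 / D).trans_le (le_csSup hbdd hne)
  obtain ⟨f, hf, hfM⟩ := DiscMap.limit hGo hGc hz0 hF hM (by simpa only [hFu] using hu)
  refine ⟨f, hf, Subset.antisymm hf.maps.image_subset ?_⟩
  intro a ha
  by_contra hcon
  obtain ⟨k, hk, hlt⟩ := hf.exists_larger hGo hGc hG hz0 (mem_ball_zero_iff.1 ha) hcon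
  have := le_csSup hbdd (show ‖deriv k z0‖ ∈ S from ⟨k, hk, rfl⟩)
  linarith

/-- Inverse of a univalent function. -/
lemma exists_holomorphic_inverse {G : Set ℂ} (hGo : IsOpen G) {f : ℂ → ℂ}
    (hfd : DifferentiableOn ℂ f G) (hinj : InjOn f G) (hd : ∀ z ∈ G, deriv f z ≠ 0) :
    ∃ ψ : ℂ → ℂ, (∀ z ∈ G, ψ (f z) = z) ∧ ∀ z ∈ G, HasDerivAt ψ (deriv f z)⁻¹ (f z) := by
  have hinv : ∀ z ∈ G, invFunOn f G (f z) = z := fun z hz => hinj.leftInvOn_invFunOn hz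
  have hst : ∀ z ∈ G, HasStrictDerivAt f (deriv f z) z := fun z hz =>
    ((hfd.analyticAt (hGo.mem_nhds hz))).hasStrictDerivAt
  refine ⟨invFunOn f G, hinv, fun z hz => ?_⟩
  have hmap := (hst z hz).map_nhds_eq (hd z hz)
  have himg : ∀ᶠ w in nhds (f z), w ∈ f '' G := by
    rw [← hmap, Filter.eventually_map]
    exact Filter.mem_of_superset (hGo.mem_nhds hz) fun w hw => mem_image_of_mem f hw
  refine HasDerivAt.of_local_left_inverse (f := f) ?_ ?_ (hd z hz) ?_
  · rw [ContinuousAt, hinv z hz, ← hmap, Filter.tendsto_map'_iff]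
    refine Filter.Tendsto.congr' ?_ Filter.tendsto_id
    exact Filter.mem_of_superset (hGo.mem_nhds hz) fun w hw => (hinv w hw).symm
  · rw [hinv z hz]; exact (hst z hz).hasDerivAt
  · filter_upwards [himg] with w hw
    obtain ⟨v, hv, rfl⟩ := hw
    rw [hinv v hv]

/-- The complex bilinear form on `ℂ³`. -/
def cdot (a b : Fin 3 → ℂ) : ℂ := a 0 * b 0 + a 1 * b 1 + a 2 * b 2

/-- The real part `ℂ³ → ℝ³`, as a real linear map. -/
def reV : (Fin 3 → ℂ) →L[ℝ] R3 :=
  LinearMap.toContinuousLinearMap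
    { toFun := fun a => WithLp.toLp 2 fun i => (a i).re
      map_add' := fun a b => by ext i; simp
      map_smul' := fun c a => by ext i; simp }

@[simp] lemma reV_apply (a : Fin 3 → ℂ) (i : Fin 3) : reV a i = (a i).re := rfl

lemma norm_sq_R3 (x : R3) : ‖x‖ ^ 2 = x 0 ^ 2 + x 1 ^ 2 + x 2 ^ 2 := by
  rw [EuclideanSpace.norm_sq_eq, Fin.sum_univ_three]; simp

lemma inner_R3 (x y : R3) : inner ℝ x y = x 0 * y 0 + x 1 * y 1 + x 2 * y 2 := by
  rw [PiLp.inner_apply, Fin.sum_univ_three]; simp; ring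

lemma norm_reV_le (a : Fin 3 → ℂ) : ‖reV a‖ ≤ 2 * ‖a‖ := by
  apply le_of_sq_le_sq _ (by positivity)
  rw [norm_sq_R3]
  have h : ∀ i, (a i).re ^ 2 ≤ ‖a‖ ^ 2 := by
    intro i
    rw [← sq_abs]
    have := (Complex.abs_re_le_norm (a i)).trans (norm_le_pi_norm a i)
    gcongr
  simp only [reV_apply]
  nlinarith [h 0, h 1, h 2, sq_nonneg ‖a‖]

lemma two_mul_norm_sq_reV {a : Fin 3 → ℂ} (ha : cdot a a = 0) :
    2 * ‖reV a‖ ^ 2 = ‖a 0‖ ^ 2 + ‖a 1‖ ^ 2 + ‖a 2‖ ^ 2 := by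
  have h := congrArg Complex.re ha
  simp only [cdot, Complex.add_re, Complex.mul_re, Complex.zero_re] at h
  rw [norm_sq_R3]
  simp only [reV_apply, Complex.sq_norm, Complex.normSq_apply]
  linarith

lemma cdot_smul_smul (c d : ℂ) (a b : Fin 3 → ℂ) : cdot (c • a) (d • b) = c * d * cdot a b := by
  simp only [cdot, Pi.smul_apply, smul_eq_mul]; ring

lemma norm_reV_smul {a : Fin 3 → ℂ} (ha : cdot a a = 0) (c : ℂ) :
    ‖reV (c • a)‖ = ‖c‖ * ‖reV a‖ := by
  have h1 := two_mul_norm_sq_reV ha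
  have h2 := two_mul_norm_sq_reV (a := c • a) (by rw [cdot_smul_smul, ha, mul_zero])
  simp only [Pi.smul_apply, smul_eq_mul, norm_mul] at h2
  have : ‖reV (c • a)‖ ^ 2 = (‖c‖ * ‖reV a‖) ^ 2 := by
    linear_combination h2 / 2 - ‖c‖ ^ 2 * h1 / 2
  exact (sq_eq_sq₀ (norm_nonneg _) (by positivity)).1 this

lemma reV_ne_zero {a : Fin 3 → ℂ} (ha : cdot a a = 0) (h : a ≠ 0) : reV a ≠ 0 := by
  intro h0
  have h1 := two_mul_norm_sq_reV ha
  rw [h0, norm_zero] at h1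
  apply h
  have : ∀ i, ‖a i‖ ^ 2 = 0 := by
    intro i
    fin_cases i <;> simp <;> rw [← norm_eq_zero] <;>
      nlinarith [sq_nonneg ‖a 0‖, sq_nonneg ‖a 1‖, sq_nonneg ‖a 2‖]
  ext i
  simpa using this i

/-- A real vector as a complex vector. -/
def toC (x : R3) : Fin 3 → ℂ := fun i => (x i : ℂ)

lemma re_cdot_toC (a : Fin 3 → ℂ) (x : R3) : (cdot a (toC x)).re = inner ℝ (reV a) x := by
  rw [inner_R3]; simp [cdot, toC]

lemma cdot_toC_add (a : Fin 3 → ℂ) (x y : R3) :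
    cdot a (toC (x + y)) = cdot a (toC x) + cdot a (toC y) := by
  simp [cdot, toC]; ring

lemma norm_cdot_toC_le {a : Fin 3 → ℂ} (ha : cdot a a = 0) (x : R3) :
    ‖cdot a (toC x)‖ ≤ ‖reV a‖ * ‖x‖ := by
  obtain ⟨c, hc, hc'⟩ : ∃ c : ℂ, ‖c‖ = 1 ∧ c * cdot a (toC x) = ‖cdot a (toC x)‖ := by
    by_cases h : cdot a (toC x) = 0
    · exact ⟨1, by simp, by simp [h]⟩
    · have hn : (‖cdot a (toC x)‖ : ℂ) ≠ 0 := by simpa using h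
      refine ⟨‖cdot a (toC x)‖ / cdot a (toC x), ?_, by field_simp⟩
      rw [norm_div, Complex.norm_real, norm_norm, div_self]
      simpa using h
  have h1 : (cdot (c • a) (toC x)).re = ‖cdot a (toC x)‖ := by
    have := cdot_smul_smul c 1 a (toC x)
    rw [one_smul, mul_one, hc'] at this
    rw [this]; simp
  rw [← h1, re_cdot_toC]
  refine (real_inner_le_norm _ _).trans ?_
  rw [norm_reV_smul ha, hc, one_mul]

/-- The parametrization of the null cone by spinors. -/
def spin (c d : ℂ) : Fin 3 → ℂ := ![c ^ 2 - d ^ 2, Complex.I * (c ^ 2 + d ^ 2), 2 * c * d]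

lemma cdot_spin_self (c d : ℂ) : cdot (spin c d) (spin c d) = 0 := by
  simp [cdot, spin]; linear_combination (c ^ 2 + d ^ 2) ^ 2 * Complex.I_sq

lemma spin_mul (u c d : ℂ) : spin (u * c) (u * d) = u ^ 2 • spin c d := by
  ext i; fin_cases i <;> simp [spin] <;> ring

lemma spin_eq_zero {c d : ℂ} (h : spin c d = 0) : c = 0 ∧ d = 0 := by
  have h0 := congrFun h 0
  have h1 := congrFun h 1
  simp [spin] at h0 h1
  have hc : c ^ 2 = 0 := by linear_combination (h0 + h1) / 2
  have hd : d ^ 2 = 0 := by linear_combination (h1 - h0) / 2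
  exact ⟨by simpa using hc, by simpa using hd⟩

/-- The spinor of a null vector orthogonal to the real vector `x`. -/
lemma cdot_spin_toC (x : R3) :
    cdot (spin ((‖x‖ - x 2 : ℝ) : ℂ) (x 0 + x 1 * Complex.I)) (toC x) = 0 := by
  have h : ((‖x‖ : ℝ) : ℂ) ^ 2 = (x 0 : ℂ) ^ 2 + (x 1 : ℂ) ^ 2 + (x 2 : ℂ) ^ 2 := by
    exact_mod_cast norm_sq_R3 x
  simp [cdot, spin, toC]
  linear_combination ((x 0 : ℂ) + x 1 * Complex.I) * h +
    ((x 0 : ℂ) * (x 1) ^ 2 * 1 + (x 1) ^ 3 * Complex.I) * Complex.I_sq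

/-- Two orthogonal null vectors are proportional. -/
lemma null_orthogonal {a b : Fin 3 → ℂ} (ha : cdot a a = 0) (hb : cdot b b = 0)
    (hab : cdot a b = 0) (hb0 : a ≠ 0) : ∃ c : ℂ, b = c • a := by
  simp only [cdot] at ha hb hab
  have h01 : a 0 * b 1 = a 1 * b 0 := by
    rw [← sub_eq_zero]
    apply pow_eq_zero_iff (two_ne_zero) |>.1
    linear_combination (b 0 * b 0 + b 1 * b 1) * ha - a 2 * a 2 * hb -
      (a 0 * b 0 + a 1 * b 1 - a 2 * b 2) * hab
  have h02 : a 0 * b 2 = a 2 * b 0 := by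
    rw [← sub_eq_zero]
    apply pow_eq_zero_iff (two_ne_zero) |>.1
    linear_combination (b 0 * b 0 + b 2 * b 2) * ha - a 1 * a 1 * hb -
      (a 0 * b 0 + a 2 * b 2 - a 1 * b 1) * hab
  have h12 : a 1 * b 2 = a 2 * b 1 := by
    rw [← sub_eq_zero]
    apply pow_eq_zero_iff (two_ne_zero) |>.1
    linear_combination (b 1 * b 1 + b 2 * b 2) * ha - a 0 * a 0 * hb -
      (a 1 * b 1 + a 2 * b 2 - a 0 * b 0) * hab
  obtain ⟨i, hi⟩ := Function.ne_iff.1 hb0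
  simp only [Pi.zero_apply] at hi
  refine ⟨b i / a i, ?_⟩
  ext j
  simp only [Pi.smul_apply, smul_eq_mul]
  rw [div_mul_eq_mul_div, eq_div_iff hi]
  fin_cases i <;> fin_cases j <;> simp <;> grind

/-- The unipotent complex rotation about the null vector `η`. -/
def tilt (τ : ℂ) (η a : Fin 3 → ℂ) : Fin 3 → ℂ :=
  a + (τ • ![η 1 * a 2 - η 2 * a 1, η 2 * a 0 - η 0 * a 2, η 0 * a 1 - η 1 * a 0] +
    (τ ^ 2 / 2) • (cdot η a • η))

lemma tilt_zero_apply (τ : ℂ) (η a : Fin 3 → ℂ) : tilt τ η a 0 =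
    a 0 + (τ * (η 1 * a 2 - η 2 * a 1) + τ ^ 2 / 2 * (cdot η a * η 0)) := rfl
lemma tilt_one_apply (τ : ℂ) (η a : Fin 3 → ℂ) : tilt τ η a 1 =
    a 1 + (τ * (η 2 * a 0 - η 0 * a 2) + τ ^ 2 / 2 * (cdot η a * η 1)) := rfl
lemma tilt_two_apply (τ : ℂ) (η a : Fin 3 → ℂ) : tilt τ η a 2 =
    a 2 + (τ * (η 0 * a 1 - η 1 * a 0) + τ ^ 2 / 2 * (cdot η a * η 2)) := rfl

lemma cdot_tilt_self {τ : ℂ} {η a : Fin 3 → ℂ} (hη : cdot η η = 0) (ha : cdot a a = 0) :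
    cdot (tilt τ η a) (tilt τ η a) = 0 := by
  have : cdot (tilt τ η a) (tilt τ η a) =
      cdot a a + (τ ^ 2 * cdot a a + τ ^ 4 / 4 * (cdot η a) ^ 2) * cdot η η := by
    simp only [cdot, tilt_zero_apply, tilt_one_apply, tilt_two_apply]; ring
  rw [this, hη, ha]; ring

lemma tilt_ne_zero {τ : ℂ} {η a : Fin 3 → ℂ} (hη : cdot η η = 0) (ha : a ≠ 0) :
    tilt τ η a ≠ 0 := by
  intro h
  have h1 : cdot η a = 0 := by
    have e : cdot η (tilt τ η a) = cdot η a + τ ^ 2 / 2 * cdot η a * cdot η η := by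
      simp only [cdot, tilt_zero_apply, tilt_one_apply, tilt_two_apply]; ring
    rw [h, hη] at e
    simpa [cdot] using e.symm
  apply ha
  have t0 := congrFun h 0
  have t1 := congrFun h 1
  have t2 := congrFun h 2
  rw [tilt_zero_apply, h1] at t0
  rw [tilt_one_apply, h1] at t1
  rw [tilt_two_apply, h1] at t2
  simp only [zero_mul, mul_zero, Pi.zero_apply, add_zero] at t0 t1 t2
  simp only [cdot] at h1 hη
  have c0 : η 1 * a 2 - η 2 * a 1 = 0 := by
    linear_combination η 1 * t2 - η 2 * t1 - τ * η 0 * h1 + τ * a 0 * hη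
  have c1 : η 2 * a 0 - η 0 * a 2 = 0 := by
    linear_combination η 2 * t0 - η 0 * t2 - τ * η 1 * h1 + τ * a 1 * hη
  have c2 : η 0 * a 1 - η 1 * a 0 = 0 := by
    linear_combination η 0 * t1 - η 1 * t0 - τ * η 2 * h1 + τ * a 2 * hη
  rw [c0] at t0
  rw [c1] at t1
  rw [c2] at t2
  ext i
  fin_cases i
  · simpa using t0
  · simpa using t1
  · simpa using t2

lemma exists_primitive_pow_mul_aux {ρ : ℝ} (hρ : 1 < ρ) {h : ℂ → ℂ}
    (hh : DifferentiableOn ℂ h (ball 0 ρ)) :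
    ∃ C : ℝ, 0 ≤ C ∧ ∀ m : ℕ, ∃ Q : ℂ → ℂ,
      (∀ z ∈ ball (0:ℂ) ρ, HasDerivAt Q (z ^ m * h z) z) ∧
      (∀ z, ‖z‖ ≤ 1 → ‖h z‖ ≤ C) ∧
      ∀ z, ‖z‖ ≤ 1 → ‖Q z‖ ≤ C * ‖z‖ ^ (m + 1) := by
  have hsub : closedBall (0:ℂ) 1 ⊆ ball 0 ρ := closedBall_subset_ball hρ
  obtain ⟨C, hC⟩ := (isCompact_closedBall (0:ℂ) 1).exists_bound_of_continuousOn
    (hh.continuousOn.mono hsub)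
  have hC0 : 0 ≤ C := (norm_nonneg _).trans (hC 0 (by simp))
  refine ⟨C, hC0, fun m => ?_⟩
  have hd : DifferentiableOn ℂ (fun z => z ^ m * h z) (ball 0 ρ) :=
    ((differentiable_id.pow m).differentiableOn).mul hh
  obtain ⟨Q, hQ⟩ := hd.isExactOn_ball
  refine ⟨fun z => Q z - Q 0, fun z hz => by simpa using (hQ z hz).sub_const (Q 0),
    fun z hz => hC z (by simpa using hz), fun z hz => ?_⟩
  have hs : closedBall (0:ℂ) ‖z‖ ⊆ ball 0 ρ := (closedBall_subset_closedBall hz).trans hsub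
  have := (convex_closedBall (0:ℂ) ‖z‖).norm_image_sub_le_of_norm_hasDerivWithin_le
    (f := Q) (f' := fun z => z ^ m * h z) (C := ‖z‖ ^ m * C) (x := 0) (y := z)
    (fun w hw => (hQ w (hs hw)).hasDerivWithinAt) (fun w hw => ?_) (by simp) (by simp)
  · calc ‖Q z - Q 0‖ ≤ _ := this
      _ = _ := by rw [sub_zero]; ring
  · have h1 : ‖w‖ ≤ ‖z‖ := by simpa using hw
    rw [norm_mul, norm_pow]
    have := hC w (by simpa using h1.trans hz)
    gcongr

/-- Asymptotics of the primitives of `z ^ m * h z`. -/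
lemma exists_primitive_pow_mul {ρ : ℝ} (hρ : 1 < ρ) {h : ℂ → ℂ}
    (hh : DifferentiableOn ℂ h (ball 0 ρ)) :
    ∃ C : ℝ, 0 ≤ C ∧ ∀ m : ℕ, ∃ Q : ℂ → ℂ,
      (∀ z ∈ ball (0:ℂ) ρ, HasDerivAt Q ((m + 1) * z ^ m * h z) z) ∧
      (∀ z, ‖z‖ ≤ 1 → ‖h z‖ ≤ C) ∧
      ∀ z, ‖z‖ ≤ 1 → ‖Q z - z ^ (m + 1) * h z‖ ≤ C / (m + 1) := by
  have hh1 : DifferentiableOn ℂ (deriv h) (ball 0 ρ) := hh.deriv isOpen_ball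
  have hh2 : DifferentiableOn ℂ (deriv (deriv h)) (ball 0 ρ) := hh1.deriv isOpen_ball
  obtain ⟨C0, hC0, h0⟩ := exists_primitive_pow_mul_aux hρ hh
  obtain ⟨C1, hC1, h1⟩ := exists_primitive_pow_mul_aux hρ hh1
  obtain ⟨C2, hC2, h2⟩ := exists_primitive_pow_mul_aux hρ hh2
  refine ⟨C0 + C1 + C2, by positivity, fun m => ?_⟩
  obtain ⟨-, -, hb0, -⟩ := h0 0
  obtain ⟨-, -, hb1, -⟩ := h1 0
  obtain ⟨Q2, hQ2, -, hb2⟩ := h2 (m + 2)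
  have hm : ((m:ℂ) + 2) ≠ 0 := by exact_mod_cast (by positivity : ((m:ℝ) + 2) ≠ 0)
  have hd : ∀ z ∈ ball (0:ℂ) ρ, HasDerivAt h (deriv h z) z := fun z hz =>
    (hh.differentiableAt (isOpen_ball.mem_nhds hz)).hasDerivAt
  have hd1 : ∀ z ∈ ball (0:ℂ) ρ, HasDerivAt (deriv h) (deriv (deriv h) z) z := fun z hz =>
    (hh1.differentiableAt (isOpen_ball.mem_nhds hz)).hasDerivAt
  refine ⟨fun z => z ^ (m + 1) * h z - (z ^ (m + 2) * deriv h z - Q2 z) / (m + 2), ?_, ?_, ?_⟩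
  · intro z hz
    refine (((hasDerivAt_pow (m + 1) z).mul (hd z hz)).sub
      ((((hasDerivAt_pow (m + 2) z).mul (hd1 z hz)).sub (hQ2 z hz)).div_const _)).congr_deriv ?_
    push_cast
    field_simp
    simp
    ring
  · intro z hz
    linarith [hb0 z hz]
  · intro z hz
    have e : z ^ (m + 1) * h z - (z ^ (m + 2) * deriv h z - Q2 z) / (m + 2) - z ^ (m + 1) * h z =
      - ((z ^ (m + 2) * deriv h z - Q2 z) / (m + 2)) := by ring
    rw [e, norm_neg, norm_div]
    have hn : ‖(m:ℂ) + 2‖ = m + 2 := by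
      have : (m:ℂ) + 2 = ((m + 2 : ℝ) : ℂ) := by push_cast; ring
      rw [this, Complex.norm_real, Real.norm_of_nonneg (by positivity)]
    rw [hn]
    have b1 : ‖z ^ (m + 2) * deriv h z‖ ≤ C1 := by
      rw [norm_mul, norm_pow]
      calc ‖z‖ ^ (m + 2) * ‖deriv h z‖ ≤ 1 * C1 := by
            gcongr
            · exact pow_le_one₀ (norm_nonneg _) hz
            · exact hb1 z hz
        _ = C1 := one_mul _
    have b2 : ‖Q2 z‖ ≤ C2 := (hb2 z hz).trans
      (mul_le_of_le_one_right hC2 (pow_le_one₀ (norm_nonneg _) hz))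
    have b3 := norm_sub_le (z ^ (m + 2) * deriv h z) (Q2 z)
    gcongr
    · linarith
    · norm_num

lemma eVariationOn_ge_of_local {S : Set ℂ} {Y : ℂ → R3} {U : ℂ → ℝ}
    (hloc : ∀ z ∈ S, ∃ N ∈ nhds z, ∀ x ∈ N ∩ S, ∀ y ∈ N ∩ S, dist (U x) (U y) ≤ dist (Y x) (Y y))
    {α : ℝ → ℂ} (hα : ContinuousOn α (Icc 0 1)) (hS : MapsTo α (Icc 0 1) S) :
    ENNReal.ofReal (dist (U (α 0)) (U (α 1))) ≤ eVariationOn (Y ∘ α) (Icc 0 1) := by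
  choose! N hN hNd using hloc
  set c : Icc (0:ℝ) 1 → Set (Icc (0:ℝ) 1) := fun t => interior {x | α x ∈ N (α t)} with hc
  have hcov : univ ⊆ ⋃ t, c t := by
    intro t _
    rw [mem_iUnion]
    refine ⟨t, mem_interior_iff_mem_nhds.2 ?_⟩
    exact (continuousOn_iff_continuous_domRestrict.1 hα).continuousAt.preimage_mem_nhds
      (hN _ (hS t.2))
  obtain ⟨t, ht0, htm, ⟨m, hm⟩, ht⟩ := exists_monotone_Icc_subset_open_cover_Icc
    (zero_le_one (α := ℝ)) (c := c) (fun i => isOpen_interior) hcov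
  have key : ∀ n, ENNReal.ofReal (dist (U (α 0)) (U (α (t n)))) ≤
      eVariationOn (Y ∘ α) (Icc 0 1 ∩ Icc 0 (t n)) := by
    intro n
    induction n with
    | zero => simp [ht0]
    | succ n ih =>
      have hle : (t n : ℝ) ≤ t (n + 1) := htm n.le_succ
      rw [← eVariationOn.Icc_add_Icc (Y ∘ α) (t n).2.1 hle (t n).2]
      have h1 : dist (U (α 0)) (U (α (t (n + 1)))) ≤
          dist (U (α 0)) (U (α (t n))) + dist (U (α (t n))) (U (α (t (n + 1)))) :=
        dist_triangle _ _ _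
      refine (ENNReal.ofReal_le_ofReal h1).trans ?_
      rw [ENNReal.ofReal_add dist_nonneg dist_nonneg]
      refine add_le_add ih ?_
      obtain ⟨i, hi⟩ := ht n
      have ha : α (t n) ∈ N (α i) := by
        have := interior_subset (hi (left_mem_Icc.2 (htm n.le_succ)))
        exact this
      have hb : α (t (n + 1)) ∈ N (α i) := by
        have := interior_subset (hi (right_mem_Icc.2 (htm n.le_succ)))
        exact this
      have h2 := hNd (α i) (hS i.2) _ ⟨ha, hS (t n).2⟩ _ ⟨hb, hS (t (n + 1)).2⟩
      refine (ENNReal.ofReal_le_ofReal h2).trans ?_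
      rw [← edist_dist]
      exact eVariationOn.edist_le (Y ∘ α) ⟨(t n).2, left_mem_Icc.2 hle⟩
        ⟨(t (n + 1)).2, right_mem_Icc.2 hle⟩
  have h := key m
  rw [hm m le_rfl] at h
  exact h.trans (eVariationOn.mono _ inter_subset_left)

/-- Lower bound for the length of curves crossing an annulus, for a conformal map whose
conformal factor dominates a radial function. -/
lemma eVariationOn_ge_of_conformal {Y : ℂ → R3} {L : ℂ → (ℂ →L[ℝ] R3)} {lam : ℂ → ℝ} {ψ : ℝ → ℝ}
    {a b ϑ : ℝ} (hab : a ≤ b) (hϑ : 0 < ϑ) (hϑ1 : ϑ < 1) (hψ : Continuous ψ)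
    (hY : ∀ z ∈ closedBall (0:ℂ) 1, HasStrictFDerivAt Y (L z) z)
    (hL : ∀ z ∈ closedBall (0:ℂ) 1, ∀ v, ‖L z v‖ = lam z * ‖v‖)
    (hlam : ∀ z ∈ closedBall (0:ℂ) 1, 0 < lam z)
    (hlψ : ∀ z ∈ closedBall (0:ℂ) 1, a ≤ ‖z‖ → ψ ‖z‖ ≤ lam z)
    {α : ℝ → ℂ} (hα : ContinuousOn α (Icc 0 1)) (hS : MapsTo α (Icc 0 1) (closedBall 0 1))
    (h0 : b ≤ ‖α 0‖) (h1 : ‖α 1‖ ≤ a) :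
    ENNReal.ofReal ((1 - ϑ) * ∫ x in a..b, ψ x) ≤ eVariationOn (Y ∘ α) (Icc 0 1) := by
  set g : ℝ → ℝ := fun x => (1 - ϑ) * max 0 (ψ x) with hg
  have hgc : Continuous g := by fun_prop
  have hg0 : ∀ x, 0 ≤ g x := fun x => mul_nonneg (by linarith) (le_max_left _ _)
  set u : ℝ → ℝ := fun x => ∫ y in a..x, g y with hu
  have hud : ∀ x, HasStrictDerivAt u (g x) x := fun x =>
    intervalIntegral.integral_hasStrictDerivAt_right (hgc.intervalIntegrable _ _)
      hgc.stronglyMeasurable.stronglyMeasurableAtFilter hgc.continuousAt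
  set U : ℂ → ℝ := fun z => u (max ‖z‖ a) with hU
  have hmax : ∀ x y : ℂ, dist (max ‖x‖ a) (max ‖y‖ a) ≤ dist x y := by
    intro x y
    rw [Real.dist_eq, dist_eq_norm]
    refine (abs_max_sub_max_le_abs _ _ _).trans (abs_norm_sub_norm_le x y)
  have hloc : ∀ z ∈ closedBall (0:ℂ) 1, ∃ N ∈ nhds z, ∀ x ∈ N ∩ closedBall (0:ℂ) 1,
      ∀ y ∈ N ∩ closedBall (0:ℂ) 1, dist (U x) (U y) ≤ dist (Y x) (Y y) := by
    intro z hz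
    by_cases hza : ‖z‖ < a
    · refine ⟨{w | ‖w‖ < a}, (isOpen_lt continuous_norm continuous_const).mem_nhds hza, ?_⟩
      rintro x ⟨hx, -⟩ y ⟨hy, -⟩
      have e1 : max ‖x‖ a = a := max_eq_right (le_of_lt hx)
      have e2 : max ‖y‖ a = a := max_eq_right (le_of_lt hy)
      simp [hU, e1, e2]
    · push Not at hza
      have hgl : g ‖z‖ < lam z := by
        rcases le_total (ψ ‖z‖) 0 with h | h
        · simp [hg, max_eq_left h, hlam z hz]
        · have h2 := hlψ z hz hza
          have h3 := hlam z hz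
          simp only [hg, max_eq_right h]
          nlinarith
      set e := (lam z - g ‖z‖) / 2 with he
      have he0 : 0 < e := by rw [he]; linarith
      have hYo := (hY z hz).isLittleO.def he0
      have huo := (hud ‖z‖).hasStrictFDerivAt.isLittleO.def he0
      rw [nhds_prod_eq] at hYo huo
      replace hYo := (Filter.eventually_prod_self_iff (r := fun x y =>
        ‖Y x - Y y - L z (x - y)‖ ≤ e * ‖x - y‖)).1 hYo
      replace huo := (Filter.eventually_prod_self_iff (r := fun x y =>
        ‖u x - u y - (ContinuousLinearMap.toSpanSingleton ℝ (g ‖z‖)) (x - y)‖ ≤ e * ‖x - y‖)).1 huo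
      obtain ⟨N1, hN1, hY1⟩ := hYo
      obtain ⟨N2, hN2, hu2⟩ := huo
      have hcont : ContinuousAt (fun w : ℂ => max ‖w‖ a) z := by fun_prop
      have hN2' : (fun w : ℂ => max ‖w‖ a) ⁻¹' N2 ∈ nhds z :=
        hcont.preimage_mem_nhds (by simpa [max_eq_left hza] using hN2)
      refine ⟨_, Filter.inter_mem hN1 hN2', ?_⟩
      rintro x ⟨⟨hx1, hx2⟩, -⟩ y ⟨⟨hy1, hy2⟩, -⟩
      have i1 := hY1 x hx1 y hy1
      have i2 := hu2 _ hx2 _ hy2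
      simp only at i1 i2
      have j1 : lam z * ‖x - y‖ - e * ‖x - y‖ ≤ dist (Y x) (Y y) := by
        rw [dist_eq_norm, ← hL z hz]
        have := norm_sub_norm_le (L z (x - y)) (Y x - Y y)
        rw [norm_sub_rev (L z (x - y))] at this
        linarith
      have j2 : dist (U x) (U y) ≤ (g ‖z‖ + e) * ‖x - y‖ := by
        have k1 := hmax x y
        rw [Real.dist_eq, dist_eq_norm] at k1
        rw [Real.dist_eq]
        simp only [Real.norm_eq_abs] at i2
        have k2 := abs_sub_abs_le_abs_sub (U x - U y) ((max ‖x‖ a - max ‖y‖ a) * g ‖z‖)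
        simp only [ContinuousLinearMap.toSpanSingleton_apply, smul_eq_mul] at i2
        rw [abs_mul, abs_of_nonneg (hg0 _)] at k2
        have k3 : |U x - U y - (max ‖x‖ a - max ‖y‖ a) * g ‖z‖| ≤ e * |max ‖x‖ a - max ‖y‖ a| := i2
        have k4 := mul_le_mul_of_nonneg_right k1 (hg0 ‖z‖)
        have k5 := mul_le_mul_of_nonneg_left k1 he0.le
        linarith
      have : (g ‖z‖ + e) = lam z - e := by rw [he]; ring
      rw [this, sub_mul] at j2
      exact j2.trans j1
  refine le_trans (ENNReal.ofReal_le_ofReal ?_) (eVariationOn_ge_of_local hloc hα hS)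
  have e1 : U (α 1) = 0 := by
    have : max ‖α 1‖ a = a := max_eq_right h1
    simp [hU, hu, this]
  rw [e1, Real.dist_eq, sub_zero]
  refine le_trans ?_ (le_abs_self _)
  have hb : b ≤ max ‖α 0‖ a := h0.trans (le_max_left _ _)
  calc (1 - ϑ) * ∫ x in a..b, ψ x = ∫ x in a..b, (1 - ϑ) * ψ x := by
        rw [intervalIntegral.integral_const_mul]
    _ ≤ ∫ x in a..b, g x := by
        apply intervalIntegral.integral_mono_on hab
          ((continuous_const.mul hψ).intervalIntegrable _ _) (hgc.intervalIntegrable _ _)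
        intro x _
        exact mul_le_mul_of_nonneg_left (le_max_right _ _) (by linarith)
    _ ≤ ∫ x in a..(max ‖α 0‖ a), g x := by
        have hadd := intervalIntegral.integral_add_adjacent_intervals
          (hgc.intervalIntegrable (μ := MeasureTheory.volume) a b)
          (hgc.intervalIntegrable b (max ‖α 0‖ a))
        have := intervalIntegral.integral_nonneg (μ := MeasureTheory.volume) hb (fun x _ => hg0 x)
        linarith

lemma exists_smooth_selection {Y : ℂ → R3} {r : ℝ} {Γ : Set R3}
    (hY : ∀ z : ℂ, ‖z‖ = 1 → ContinuousAt Y z)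
    (hT : ∀ z : ℂ, ‖z‖ = 1 → Y z ∈ thickening r Γ) :
    ∃ Q : ℂ → R3, ContDiff ℝ 1 Q ∧ ∀ z, ‖z‖ = 1 → Q z ∈ convexHull ℝ (Γ ∩ ball (Y z) r) := by
  obtain ⟨g, hg⟩ := exists_contMDiffMap_forall_mem_convex_of_local_const (n := 1)
    (modelWithCornersSelf ℝ ℂ) (F := R3)
    (t := fun z => {q | ‖z‖ = 1 → q ∈ convexHull ℝ (Γ ∩ ball (Y z) r)}) (fun z => by
      by_cases hz : ‖z‖ = 1
      · simpa [hz] using convex_convexHull ℝ _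
      · simpa [hz] using convex_univ) (fun z => by
      by_cases hz : ‖z‖ = 1
      · obtain ⟨q, hq, hd⟩ := mem_thickening_iff.1 (hT z hz)
        refine ⟨q, ?_⟩
        have : ∀ᶠ w in nhds z, dist (Y w) q < r :=
          ((hY z hz).dist continuousAt_const).eventually_lt continuousAt_const hd
        filter_upwards [this] with w hw _
        exact subset_convexHull ℝ _ ⟨hq, by rwa [mem_ball, dist_comm]⟩
      · refine ⟨0, ?_⟩
        have : ∀ᶠ w : ℂ in nhds z, ‖w‖ ≠ 1 := continuous_norm.continuousAt.eventually_ne hz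
        filter_upwards [this] with w hw h
        exact absurd h hw)
  exact ⟨g, g.contMDiff.contDiff, fun z hz => hg z hz⟩

/-- The cross product of the real and imaginary parts of a vector of `ℂ³`. -/
def normalV (a : Fin 3 → ℂ) : R3 := WithLp.toLp 2
  ![(a 1).re * (a 2).im - (a 2).re * (a 1).im, (a 2).re * (a 0).im - (a 0).re * (a 2).im,
    (a 0).re * (a 1).im - (a 1).re * (a 0).im]

lemma exists_smul_normalV {a : Fin 3 → ℂ} (ha : cdot a a = 0) (h0 : a ≠ 0) {x : R3}
    (hx : cdot a (toC x) = 0) : ∃ μ : ℝ, x = μ • normalV a := by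
  have hn := two_mul_norm_sq_reV ha
  have hp : 0 < ‖reV a‖ := norm_pos_iff.2 (reV_ne_zero ha h0)
  set l := ‖reV a‖ ^ 2 with hl
  have hl0 : 0 < l := by positivity
  have hl1 : l = (a 0).re ^ 2 + (a 1).re ^ 2 + (a 2).re ^ 2 := by rw [hl, norm_sq_R3]; rfl
  have r1 := congrArg Complex.re ha
  have r2 := congrArg Complex.im ha
  have r3 := congrArg Complex.re hx
  have r4 := congrArg Complex.im hx
  simp [cdot, toC] at r1 r2 r3 r4
  have hl2 : l = (a 0).im ^ 2 + (a 1).im ^ 2 + (a 2).im ^ 2 := by linarith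
  refine ⟨(inner ℝ (normalV a) x) / l ^ 2, ?_⟩
  have hAB : (a 0).re * (a 0).im + (a 1).re * (a 1).im + (a 2).re * (a 2).im = 0 := by linarith
  have hll : l ^ 2 = (normalV a 0) ^ 2 + (normalV a 1) ^ 2 + (normalV a 2) ^ 2 := by
    simp only [normalV, Matrix.cons_val_zero, Matrix.cons_val_one, Matrix.cons_val]
    rw [sq l]; nth_rw 1 [hl1]; rw [hl2]
    linear_combination ((a 0).re * (a 0).im + (a 1).re * (a 1).im + (a 2).re * (a 2).im) * hAB
  ext i
  rw [PiLp.smul_apply, smul_eq_mul, div_mul_eq_mul_div, eq_div_iff (by positivity), hll, inner_R3]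
  fin_cases i <;>
  simp only [normalV, Matrix.cons_val_zero, Matrix.cons_val_one, Matrix.cons_val, Fin.zero_eta,
    Fin.mk_one, Fin.reduceFinMk]
  · linear_combination ((a 2).re * (a 0).im - (a 0).re * (a 2).im) *
        ((a 2).re * r4 - (a 2).im * r3) - ((a 0).re * (a 1).im - (a 1).re * (a 0).im) *
        ((a 1).re * r4 - (a 1).im * r3)
  · linear_combination ((a 0).re * (a 1).im - (a 1).re * (a 0).im) *
        ((a 0).re * r4 - (a 0).im * r3) - ((a 1).re * (a 2).im - (a 2).re * (a 1).im) *
        ((a 2).re * r4 - (a 2).im * r3)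
  · linear_combination ((a 1).re * (a 2).im - (a 2).re * (a 1).im) *
        ((a 1).re * r4 - (a 1).im * r3) - ((a 2).re * (a 0).im - (a 0).re * (a 2).im) *
        ((a 0).re * r4 - (a 0).im * r3)

lemma continuous_normalV_comp {φ : ℝ → Fin 3 → ℂ} (hφ : ContDiff ℝ 1 φ) :
    ContDiff ℝ 1 fun t => normalV (φ t) := by
  have hre : ∀ i, ContDiff ℝ 1 fun t => (φ t i).re := fun i =>
    Complex.reCLM.contDiff.comp (contDiff_pi.1 hφ i)
  have him : ∀ i, ContDiff ℝ 1 fun t => (φ t i).im := fun i =>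
    Complex.imCLM.contDiff.comp (contDiff_pi.1 hφ i)
  rw [contDiff_euclidean]
  intro i
  fin_cases i
  · exact ((hre 1).mul (him 2)).sub ((hre 2).mul (him 1))
  · exact ((hre 2).mul (him 0)).sub ((hre 0).mul (him 2))
  · exact ((hre 0).mul (him 1)).sub ((hre 1).mul (him 0))

/-- A generic small translation of a curve in `ℝ³` avoids the normal lines of two families of
null planes. -/
lemma exists_generic_translation {W : ℝ → R3} {φ χ : ℝ → Fin 3 → ℂ} (hW : ContDiff ℝ 1 W)
    (hφ : ContDiff ℝ 1 φ) (hφn : ∀ t, cdot (φ t) (φ t) = 0) (hφ0 : ∀ t, φ t ≠ 0)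
    (hχ : ContDiff ℝ 1 χ) (hχn : ∀ t, cdot (χ t) (χ t) = 0) (hχ0 : ∀ t, χ t ≠ 0)
    {e : ℝ} (he : 0 < e) :
    ∃ a : R3, ‖a‖ < e ∧ ∀ t, cdot (φ t) (toC (W t + a)) ≠ 0 ∧ cdot (χ t) (toC (W t + a)) ≠ 0 := by
  have hdim : ∀ φ : ℝ → Fin 3 → ℂ, ContDiff ℝ 1 φ →
      dimH (range fun q : ℝ × ℝ => q.2 • normalV (φ q.1) - W q.1) ≤ 2 := by
    intro φ hφ
    have hc : ContDiff ℝ 1 fun q : ℝ × ℝ => q.2 • normalV (φ q.1) - W q.1 :=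
      (contDiff_snd.smul ((continuous_normalV_comp hφ).comp contDiff_fst)).sub
        (hW.comp contDiff_fst)
    simpa using hc.dimH_range_le
  have hd : Dense ((range fun q : ℝ × ℝ => q.2 • normalV (φ q.1) - W q.1) ∪
      (range fun q : ℝ × ℝ => q.2 • normalV (χ q.1) - W q.1))ᶜ := by
    apply dense_compl_of_dimH_lt_finrank
    rw [dimH_union]
    refine (max_le (hdim φ hφ) (hdim χ hχ)).trans_lt ?_
    simp
    norm_num
  obtain ⟨a, ha, hae⟩ := hd.exists_dist_lt 0 he
  rw [mem_compl_iff, mem_union, not_or] at ha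
  refine ⟨a, by simpa using hae, fun t => ⟨fun h => ha.1 ?_, fun h => ha.2 ?_⟩⟩
  · obtain ⟨μ, hμ⟩ := exists_smul_normalV (hφn t) (hφ0 t) h
    exact ⟨(t, μ), by simp only; rw [← hμ]; abel⟩
  · obtain ⟨μ, hμ⟩ := exists_smul_normalV (hχn t) (hχ0 t) h
    exact ⟨(t, μ), by simp only; rw [← hμ]; abel⟩

lemma exists_entire_of_mem_span_fourier {G : C(AddCircle (1:ℝ), ℂ)}
    (hG : G ∈ Submodule.span ℂ (range (@fourier (1:ℝ)))) :
    ∃ M : ℕ, ∃ p : ℂ → ℂ, Differentiable ℂ p ∧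
      ∀ x : AddCircle (1:ℝ), p (x.toCircle) = (x.toCircle : ℂ) ^ M * G x := by
  induction hG using Submodule.span_induction with
  | mem x h =>
    obtain ⟨n, rfl⟩ := h
    refine ⟨n.natAbs, fun z => z ^ ((n.natAbs : ℤ) + n).toNat, by fun_prop, fun x => ?_⟩
    have h0 : (x.toCircle : ℂ) ≠ 0 := Circle.coe_ne_zero _
    rw [fourier_apply, AddCircle.toCircle_zsmul, Circle.coe_zpow]
    generalize (x.toCircle : ℂ) = z at h0
    simp only
    rw [← zpow_natCast, ← zpow_natCast, ← zpow_add₀ h0, Int.toNat_of_nonneg (by grind)]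
  | zero => exact ⟨0, 0, differentiable_const 0, fun x => by simp⟩
  | add F G _ _ hF hG =>
    obtain ⟨M, p, hp, hF⟩ := hF
    obtain ⟨N, q, hq, hG⟩ := hG
    refine ⟨M + N, fun z => z ^ N * p z + z ^ M * q z, by fun_prop, fun x => ?_⟩
    simp only [hF, hG, ContinuousMap.add_apply]; ring
  | smul c F _ hF =>
    obtain ⟨M, p, hp, hF⟩ := hF
    refine ⟨M, fun z => c * p z, by fun_prop, fun x => ?_⟩
    simp only [hF, ContinuousMap.smul_apply, smul_eq_mul]; ring

lemma exists_entire_approx_circle {f : ℂ → ℂ} (hf : ContinuousOn f (sphere 0 1)) {e : ℝ}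
    (he : 0 < e) : ∃ M : ℕ, ∃ p : ℂ → ℂ, Differentiable ℂ p ∧
      ∀ z : ℂ, ‖z‖ = 1 → ‖p z - z ^ M * f z‖ < e := by
  have hc : Continuous fun x : AddCircle (1:ℝ) => f x.toCircle :=
    hf.comp_continuous (continuous_subtype_val.comp AddCircle.continuous_toCircle)
      fun x => by rw [mem_sphere_zero_iff_norm]; exact Circle.norm_coe _
  set F : C(AddCircle (1:ℝ), ℂ) := ⟨fun x => f x.toCircle, hc⟩ with hF
  have : Fact ((0:ℝ) < 1) := ⟨one_pos⟩
  have hmem : F ∈ (Submodule.span ℂ (range (@fourier (1:ℝ)))).topologicalClosure := by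
    rw [span_fourier_closure_eq_top]; trivial
  obtain ⟨G, hG, hd⟩ := Metric.mem_closure_iff.1 hmem e he
  obtain ⟨M, p, hp, h⟩ := exists_entire_of_mem_span_fourier hG
  refine ⟨M, p, hp, fun z hz => ?_⟩
  obtain ⟨x, hx⟩ := (AddCircle.homeomorphCircle (one_ne_zero : (1:ℝ) ≠ 0)).surjective
    ⟨z, by simpa [Submonoid.unitSphere] using hz⟩
  rw [AddCircle.homeomorphCircle_apply] at hx
  have hxz : (x.toCircle : ℂ) = z := by rw [hx]
  rw [← hxz, h x, ← mul_sub, norm_mul, norm_pow, Circle.norm_coe, one_pow, one_mul]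
  rw [dist_comm, dist_eq_norm] at hd
  exact ((G - F).norm_coe_le_norm x).trans_lt hd

lemma exists_entire_approx_circle₂ {f g : ℂ → ℂ} (hf : ContinuousOn f (sphere 0 1))
    (hg : ContinuousOn g (sphere 0 1)) {e : ℝ} (he : 0 < e) :
    ∃ M : ℕ, ∃ p q : ℂ → ℂ, Differentiable ℂ p ∧ Differentiable ℂ q ∧
      ∀ z : ℂ, ‖z‖ = 1 → ‖p z - z ^ M * f z‖ < e ∧ ‖q z - z ^ M * g z‖ < e := by
  obtain ⟨M, p, hp, hpf⟩ := exists_entire_approx_circle hf he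
  obtain ⟨N, q, hq, hqg⟩ := exists_entire_approx_circle hg he
  refine ⟨M + N, fun z => z ^ N * p z, fun z => z ^ M * q z, by fun_prop, by fun_prop,
    fun z hz => ⟨?_, ?_⟩⟩
  · have : z ^ N * p z - z ^ (M + N) * f z = z ^ N * (p z - z ^ M * f z) := by ring
    rw [this, norm_mul, norm_pow, hz, one_pow, one_mul]
    exact hpf z hz
  · have : z ^ M * q z - z ^ (M + N) * g z = z ^ M * (q z - z ^ N * g z) := by ring
    rw [this, norm_mul, norm_pow, hz, one_pow, one_mul]
    exact hqg z hz

lemma differentiable_spin {p q : ℂ → ℂ} (hp : Differentiable ℂ p) (hq : Differentiable ℂ q) :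
    Differentiable ℂ fun z => spin (p z) (q z) := by
  rw [differentiable_pi]
  intro i
  fin_cases i
  · exact (hp.pow 2).sub (hq.pow 2)
  · exact ((hp.pow 2).add (hq.pow 2)).const_mul Complex.I
  · exact (hp.const_mul 2).mul hq

lemma continuous_spin : Continuous fun k : ℂ × ℂ => spin k.1 k.2 := by
  rw [continuous_pi_iff]
  intro i
  fin_cases i
  · exact (continuous_fst.pow 2).sub (continuous_snd.pow 2)
  · exact continuous_const.mul ((continuous_fst.pow 2).add (continuous_snd.pow 2))
  · exact (continuous_const.mul continuous_fst).mul continuous_snd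

lemma ContinuousOn.cdot {α : Type*} [TopologicalSpace α] {S : Set α} {f g : α → Fin 3 → ℂ}
    (hf : ContinuousOn f S) (hg : ContinuousOn g S) :
    ContinuousOn (fun x => cdot (f x) (g x)) S := by
  have h1 := continuousOn_pi.1 hf
  have h2 := continuousOn_pi.1 hg
  exact (((h1 0).mul (h2 0)).add ((h1 1).mul (h2 1))).add ((h1 2).mul (h2 2))

lemma continuous_toC : Continuous toC := by
  unfold toC; fun_prop

/-- A property which is open in the spinor variables is stable under small perturbations of a
continuous spinor field on the circle. -/
lemma exists_uniform_tol {c d : ℂ → ℂ} (hc : ContinuousOn c (sphere 0 1))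
    (hd : ContinuousOn d (sphere 0 1)) {G : ℂ × ℂ × ℂ → ℝ}
    (hG : ContinuousOn G (sphere 0 1 ×ˢ univ)) {l u : ℝ}
    (h : ∀ z : ℂ, ‖z‖ = 1 → l < G (z, c z, d z) ∧ G (z, c z, d z) < u) :
    ∃ e > 0, ∀ z : ℂ, ‖z‖ = 1 → ∀ c' d' : ℂ, ‖c' - c z‖ < e → ‖d' - d z‖ < e →
      l < G (z, c', d') ∧ G (z, c', d') < u := by
  set κ : sphere (0:ℂ) 1 → sphere (0:ℂ) 1 × ℂ × ℂ := fun z => (z, c z, d z) with hκ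
  have hκc : Continuous κ := continuous_id.prodMk
    ((continuousOn_iff_continuous_domRestrict.1 hc).prodMk
      (continuousOn_iff_continuous_domRestrict.1 hd))
  have hGc : Continuous fun x : sphere (0:ℂ) 1 × ℂ × ℂ => G (x.1, x.2) :=
    hG.comp_continuous (by fun_prop) fun x => ⟨x.1.2, trivial⟩
  have hO : IsOpen {x : sphere (0:ℂ) 1 × ℂ × ℂ | l < G (x.1, x.2) ∧ G (x.1, x.2) < u} :=
    (isOpen_lt continuous_const hGc).inter (isOpen_lt hGc continuous_const)
  obtain ⟨e, he, hsub⟩ := (isCompact_range hκc).exists_thickening_subset_open hO (by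
    rintro _ ⟨z, rfl⟩
    exact h z (by simpa using z.2))
  refine ⟨e, he, fun z hz c' d' hc' hd' => ?_⟩
  have hz' : z ∈ sphere (0:ℂ) 1 := by simpa using hz
  have : ((⟨z, hz'⟩, c', d') : sphere (0:ℂ) 1 × ℂ × ℂ) ∈ thickening e (range κ) := by
    refine mem_thickening_iff.2 ⟨_, ⟨⟨z, hz'⟩, rfl⟩, ?_⟩
    rw [hκ, Prod.dist_eq, Prod.dist_eq, dist_self, dist_eq_norm, dist_eq_norm]
    simp only
    exact max_lt he (max_lt hc' hd')
  exact hsub this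

lemma cdot_smul_left (c : ℂ) (a b : Fin 3 → ℂ) : cdot (c • a) b = c * cdot a b := by
  simp only [cdot, Pi.smul_apply, smul_eq_mul]; ring

lemma cdot_smul_right (c : ℂ) (a b : Fin 3 → ℂ) : cdot a (c • b) = c * cdot a b := by
  simp only [cdot, Pi.smul_apply, smul_eq_mul]; ring

lemma infDist_le_of_mem_convexHull {Γ : Set R3} {y v Q : R3} {r s : ℝ} (hs : 0 < s)
    (hQ : Q ∈ convexHull ℝ (Γ ∩ ball y r)) (hv : ‖v‖ ≤ 1.8 * s)
    (hvw : inner ℝ v (y - Q) ≤ 0.1 * s ^ 2) :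
    infDist (y + v) Γ ≤ Real.sqrt ((2 * s) ^ 2 + r ^ 2) := by
  obtain ⟨q, hq, hqQ⟩ := ((innerSL ℝ v).toLinearMap.convexOn (convex_convexHull ℝ (Γ ∩ ball y r))
    ).exists_ge_of_mem_convexHull (subset_convexHull ℝ _) hQ
  simp only [ContinuousLinearMap.coe_coe, innerSL_apply_apply] at hqQ
  refine (infDist_le_dist_of_mem hq.1).trans (Real.le_sqrt_of_sq_le ?_)
  have e : y + v - q = (y - q) + v := by abel
  rw [dist_eq_norm, e, norm_add_sq_real, real_inner_comm]
  have h1 : ‖y - q‖ < r := by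
    have := mem_ball.1 hq.2
    rwa [dist_comm, dist_eq_norm] at this
  have h2 : ‖y - q‖ ^ 2 ≤ r ^ 2 := by gcongr
  have h3 : ‖v‖ ^ 2 ≤ (1.8 * s) ^ 2 := by gcongr
  rw [inner_sub_right] at hvw ⊢
  nlinarith

theorem exists_null_field {ρ : ℝ} (hρ : 1 < ρ) {φ : ℂ → Fin 3 → ℂ}
    (hφ : DifferentiableOn ℂ φ (ball 0 ρ)) (hφn : ∀ z ∈ ball (0:ℂ) ρ, cdot (φ z) (φ z) = 0)
    (hφ0 : ∀ z ∈ ball (0:ℂ) ρ, φ z ≠ 0) {Y : ℂ → R3} (hY : ContDiffOn ℝ 1 Y (ball 0 ρ))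
    {Γ : Set R3} {r s : ℝ} (hs : 0 < s) (hT : ∀ z : ℂ, ‖z‖ = 1 → Y z ∈ thickening r Γ) :
    ∃ η : ℂ → Fin 3 → ℂ, Differentiable ℂ η ∧ (∀ z, cdot (η z) (η z) = 0) ∧
      ∀ z : ℂ, ‖z‖ = 1 → 1.2 * s < ‖reV (cdot (η z) (φ z) • η z)‖ ∧
        ∀ ζ : ℂ, ‖ζ‖ ≤ 1 → infDist (Y z + reV (ζ • (cdot (η z) (φ z) • η z))) Γ ≤
          Real.sqrt ((2 * s) ^ 2 + r ^ 2) := by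
  have hmem : ∀ z : ℂ, ‖z‖ = 1 → z ∈ ball (0:ℂ) ρ := fun z hz => by simpa [hz] using hρ
  have hsub : sphere (0:ℂ) 1 ⊆ ball 0 ρ := sphere_subset_ball hρ
  obtain ⟨Q, hQ, hQc⟩ := exists_smooth_selection (fun z hz =>
    hY.continuousOn.continuousAt (isOpen_ball.mem_nhds (hmem z hz))) hT
  set E : ℝ → ℂ := fun t => Complex.exp (t * Complex.I) with hE
  have hEc : ContDiff ℝ 1 E :=
    ((Complex.ofRealCLM.contDiff.mul contDiff_const)).cexp
  have hEn : ∀ t, ‖E t‖ = 1 := fun t => Complex.norm_exp_ofReal_mul_I t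
  have hφE : ContDiff ℝ 1 fun t => φ (E t) := by
    have h1 : ContDiffOn ℝ 1 φ (ball 0 ρ) := (hφ.contDiffOn isOpen_ball).restrict_scalars ℝ
    exact h1.comp_contDiff hEc fun t => hmem _ (hEn t)
  obtain ⟨a, ha, hW⟩ := exists_generic_translation (W := fun t => Y (E t) - Q (E t))
    ((hY.comp_contDiff hEc fun t => hmem _ (hEn t)).sub (hQ.comp hEc)) hφE
    (fun t => hφn _ (hmem _ (hEn t))) (fun t => hφ0 _ (hmem _ (hEn t)))
    (χ := fun _ => ![1, Complex.I, 0]) contDiff_const (fun _ => by simp [cdot])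
    (fun _ h => by simpa using congrFun h 0) (e := s / 20) (by positivity)
  set w : ℂ → R3 := fun z => Y z - Q z + a with hw
  have hwn : ∀ z : ℂ, ‖z‖ = 1 → cdot (φ z) (toC (w z)) ≠ 0 ∧
      (w z 0 + w z 1 * Complex.I : ℂ) ≠ 0 := by
    intro z hz
    have hzE : E (Complex.arg z) = z := by
      have := Complex.norm_mul_exp_arg_mul_I z
      rw [hz] at this; simpa using this
    obtain ⟨h1, h2⟩ := hW (Complex.arg z)
    rw [hzE] at h1 h2
    refine ⟨h1, fun h => h2 ?_⟩
    refine Eq.trans ?_ h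
    change (1:ℂ) * ((w z 0 : ℝ) : ℂ) + Complex.I * ((w z 1 : ℝ) : ℂ)
      + 0 * ((w z 2 : ℝ) : ℂ) = _
    ring
  have hwc : ContinuousOn w (sphere 0 1) :=
    ((hY.continuousOn.mono hsub).sub hQ.continuous.continuousOn).add continuousOn_const
  have hwi : ∀ i, ContinuousOn (fun z => w z i) (sphere 0 1) := fun i =>
    (EuclideanSpace.proj (𝕜 := ℝ) i).continuous.comp_continuousOn hwc
  set c0 : ℂ → ℂ := fun z => ((‖w z‖ - w z 2 : ℝ) : ℂ) with hc0
  set d0 : ℂ → ℂ := fun z => w z 0 + w z 1 * Complex.I with hd0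
  have hc0c : ContinuousOn c0 (sphere 0 1) :=
    Complex.continuous_ofReal.comp_continuousOn (hwc.norm.sub (hwi 2))
  have hd0c : ContinuousOn d0 (sphere 0 1) :=
    (Complex.continuous_ofReal.comp_continuousOn (hwi 0)).add
      ((Complex.continuous_ofReal.comp_continuousOn (hwi 1)).mul continuousOn_const)
  have hn0 : ∀ z, ‖z‖ = 1 → spin (c0 z) (d0 z) ≠ 0 := fun z hz h =>
    (hwn z hz).2 (spin_eq_zero h).2
  have horth : ∀ z, cdot (spin (c0 z) (d0 z)) (toC (w z)) = 0 := fun z => cdot_spin_toC (w z)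
  have hphi : ∀ z, ‖z‖ = 1 → cdot (spin (c0 z) (d0 z)) (φ z) ≠ 0 := by
    intro z hz h
    obtain ⟨μ, hμ⟩ := null_orthogonal (cdot_spin_self _ _) (hφn z (hmem z hz)) h (hn0 z hz)
    apply (hwn z hz).1
    rw [hμ, cdot_smul_left, horth, mul_zero]
  set g : ℂ × ℂ × ℂ → ℝ := fun x =>
    ‖reV (cdot (spin x.2.1 x.2.2) (φ x.1) • spin x.2.1 x.2.2)‖ with hg
  set H : ℂ × ℂ × ℂ → ℝ := fun x =>
    ‖cdot (spin x.2.1 x.2.2) (toC (Y x.1 - Q x.1))‖ * ‖cdot (spin x.2.1 x.2.2) (φ x.1)‖ with hH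
  have hspc : ContinuousOn (fun x : ℂ × ℂ × ℂ => spin x.2.1 x.2.2) (sphere 0 1 ×ˢ univ) :=
    (continuous_spin.comp continuous_snd).continuousOn
  have hφc : ContinuousOn (fun x : ℂ × ℂ × ℂ => φ x.1) (sphere 0 1 ×ˢ univ) :=
    (hφ.continuousOn.mono hsub).comp continuousOn_fst fun x hx => hx.1
  have hYc : ContinuousOn (fun x : ℂ × ℂ × ℂ => toC (Y x.1 - Q x.1)) (sphere 0 1 ×ˢ univ) :=
    continuous_toC.comp_continuousOn
      (((hY.continuousOn.mono hsub).sub hQ.continuous.continuousOn).comp continuousOn_fst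
        fun x hx => hx.1)
  have hgc : ContinuousOn g (sphere 0 1 ×ˢ univ) :=
    (reV.continuous.comp_continuousOn ((hspc.cdot hφc).smul hspc)).norm
  have hHc : ContinuousOn H (sphere 0 1 ×ˢ univ) := (hspc.cdot hYc).norm.mul (hspc.cdot hφc).norm
  have hgs : ∀ (u z c d : ℂ), g (z, u * c, u * d) = ‖u‖ ^ 4 * g (z, c, d) := by
    intro u z c d
    simp only [hg, spin_mul, cdot_smul_left]
    rw [smul_smul, show u ^ 2 * cdot (spin c d) (φ z) * u ^ 2 =
      u ^ 4 * cdot (spin c d) (φ z) by ring, mul_smul, norm_reV_smul, norm_pow]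
    rw [cdot_smul_smul, cdot_spin_self, mul_zero]
  have hHs : ∀ (u z c d : ℂ), H (z, u * c, u * d) = ‖u‖ ^ 4 * H (z, c, d) := by
    intro u z c d
    simp only [hH, spin_mul, cdot_smul_left, norm_mul, norm_pow]
    ring
  have hgpos : ∀ z, ‖z‖ = 1 → 0 < g (z, c0 z, d0 z) := by
    intro z hz
    simp only [hg]
    rw [norm_reV_smul (cdot_spin_self _ _)]
    exact mul_pos (norm_pos_iff.2 (hphi z hz))
      (norm_pos_iff.2 (reV_ne_zero (cdot_spin_self _ _) (hn0 z hz)))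
  have hg0c : ContinuousOn (fun z => g (z, c0 z, d0 z)) (sphere 0 1) :=
    hgc.comp (continuousOn_id.prodMk (hc0c.prodMk hd0c)) fun z hz => ⟨hz, trivial⟩
  have hH0 : ∀ z, H (z, c0 z, d0 z) ≤ s / 20 * g (z, c0 z, d0 z) := by
    intro z
    have e1 : cdot (spin (c0 z) (d0 z)) (toC (Y z - Q z)) =
        - cdot (spin (c0 z) (d0 z)) (toC a) := by
      have := horth z
      rw [hw, cdot_toC_add] at this
      exact eq_neg_of_add_eq_zero_left this
    simp only [hH, hg]
    rw [e1, norm_neg, norm_reV_smul (cdot_spin_self _ _)]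
    have h1 := norm_cdot_toC_le (cdot_spin_self (c0 z) (d0 z)) a
    have h2 : ‖reV (spin (c0 z) (d0 z))‖ * ‖a‖ ≤ ‖reV (spin (c0 z) (d0 z))‖ * (s / 20) := by gcongr
    have h3 := mul_le_mul_of_nonneg_right (h1.trans h2) (norm_nonneg (cdot (spin (c0 z) (d0 z)) (φ z)))
    linarith
  set σ : ℂ → ℝ := fun z => Real.sqrt (Real.sqrt (1.5 * s / g (z, c0 z, d0 z))) with hσ
  have hσc : ContinuousOn σ (sphere 0 1) :=
    ((continuousOn_const.div hg0c fun z hz => (hgpos z (by simpa using hz)).ne').sqrt).sqrt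
  have hσ4 : ∀ z, ‖z‖ = 1 → ‖(σ z : ℂ)‖ ^ 4 * g (z, c0 z, d0 z) = 1.5 * s := by
    intro z hz
    have hp := hgpos z hz
    rw [Complex.norm_real, Real.norm_of_nonneg (Real.sqrt_nonneg _),
      show (4 : ℕ) = 2 * 2 by norm_num, pow_mul, Real.sq_sqrt (Real.sqrt_nonneg _),
      Real.sq_sqrt (by positivity)]
    field_simp
  obtain ⟨e1, he1, ht1⟩ := exists_uniform_tol (c := fun z => σ z * c0 z) (d := fun z => σ z * d0 z)
    ((Complex.continuous_ofReal.comp_continuousOn hσc).mul hc0c)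
    ((Complex.continuous_ofReal.comp_continuousOn hσc).mul hd0c) hgc (l := 1.2 * s) (u := 1.8 * s)
    (fun z hz => by rw [hgs, hσ4 z hz]; constructor <;> nlinarith)
  obtain ⟨e2, he2, ht2⟩ := exists_uniform_tol (c := fun z => σ z * c0 z) (d := fun z => σ z * d0 z)
    ((Complex.continuous_ofReal.comp_continuousOn hσc).mul hc0c)
    ((Complex.continuous_ofReal.comp_continuousOn hσc).mul hd0c) hHc (l := -1) (u := 0.1 * s ^ 2)
    (fun z hz => by
      rw [hHs]
      have h0 : 0 ≤ H (z, c0 z, d0 z) := mul_nonneg (norm_nonneg _) (norm_nonneg _)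
      refine ⟨by have := mul_nonneg (pow_nonneg (norm_nonneg (σ z : ℂ)) 4) h0; linarith, ?_⟩
      have h1 := mul_le_mul_of_nonneg_left (hH0 z) (pow_nonneg (norm_nonneg (σ z : ℂ)) 4)
      have h2 := hσ4 z hz
      nlinarith)
  obtain ⟨M, p, q, hp, hq, hpq⟩ := exists_entire_approx_circle₂
    (f := fun z => σ z * c0 z) (g := fun z => σ z * d0 z)
    ((Complex.continuous_ofReal.comp_continuousOn hσc).mul hc0c)
    ((Complex.continuous_ofReal.comp_continuousOn hσc).mul hd0c) (lt_min he1 he2)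
  refine ⟨fun z => spin (p z) (q z), differentiable_spin hp hq, fun z => cdot_spin_self _ _,
    fun z hz => ?_⟩
  have hz0 : z ^ M ≠ 0 := pow_ne_zero _ (by rw [← norm_pos_iff, hz]; norm_num)
  have hzM : ‖z ^ M‖ = 1 := by rw [norm_pow, hz, one_pow]
  have hconv : ∀ p f : ℂ, ‖p / z ^ M - f‖ = ‖p - z ^ M * f‖ := by
    intro p f
    rw [show p - z ^ M * f = z ^ M * (p / z ^ M - f) by field_simp, norm_mul, hzM, one_mul]
  have hp1 : p z = z ^ M * (p z / z ^ M) := by field_simp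
  have hq1 : q z = z ^ M * (q z / z ^ M) := by field_simp
  have G1 : 1.2 * s < g (z, p z, q z) ∧ g (z, p z, q z) < 1.8 * s := by
    rw [hp1, hq1, hgs, hzM, one_pow, one_mul]
    apply ht1 z hz
    · rw [hconv]; exact (hpq z hz).1.trans_le (min_le_left _ _)
    · rw [hconv]; exact (hpq z hz).2.trans_le (min_le_left _ _)
  have G2 : H (z, p z, q z) < 0.1 * s ^ 2 := by
    rw [hp1, hq1, hHs, hzM, one_pow, one_mul]
    apply (ht2 z hz _ _ _ _).2
    · rw [hconv]; exact (hpq z hz).1.trans_le (min_le_right _ _)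
    · rw [hconv]; exact (hpq z hz).2.trans_le (min_le_right _ _)
  refine ⟨G1.1, fun ζ hζ => ?_⟩
  have hnull : cdot (cdot (spin (p z) (q z)) (φ z) • spin (p z) (q z))
      (cdot (spin (p z) (q z)) (φ z) • spin (p z) (q z)) = 0 := by
    rw [cdot_smul_smul, cdot_spin_self, mul_zero]
  refine infDist_le_of_mem_convexHull hs (hQc z hz) ?_ ?_
  · rw [norm_reV_smul hnull]
    exact (mul_le_of_le_one_left (norm_nonneg _) hζ).trans G1.2.le
  · rw [← re_cdot_toC, cdot_smul_left, cdot_smul_left]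
    refine (Complex.re_le_norm _).trans ?_
    rw [norm_mul, norm_mul, mul_comm ‖cdot _ (φ z)‖]
    exact (mul_le_of_le_one_left (by positivity) hζ).trans G2.le

lemma exists_tilt_primitive {ρ : ℝ} (hρ : 1 < ρ) {Θ φ η : ℂ → Fin 3 → ℂ}
    (hΘ : ∀ z ∈ ball (0:ℂ) ρ, HasDerivAt Θ (φ z) z)
    (hφn : ∀ z ∈ ball (0:ℂ) ρ, cdot (φ z) (φ z) = 0) (hφ0 : ∀ z ∈ ball (0:ℂ) ρ, φ z ≠ 0)
    (hη : Differentiable ℂ η) (hηn : ∀ z, cdot (η z) (η z) = 0) :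
    ∃ C : ℝ, 0 ≤ C ∧ ∀ j : ℕ, ∃ Θ' φ' : ℂ → Fin 3 → ℂ,
      (∀ z ∈ ball (0:ℂ) ρ, HasDerivAt Θ' (φ' z) z) ∧
      (∀ z ∈ ball (0:ℂ) ρ, cdot (φ' z) (φ' z) = 0) ∧ (∀ z ∈ ball (0:ℂ) ρ, φ' z ≠ 0) ∧
      (∀ z, ‖z‖ ≤ 1 → ‖Θ' z - Θ z - z ^ (2 * j + 1) • cdot (η z) (φ z) • η z‖ ≤
        C / Real.sqrt (2 * j + 1)) ∧
      ∀ z, ‖z‖ ≤ 1 → ‖φ' z - φ z - ((2 * j + 1) * z ^ (2 * j)) • cdot (η z) (φ z) • η z‖ ≤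
        C * (Real.sqrt (2 * j + 1) * ‖z‖ ^ j) := by
  have hφ : DifferentiableOn ℂ φ (ball 0 ρ) := by
    have h : DifferentiableOn ℂ Θ (ball 0 ρ) := fun z hz =>
      (hΘ z hz).differentiableAt.differentiableWithinAt
    exact (h.deriv isOpen_ball).congr fun z hz => ((hΘ z hz).deriv).symm
  have hφi : ∀ i, DifferentiableOn ℂ (fun z => φ z i) (ball 0 ρ) := fun i =>
    (differentiableOn_pi.1 hφ) i
  have hηi : ∀ i, DifferentiableOn ℂ (fun z => η z i) (ball 0 ρ) := fun i =>
    ((differentiable_pi.1 hη) i).differentiableOn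
  set k : ℂ → Fin 3 → ℂ := fun z => ![η z 1 * φ z 2 - η z 2 * φ z 1,
    η z 2 * φ z 0 - η z 0 * φ z 2, η z 0 * φ z 1 - η z 1 * φ z 0] with hk
  set h : ℂ → Fin 3 → ℂ := fun z => cdot (η z) (φ z) • η z with hh
  have hki : ∀ i, DifferentiableOn ℂ (fun z => k z i) (ball 0 ρ) := by
    intro i
    fin_cases i
    · exact ((hηi 1).mul (hφi 2)).sub ((hηi 2).mul (hφi 1))
    · exact ((hηi 2).mul (hφi 0)).sub ((hηi 0).mul (hφi 2))
    · exact ((hηi 0).mul (hφi 1)).sub ((hηi 1).mul (hφi 0))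
  have hhi : ∀ i, DifferentiableOn ℂ (fun z => h z i) (ball 0 ρ) := fun i =>
    ((((hηi 0).mul (hφi 0)).add ((hηi 1).mul (hφi 1))).add ((hηi 2).mul (hφi 2))).mul (hηi i)
  choose A hA0 hA using fun i => exists_primitive_pow_mul hρ (hki i)
  choose B hB0 hB using fun i => exists_primitive_pow_mul hρ (hhi i)
  set M := ∑ i, A i + ∑ i, B i with hM
  have hAM : ∀ i, A i ≤ M := fun i => by
    have := Finset.single_le_sum (f := A) (fun i _ => hA0 i) (Finset.mem_univ i)
    have h2 : 0 ≤ ∑ i, B i := Finset.sum_nonneg fun i _ => hB0 i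
    linarith
  have hBM : ∀ i, B i ≤ M := fun i => by
    have := Finset.single_le_sum (f := B) (fun i _ => hB0 i) (Finset.mem_univ i)
    have h2 : 0 ≤ ∑ i, A i := Finset.sum_nonneg fun i _ => hA0 i
    linarith
  have hM0 : 0 ≤ M := (hA0 0).trans (hAM 0)
  refine ⟨9 * M, by positivity, fun j => ?_⟩
  choose Q hQ hkb hQb using fun i => hA i j
  choose S hS _ hSb using fun i => hB i (2 * j)
  set n : ℝ := 2 * j + 1 with hn
  have hn1 : 1 ≤ n := by rw [hn]; linarith [(Nat.cast_nonneg j : (0:ℝ) ≤ j)]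
  set c : ℝ := Real.sqrt 2 * Real.sqrt n with hc
  have hc2 : c ^ 2 = 2 * n := by
    rw [hc, mul_pow, Real.sq_sqrt (by norm_num), Real.sq_sqrt (by linarith)]
  have hc2' : (c:ℂ) ^ 2 = 2 * (2 * j + 1) := by
    have : ((c ^ 2 : ℝ) : ℂ) = ((2 * n : ℝ) : ℂ) := by rw [hc2]
    rw [hn] at this; push_cast at this; exact this
  have hsn : 1 ≤ Real.sqrt n := by rw [Real.one_le_sqrt]; exact hn1
  have hsn2 : Real.sqrt n ^ 2 = n := Real.sq_sqrt (by linarith)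
  have hs2 : Real.sqrt 2 ≤ 2 := by
    rw [Real.sqrt_le_left (by norm_num)]; norm_num
  have hc0 : 0 ≤ c := by positivity
  have hcn : c ≤ 2 * Real.sqrt n := by rw [hc]; gcongr
  have hj1 : ((j:ℂ) + 1) ≠ 0 := by exact_mod_cast Nat.succ_ne_zero j
  refine ⟨fun z i => Θ z i + ((c / (j + 1)) * Q i z + S i z),
    fun z => tilt (c * z ^ j) (η z) (φ z), fun z hz => ?_, fun z hz => ?_, fun z hz => ?_,
    fun z hz => ?_, fun z hz => ?_⟩
  · rw [hasDerivAt_pi]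
    intro i
    refine ((hasDerivAt_pi.1 (hΘ z hz) i).add
      (((hQ i z hz).const_mul _).add (hS i z hz))).congr_deriv ?_
    have e : tilt (c * z ^ j) (η z) (φ z) i =
        φ z i + (c * z ^ j * k z i + (c * z ^ j) ^ 2 / 2 * h z i) := rfl
    refine Eq.trans ?_ e.symm
    rw [mul_pow, hc2', ← pow_mul, mul_comm j 2]
    push_cast
    field_simp
  · exact cdot_tilt_self (hηn z) (hφn z hz)
  · exact tilt_ne_zero (hηn z) (hφ0 z hz)
  · rw [pi_norm_le_iff_of_nonneg (by positivity)]
    intro i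
    have h1 : ‖Q i z‖ ≤ 2 * M := by
      have e1 := hQb i z hz
      have e2 := hkb i z hz
      have e3 : ‖z ^ (j + 1) * k z i‖ ≤ M := by
        rw [norm_mul, norm_pow]
        calc _ ≤ 1 * A i := by
              gcongr
              exact pow_le_one₀ (norm_nonneg _) hz
          _ ≤ M := by rw [one_mul]; exact hAM i
      have e4 : A i / (j + 1) ≤ M := by
        refine (div_le_self (hA0 i) ?_).trans (hAM i)
        linarith [(Nat.cast_nonneg j : (0:ℝ) ≤ j)]
      have := norm_add_le (Q i z - z ^ (j + 1) * k z i) (z ^ (j + 1) * k z i)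
      rw [sub_add_cancel] at this
      linarith
    have h2 := hSb i z hz
    have e : (fun i => Θ z i + ((c / (j + 1)) * Q i z + S i z) : Fin 3 → ℂ) i - Θ z i -
        z ^ (2 * j + 1) * h z i = (c / (j + 1)) * Q i z + (S i z - z ^ (2 * j + 1) * h z i) := by
      ring
    change ‖(fun i => Θ z i + ((c / (j + 1)) * Q i z + S i z) : Fin 3 → ℂ) i - Θ z i -
        z ^ (2 * j + 1) * h z i‖ ≤ _
    rw [e]
    have e5 : ‖(c / (j + 1) : ℂ)‖ = c / (j + 1) := by
      have : (c / (j + 1) : ℂ) = ((c / (j + 1) : ℝ) : ℂ) := by push_cast; rfl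
      rw [this, Complex.norm_real, Real.norm_of_nonneg (by positivity)]
    have e6 : c / (j + 1) ≤ 4 / Real.sqrt n := by
      rw [div_le_div_iff₀ (by positivity) (by positivity)]
      nlinarith
    have e7 : B i / ((2 * j : ℕ) + 1) ≤ M / Real.sqrt n := by
      have : (((2 * j : ℕ) : ℝ) + 1) = n := by rw [hn]; push_cast; ring
      rw [this]
      gcongr
      · exact hBM i
      · nlinarith
    calc _ ≤ ‖(c / (j + 1) : ℂ) * Q i z‖ + ‖S i z - z ^ (2 * j + 1) * h z i‖ := norm_add_le _ _
      _ ≤ 4 / Real.sqrt n * (2 * M) + M / Real.sqrt n := by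
        rw [norm_mul, e5]
        gcongr
        exact h2.trans e7
      _ = _ := by ring
  · rw [pi_norm_le_iff_of_nonneg (by positivity)]
    intro i
    have e : tilt (c * z ^ j) (η z) (φ z) i =
        φ z i + (c * z ^ j * k z i + (c * z ^ j) ^ 2 / 2 * h z i) := rfl
    change ‖tilt (c * z ^ j) (η z) (φ z) i - φ z i - (2 * j + 1) * z ^ (2 * j) * h z i‖ ≤ _
    rw [e, mul_pow, hc2', ← pow_mul]
    have e2 : φ z i + (c * z ^ j * k z i + 2 * (2 * j + 1) * z ^ (j * 2) / 2 * h z i) - φ z i -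
        (2 * j + 1) * z ^ (2 * j) * h z i = c * z ^ j * k z i := by
      rw [mul_comm j 2]; ring
    rw [e2, norm_mul, norm_mul, norm_pow, Complex.norm_real, Real.norm_of_nonneg hc0]
    have h2 := (hkb i z hz).trans (hAM i)
    calc c * ‖z‖ ^ j * ‖k z i‖ ≤ (2 * Real.sqrt n) * ‖z‖ ^ j * M := by gcongr
      _ ≤ 9 * M * (Real.sqrt n * ‖z‖ ^ j) := by
        have : 0 ≤ M * (Real.sqrt n * ‖z‖ ^ j) := by positivity
        nlinarith

lemma exists_shell {p : ℂ → Prop}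
    (h : ∀ z : ℂ, ‖z‖ = 1 → ∀ᶠ w in nhds z, p w) :
    ∃ κ > 0, ∀ w : ℂ, 1 - κ ≤ ‖w‖ → ‖w‖ ≤ 1 → p w := by
  obtain ⟨δ, hδ, hδs⟩ := (isCompact_sphere (0:ℂ) 1).exists_thickening_subset_open
    (isOpen_interior (s := {w | p w})) (fun z hz => mem_interior_iff_mem_nhds.2
      (h z (by simpa using hz)))
  refine ⟨min (δ / 2) (1 / 2), by positivity, fun w h1 h2 => ?_⟩
  have hw : 0 < ‖w‖ := by
    have := min_le_right (δ / 2) (1 / 2)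
    linarith
  have hw' : (‖w‖ : ℂ) ≠ 0 := by exact_mod_cast hw.ne'
  refine interior_subset (hδs (mem_thickening_iff.2 ⟨w / ‖w‖, ?_, ?_⟩))
  · simp [hw.ne']
  · have : w - w / ‖w‖ = w / ‖w‖ * (‖w‖ - 1 : ℝ) := by push_cast; field_simp
    rw [dist_eq_norm, this, norm_mul, norm_div, Complex.norm_real, Complex.norm_real, norm_norm,
      div_self hw.ne', one_mul, Real.norm_eq_abs, abs_of_nonpos (by linarith)]
    have := min_le_left (δ / 2) (1 / 2)
    linarith

theorem exists_stretching {ρ ρ0 r s R ε : ℝ} (hρ : 1 < ρ) (hρ0 : 0 < ρ0) (hρ1 : ρ0 < 1)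
    {Θ φ : ℂ → Fin 3 → ℂ} (hΘ : ∀ z ∈ ball (0:ℂ) ρ, HasDerivAt Θ (φ z) z)
    (hφn : ∀ z ∈ ball (0:ℂ) ρ, cdot (φ z) (φ z) = 0) (hφ0 : ∀ z ∈ ball (0:ℂ) ρ, φ z ≠ 0)
    {Γ : Set R3} (hΓ : Γ.Nonempty) (hr : 0 < r) (hs : 0 < s)
    (hR : Real.sqrt ((2 * s) ^ 2 + r ^ 2) < R)
    (hT : ∀ z : ℂ, ρ0 ≤ ‖z‖ → ‖z‖ ≤ 1 → reV (Θ z) ∈ thickening r Γ) (hε : 0 < ε) :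
    ∃ Θ' φ' : ℂ → Fin 3 → ℂ, (∀ z ∈ ball (0:ℂ) ρ, HasDerivAt Θ' (φ' z) z) ∧
      (∀ z ∈ ball (0:ℂ) ρ, cdot (φ' z) (φ' z) = 0) ∧ (∀ z ∈ ball (0:ℂ) ρ, φ' z ≠ 0) ∧
      (∀ z : ℂ, ‖z‖ ≤ ρ0 → ‖reV (Θ z) - reV (Θ' z)‖ < ε) ∧
      (∀ z : ℂ, ρ0 ≤ ‖z‖ → ‖z‖ ≤ 1 → ∀ t ∈ Icc (0:ℝ) 1,
        reV (Θ z) + t • (reV (Θ' z) - reV (Θ z)) ∈ thickening R Γ) ∧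
      ∃ κ s' : ℝ, 0 < κ ∧ κ < 1 - ρ0 ∧ s < s' ∧ ∀ α : ℝ → ℂ, ContinuousOn α (Icc 0 1) →
        MapsTo α (Icc 0 1) (closedBall 0 1) → 1 - κ ≤ ‖α 0‖ → ‖α 1‖ ≤ ρ0 →
        ENNReal.ofReal s' ≤ eVariationOn ((fun z => reV (Θ' z)) ∘ α) (Icc 0 1) := by
  have hΘd : DifferentiableOn ℂ Θ (ball 0 ρ) := fun z hz =>
      (hΘ z hz).differentiableAt.differentiableWithinAt
  have hφ : DifferentiableOn ℂ φ (ball 0 ρ) :=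
    (hΘd.deriv isOpen_ball).congr fun z hz => ((hΘ z hz).deriv).symm
  have hYc : ContDiffOn ℝ 1 (fun z => reV (Θ z)) (ball 0 ρ) :=
    reV.contDiff.comp_contDiffOn ((hΘd.contDiffOn isOpen_ball).restrict_scalars ℝ)
  have hcb : closedBall (0:ℂ) 1 ⊆ ball 0 ρ := closedBall_subset_ball hρ
  obtain ⟨η, hη, hηn, hηs⟩ := exists_null_field hρ hφ hφn hφ0 hYc hs
    (fun z hz => hT z (by rw [hz]; exact hρ1.le) hz.le)
  obtain ⟨C, hC0, hC⟩ := exists_tilt_primitive hρ hΘ hφn hφ0 hη hηn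
  set h : ℂ → Fin 3 → ℂ := fun z => cdot (η z) (φ z) • η z with hh
  have hhn : ∀ z, cdot (h z) (h z) = 0 := fun z => by rw [hh, cdot_smul_smul, hηn, mul_zero]
  have hhc : ContinuousOn h (ball 0 ρ) :=
    ContinuousOn.smul (ContinuousOn.cdot hη.continuous.continuousOn hφ.continuousOn)
      hη.continuous.continuousOn
  obtain ⟨M, hM⟩ := (isCompact_closedBall (0:ℂ) 1).exists_bound_of_continuousOn (hhc.mono hcb)
  obtain ⟨N, hN⟩ := (isCompact_closedBall (0:ℂ) 1).exists_bound_of_continuousOn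
    (hφ.continuousOn.mono hcb)
  have hM0 : 0 ≤ M := (norm_nonneg _).trans (hM 0 (by simp))
  have hN0 : 0 ≤ N := (norm_nonneg _).trans (hN 0 (by simp))
  obtain ⟨R2, hR2, hR2R⟩ := exists_between hR
  have hrR2 : r < R2 := lt_of_le_of_lt (Real.le_sqrt_of_sq_le (by nlinarith)) hR2
  set C' : ℝ := 2 * N + 10 * C ^ 2 / s with hC'
  have hC'0 : 0 ≤ C' := by positivity
  obtain ⟨κ1, hκ1, hsh⟩ := exists_shell (p := fun z => 1.2 * s < ‖reV (h z)‖ ∧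
      ∀ ζ ∈ closedBall (0:ℂ) 1, infDist (reV (Θ z) + reV (ζ • h z)) Γ < R2) (by
    intro z hz
    obtain ⟨h1, h2⟩ := hηs z hz
    have hzb : ball (0:ℂ) ρ ∈ nhds z := isOpen_ball.mem_nhds (by simpa [hz] using hρ)
    have hhz : ContinuousAt h z := hhc.continuousAt hzb
    refine Filter.Eventually.and ?_ ?_
    · exact ((reV.continuous.continuousAt.comp hhz).norm).eventually_const_lt h1
    · refine (isCompact_closedBall (0:ℂ) 1).eventually_forall_of_forall_eventually
        fun ζ hζ => ?_
      have h3 := (h2 ζ (by simpa using hζ)).trans_lt hR2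
      have hc : ContinuousAt (fun q : ℂ × ℂ => infDist (reV (Θ q.1) + reV (q.2 • h q.1)) Γ)
          (z, ζ) := by
        refine (continuous_infDist_pt Γ).continuousAt.comp ?_
        refine ContinuousAt.add ?_ ?_
        · exact ContinuousAt.comp (f := Prod.fst) (x := (z, ζ)) (g := fun z => reV (Θ z))
            (hYc.continuousOn.continuousAt hzb) continuousAt_fst
        · refine reV.continuous.continuousAt.comp (ContinuousAt.smul continuousAt_snd ?_)
          exact ContinuousAt.comp (f := Prod.fst) (x := (z, ζ)) (g := h) hhz continuousAt_fst
      exact hc.eventually_lt_const h3)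
  obtain ⟨κ0, hκ0, hκ0'⟩ : ∃ κ0 : ℝ, 0 < κ0 ∧ κ0 ≤ κ1 ∧ κ0 < 1 - ρ0 ∧ C' * κ0 ≤ 0.01 * s := by
    refine ⟨min κ1 (min ((1 - ρ0) / 2) (0.01 * s / (C' + 1))), ?_, min_le_left _ _, ?_, ?_⟩
    · refine lt_min hκ1 (lt_min (by linarith) (by positivity))
    · refine lt_of_le_of_lt ((min_le_right _ _).trans (min_le_left _ _)) (by linarith)
    · calc C' * min κ1 (min ((1 - ρ0) / 2) (0.01 * s / (C' + 1)))
          ≤ (C' + 1) * (0.01 * s / (C' + 1)) := by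
            gcongr
            · linarith
            · exact (min_le_right _ _).trans (min_le_right _ _)
        _ = 0.01 * s := by field_simp
  obtain ⟨hκa, hκb, hκc⟩ := hκ0'
  set a : ℝ := 1 - κ0 with ha
  have haρ : ρ0 < a := by linarith
  have ha0 : 0 < a := hρ0.trans haρ
  have ha1 : a < 1 := by linarith
  set δ : ℝ := min ε (R - R2) with hδ
  have hδ0 : 0 < δ := lt_min hε (by linarith)
  have hpow : Filter.Tendsto (fun j : ℕ => a ^ (2 * j + 1)) Filter.atTop (nhds 0) :=
    (tendsto_pow_atTop_nhds_zero_of_lt_one ha0.le ha1).comp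
      (Filter.tendsto_atTop_mono (fun j => (by simp only [id]; omega : id j ≤ 2 * j + 1)) Filter.tendsto_id)
  have hsq : Filter.Tendsto (fun j : ℕ => C / Real.sqrt (2 * j + 1)) Filter.atTop (nhds 0) := by
    refine Filter.Tendsto.const_div_atTop ?_ C
    refine Real.tendsto_sqrt_atTop.comp ?_
    refine Filter.tendsto_atTop_mono (fun j => ?_) tendsto_natCast_atTop_atTop
    have : (0:ℝ) ≤ j := Nat.cast_nonneg j
    linarith
  have hev : ∀ᶠ j : ℕ in Filter.atTop, a ^ (2 * j + 1) < 0.01 ∧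
      2 * (a ^ (2 * j + 1) * M + C / Real.sqrt (2 * j + 1)) < δ := by
    refine (hpow.eventually_lt_const (by norm_num)).and ?_
    have := ((hpow.mul_const M).add hsq).const_mul 2
    simp only [zero_mul, add_zero, mul_zero] at this
    exact this.eventually_lt_const hδ0
  obtain ⟨j, hj1, hj2⟩ := hev.exists
  obtain ⟨Θ', φ', hΘ', hφn', hφ0', hest, hest'⟩ := hC j
  set e : ℝ := C / Real.sqrt (2 * j + 1) with he
  have he0 : 0 ≤ e := by positivity
  have hdiff : ∀ z : ℂ, ‖z‖ ≤ 1 → ‖reV (Θ' z) - reV (Θ z) - reV (z ^ (2 * j + 1) • h z)‖ ≤ 2 * e := by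
    intro z hz
    rw [← map_sub, ← map_sub]
    exact (norm_reV_le _).trans (by gcongr; exact hest z hz)
  have hinner : ∀ z : ℂ, ‖z‖ ≤ a → ‖reV (Θ' z) - reV (Θ z)‖ < δ := by
    intro z hz
    have hz1 : ‖z‖ ≤ 1 := hz.trans ha1.le
    refine lt_of_le_of_lt ?_ hj2
    rw [← map_sub]
    refine (norm_reV_le _).trans ?_
    gcongr
    have := hest z hz1
    have h2 : ‖z ^ (2 * j + 1) • h z‖ ≤ a ^ (2 * j + 1) * M := by
      rw [norm_smul, norm_pow]
      gcongr
      exact hM z (by simpa using hz1)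
    have h3 := norm_add_le (Θ' z - Θ z - z ^ (2 * j + 1) • h z) (z ^ (2 * j + 1) • h z)
    rw [sub_add_cancel] at h3
    linarith
  have h2e : 2 * e < δ := by
    have : 0 ≤ a ^ (2 * j + 1) * M := by positivity
    linarith
  refine ⟨Θ', φ', hΘ', hφn', hφ0', fun z hz => ?_, fun z hz0 hz1 t ht => ?_, ?_⟩
  · rw [norm_sub_rev]
    exact (hinner z (hz.trans haρ.le)).trans_le (min_le_left _ _)
  · rw [mem_thickening_iff_infDist_lt hΓ]
    rcases le_total ‖z‖ a with hza | hza
    · have h1 := hT z hz0 hz1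
      rw [mem_thickening_iff_infDist_lt hΓ] at h1
      have h2 := infDist_le_infDist_add_dist (s := Γ)
        (x := reV (Θ z) + t • (reV (Θ' z) - reV (Θ z))) (y := reV (Θ z))
      rw [dist_eq_norm, add_sub_cancel_left, norm_smul, Real.norm_of_nonneg ht.1] at h2
      have h3 := hinner z hza
      have h4 : t * ‖reV (Θ' z) - reV (Θ z)‖ ≤ 1 * ‖reV (Θ' z) - reV (Θ z)‖ := by
        gcongr; exact ht.2
      have h5 : δ ≤ R - R2 := min_le_right _ _
      linarith
    · have h1 := (hsh z (by linarith) hz1).2 (t * z ^ (2 * j + 1)) (by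
        rw [mem_closedBall_zero_iff, norm_mul, Complex.norm_real, Real.norm_of_nonneg ht.1,
          norm_pow]
        exact mul_le_one₀ ht.2 (by positivity) (pow_le_one₀ (norm_nonneg _) hz1))
      have h2 := infDist_le_infDist_add_dist (s := Γ)
        (x := reV (Θ z) + t • (reV (Θ' z) - reV (Θ z)))
        (y := reV (Θ z) + reV (((t:ℂ) * z ^ (2 * j + 1)) • h z))
      have h6 : reV (((t:ℂ) * z ^ (2 * j + 1)) • h z) = t • reV (z ^ (2 * j + 1) • h z) := by
        rw [← map_smul, mul_smul]; rfl
      rw [dist_eq_norm, add_sub_add_left_eq_sub, h6, ← smul_sub, norm_smul,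
        Real.norm_of_nonneg ht.1] at h2
      rw [h6] at h1
      have h3 := hdiff z hz1
      have h4 : t * ‖reV (Θ' z) - reV (Θ z) - reV (z ^ (2 * j + 1) • h z)‖ ≤
          1 * ‖reV (Θ' z) - reV (Θ z) - reV (z ^ (2 * j + 1) • h z)‖ := by
        gcongr; exact ht.2
      have h5 : δ ≤ R - R2 := min_le_right _ _
      linarith
  · obtain ⟨κ, hκ, hκκ, hκp⟩ : ∃ κ : ℝ, 0 < κ ∧ κ < κ0 ∧ 0.99 < (1 - κ) ^ (2 * j + 1) := by
      have hc : Filter.Tendsto (fun κ : ℝ => (1 - κ) ^ (2 * j + 1)) (nhdsWithin 0 (Ioi 0))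
          (nhds 1) := by
        have : Continuous fun κ : ℝ => (1 - κ) ^ (2 * j + 1) := by fun_prop
        have h2 := this.tendsto 0
        simp only [sub_zero, one_pow] at h2
        exact h2.mono_left nhdsWithin_le_nhds
      have h1 := (hc.eventually_const_lt (by norm_num : (0.99:ℝ) < 1)).and
        (Ioo_mem_nhdsGT hκ0)
      obtain ⟨κ, h2, h3⟩ := h1.exists
      exact ⟨κ, h3.1, h3.2, h2⟩
    refine ⟨κ, 1.05 * s, hκ, by linarith, by linarith, fun α hα hαm hα0 hα1 => ?_⟩
    set n : ℝ := 2 * j + 1 with hn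
    have hn0 : 0 < n := by positivity
    have hΘd' : DifferentiableOn ℂ Θ' (ball 0 ρ) := fun z hz =>
      (hΘ' z hz).differentiableAt.differentiableWithinAt
    have hcd := hΘd'.contDiffOn (n := 1) isOpen_ball
    have key := eVariationOn_ge_of_conformal (Y := fun z => reV (Θ' z))
      (L := fun z => reV.comp
        (((ContinuousLinearMap.toSpanSingleton ℂ (φ' z))).restrictScalars ℝ))
      (lam := fun z => ‖reV (φ' z)‖)
      (ψ := fun x => 1.1 * s * (n * x ^ (2 * j)) - C') (a := a) (b := 1 - κ)
      (ϑ := 0.01) (by linarith) (by norm_num) (by norm_num) (by fun_prop)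
      (fun z hz => by
        have h1 : HasStrictFDerivAt Θ' (ContinuousLinearMap.toSpanSingleton ℂ (φ' z)) z := by
          have h2 := (hcd.contDiffAt (isOpen_ball.mem_nhds (hcb hz))).hasStrictFDerivAt one_ne_zero
          rwa [(hΘ' z (hcb hz)).hasFDerivAt.fderiv] at h2
        exact reV.hasStrictFDerivAt.comp z (h1.restrictScalars ℝ))
      (fun z hz v => by
        change ‖reV (v • φ' z)‖ = _
        rw [norm_reV_smul (hφn' z (hcb hz)), mul_comm])
      (fun z hz => norm_pos_iff.2 (reV_ne_zero (hφn' z (hcb hz)) (hφ0' z (hcb hz))))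
      (fun z hz haz => by
        have hz1 : ‖z‖ ≤ 1 := by simpa using hz
        have h1 := (hsh z (by linarith) hz1).1
        have h2 := hest' z hz1
        have h3 := norm_reV_smul (hhn z) ((2 * j + 1) * z ^ (2 * j))
        have h4 : ‖((2 * j + 1) * z ^ (2 * j) : ℂ)‖ = n * ‖z‖ ^ (2 * j) := by
          have : (2 * j + 1 : ℂ) = ((n : ℝ) : ℂ) := by rw [hn]; push_cast; rfl
          rw [this, norm_mul, norm_pow, Complex.norm_real, Real.norm_of_nonneg hn0.le]
        rw [h4] at h3
        have h5 : ‖reV (φ z)‖ ≤ 2 * N := (norm_reV_le _).trans (by gcongr; exact hN z hz)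
        have h6 : ‖reV (φ' z - φ z - ((2 * j + 1) * z ^ (2 * j)) • h z)‖ ≤
            2 * (C * (Real.sqrt n * ‖z‖ ^ j)) := (norm_reV_le _).trans (by gcongr)
        have h7 : ‖reV (((2 * j + 1) * z ^ (2 * j) : ℂ) • h z)‖ ≤ ‖reV (φ' z)‖ + ‖reV (φ z)‖ +
            ‖reV (φ' z - φ z - ((2 * j + 1) * z ^ (2 * j)) • h z)‖ := by
          have e1 : reV (((2 * j + 1) * z ^ (2 * j) : ℂ) • h z) = reV (φ' z) - reV (φ z) -
              reV (φ' z - φ z - ((2 * j + 1) * z ^ (2 * j)) • h z) := by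
            simp only [map_sub]; abel
          rw [e1]
          exact (norm_sub_le _ _).trans (by gcongr; exact norm_sub_le _ _)
        set y := Real.sqrt n * ‖z‖ ^ j with hy
        have hy2 : y ^ 2 = n * ‖z‖ ^ (2 * j) := by
          rw [hy, mul_pow, Real.sq_sqrt hn0.le, ← pow_mul, mul_comm j 2]
        rw [← hy2] at h3 ⊢
        have h8 : y ^ 2 * (1.2 * s) ≤ y ^ 2 * ‖reV (h z)‖ := by gcongr
        have h9 : 2 * (C * y) ≤ 0.1 * s * y ^ 2 + 10 * C ^ 2 / s := by
          have : 0 ≤ (0.1 * s * y - C) ^ 2 / (0.1 * s) := by positivity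
          have e : (0.1 * s * y - C) ^ 2 / (0.1 * s) =
            0.1 * s * y ^ 2 + 10 * C ^ 2 / s - 2 * (C * y) := by field_simp; ring
          linarith
        rw [hC']
        linarith)
      hα hαm hα0 (hα1.trans haρ.le)
    refine le_trans (ENNReal.ofReal_le_ofReal ?_) key
    have hint : ∫ x in a..(1 - κ), (1.1 * s * (n * x ^ (2 * j)) - C') =
        1.1 * s * ((1 - κ) ^ (2 * j + 1) - a ^ (2 * j + 1)) - C' * (1 - κ - a) := by
      rw [intervalIntegral.integral_sub, intervalIntegral.integral_const_mul,
        intervalIntegral.integral_const_mul, integral_pow, intervalIntegral.integral_const,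
        smul_eq_mul]
      · rw [hn]; push_cast; field_simp
      · exact Continuous.intervalIntegrable (by fun_prop) _ _
      · exact Continuous.intervalIntegrable (by fun_prop) _ _
    rw [hint]
    have h1 : C' * (1 - κ - a) ≤ 0.01 * s := le_trans (by gcongr; linarith) hκc
    have h2 : 1.1 * s * 0.98 ≤ 1.1 * s * ((1 - κ) ^ (2 * j + 1) - a ^ (2 * j + 1)) := by
      gcongr; linarith
    nlinarith

/-- `g` is piecewise linear, interpolating the values `a k` at the nodes `k / N`. -/
def IsPL (N : ℕ) (a : ℤ → ℂ) (g : ℝ → ℂ) : Prop :=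
  ∀ k : ℤ, ∀ s ∈ Icc ((k:ℝ) / N) ((k + 1) / N), g s = a k + ((s - k / N) * N : ℝ) • (a (k + 1) - a k)

/-- The piecewise linear interpolation of the values `a k` at the nodes `k / N`. -/
def plInterp (N : ℕ) (a : ℤ → ℂ) (t : ℝ) : ℂ :=
  a ⌊N * t⌋ + Int.fract (N * t) • (a (⌊N * t⌋ + 1) - a ⌊N * t⌋)

lemma isPL_plInterp {N : ℕ} (hN : 0 < N) (a : ℤ → ℂ) : IsPL N a (plInterp N a) := by
  intro k s hs
  have hN' : (0:ℝ) < N := by exact_mod_cast hN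
  have h1 : (k:ℝ) ≤ N * s := by
    have := hs.1; rw [div_le_iff₀ hN'] at this; linarith
  have h2 : N * s ≤ k + 1 := by
    have := hs.2; rw [le_div_iff₀ hN'] at this; linarith
  have e : (s - k / N) * N = N * s - k := by field_simp
  rw [e]
  rcases h2.lt_or_eq with h2 | h2
  · have : ⌊N * s⌋ = k := Int.floor_eq_iff.2 ⟨h1, h2⟩
    rw [plInterp, this, Int.fract, this]
  · have h3 : (N:ℝ) * s = ((k + 1 : ℤ) : ℝ) := by rw [h2]; push_cast; ring
    rw [plInterp, h3, Int.floor_intCast, Int.fract_intCast]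
    push_cast
    simp

lemma plInterp_periodic {N : ℕ} {a : ℤ → ℂ} (ha : ∀ k, a (k + N) = a k) :
    Periodic (plInterp N a) 1 := by
  intro t
  have e : (N:ℝ) * (t + 1) = N * t + (N : ℤ) := by push_cast; ring
  have h2 : a (⌊N * t⌋ + N + 1) = a (⌊N * t⌋ + 1) := by rw [add_right_comm, ha]
  simp only [plInterp, e, Int.floor_add_intCast, Int.fract_add_intCast, ha, h2]

lemma exists_edge {N : ℕ} (hN : 0 < N) (x : ℝ) :
    ∃ k : ℤ, (k:ℝ) / N ≤ x ∧ x < (k + 1) / N := by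
  have hN' : (0:ℝ) < N := by exact_mod_cast hN
  refine ⟨⌊N * x⌋, ?_, ?_⟩
  · rw [div_le_iff₀ hN', mul_comm]; exact Int.floor_le _
  · rw [lt_div_iff₀ hN', mul_comm]; exact Int.lt_floor_add_one _

lemma IsPL.hasDerivWithinAt {N : ℕ} (hN : 0 < N) {a : ℤ → ℂ} {g : ℝ → ℂ} (h : IsPL N a g)
    {k : ℤ} {x : ℝ} (h1 : (k:ℝ) / N ≤ x) (h2 : x < (k + 1) / N) :
    HasDerivWithinAt g ((N:ℝ) • (a (k + 1) - a k)) (Ici x) x := by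
  have h3 : HasDerivAt (fun s : ℝ => a k + ((s - k / N) * N : ℝ) • (a (k + 1) - a k))
      ((N:ℝ) • (a (k + 1) - a k)) x := by
    refine (((((hasDerivAt_id x).sub_const _).mul_const _).smul_const _).const_add _).congr_deriv ?_
    simp
  refine (h3.hasDerivWithinAt (s := Ici x)).congr_of_eventuallyEq ?_ (h k x ⟨h1, h2.le⟩)
  filter_upwards [Ico_mem_nhdsGE h2] with y hy
  exact h k y ⟨h1.trans hy.1, hy.2.le⟩

lemma IsPL.continuous {N : ℕ} (hN : 0 < N) {a : ℤ → ℂ} {g : ℝ → ℂ} (h : IsPL N a g) :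
    Continuous g := by
  have hN' : (0:ℝ) < N := by exact_mod_cast hN
  rw [continuous_iff_continuousAt]
  intro x
  rw [continuousAt_iff_continuous_left_right]
  constructor
  · set k : ℤ := ⌈N * x⌉ - 1 with hk
    have h1 : (k:ℝ) / N < x := by
      rw [div_lt_iff₀ hN', hk]; push_cast; linarith [Int.ceil_lt_add_one ((N:ℝ) * x)]
    have h2 : x ≤ (k + 1) / N := by
      rw [le_div_iff₀ hN', hk]; push_cast; linarith [Int.le_ceil ((N:ℝ) * x)]
    have h3 : Continuous (fun s : ℝ => a k + ((s - k / N) * N : ℝ) • (a (k + 1) - a k)) := by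
      fun_prop
    refine h3.continuousWithinAt.congr_of_eventuallyEq ?_ (h k x ⟨h1.le, h2⟩)
    filter_upwards [Ioc_mem_nhdsLE h1] with y hy
    exact h k y ⟨hy.1.le, hy.2.trans h2⟩
  · obtain ⟨k, h1, h2⟩ := exists_edge hN x
    exact (h.hasDerivWithinAt hN h1 h2).continuousWithinAt

lemma IsPL.sub_le_of_slope {N : ℕ} (hN : 0 < N) {a : ℤ → ℂ} {g : ℝ → ℂ} (h : IsPL N a g)
    {b b' : ℝ → ℂ} (hb : ∀ x, HasDerivAt b (b' x) x) {C : ℝ}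
    (hC : ∀ k : ℤ, ∀ x : ℝ, (k:ℝ) / N ≤ x → x < (k + 1) / N →
      ‖(N:ℝ) • (a (k + 1) - a k) - b' x‖ ≤ C) (t u : ℝ) :
    ‖(g t - b t) - (g u - b u)‖ ≤ C * |t - u| := by
  wlog hut : u ≤ t generalizing t u
  · rw [norm_sub_rev, abs_sub_comm]; exact this u t (le_of_not_ge hut)
  choose k hk1 hk2 using exists_edge hN
  rw [abs_of_nonneg (by linarith)]
  refine norm_image_sub_le_of_norm_deriv_right_le_segment (f := fun x => g x - b x)
    (f' := fun x => (N:ℝ) • (a (k x + 1) - a (k x)) - b' x) ?_ ?_ ?_ t ⟨hut, le_rfl⟩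
  · exact ((h.continuous hN).sub (continuous_iff_continuousAt.2 fun x =>
      (hb x).continuousAt)).continuousOn
  · exact fun x _ => (h.hasDerivWithinAt hN (hk1 x) (hk2 x)).sub (hb x).hasDerivWithinAt
  · exact fun x _ => hC _ x (hk1 x) (hk2 x)

lemma IsPL.lipschitz {N : ℕ} (hN : 0 < N) {a : ℤ → ℂ} {g : ℝ → ℂ} (h : IsPL N a g) {C : ℝ}
    (hC : ∀ k : ℤ, ‖a (k + 1) - a k‖ ≤ C) (t u : ℝ) : ‖g t - g u‖ ≤ N * C * |t - u| := by
  have := h.sub_le_of_slope hN (b := fun _ => 0) (b' := fun _ => 0) (fun x => hasDerivAt_const x _)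
    (C := N * C) (fun k x _ _ => by
      rw [sub_zero, norm_smul, Real.norm_of_nonneg (Nat.cast_nonneg _)]; gcongr; exact hC k) t u
  simpa using this

lemma exists_uniform_of_periodic {N : ℕ} (hN : 0 < N) {f : ℤ → ℝ} (hf : ∀ k, f (k + N) = f k)
    (hf0 : ∀ k, 0 < f k) : ∃ c > 0, ∃ C, ∀ k, c ≤ f k ∧ f k ≤ C := by
  have hp : Periodic f (N:ℤ) := hf
  have hne : (Finset.range N).Nonempty := ⟨0, by simpa using hN⟩
  obtain ⟨i, -, hi⟩ := Finset.exists_min_image (Finset.range N) (fun j => f j) hne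
  obtain ⟨i', -, hi'⟩ := Finset.exists_max_image (Finset.range N) (fun j => f j) hne
  have key : ∀ k : ℤ, ∃ j ∈ Finset.range N, f k = f (j : ℕ) := by
    intro k
    have hN0 : (N:ℤ) ≠ 0 := by exact_mod_cast hN.ne'
    refine ⟨(k % N).toNat, ?_, ?_⟩
    · have := Int.emod_lt_of_pos k (by exact_mod_cast hN : (0:ℤ) < N)
      have := Int.emod_nonneg k hN0
      simp; omega
    · rw [Int.toNat_of_nonneg (Int.emod_nonneg k hN0)]
      have e : k = k % N + (k / N) • (N:ℤ) := by rw [smul_eq_mul, Int.emod_add_ediv_mul]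
      conv_lhs => rw [e]
      exact (hp.zsmul _) _
  refine ⟨f i, hf0 _, f i', fun k => ?_⟩
  obtain ⟨j, hj, e⟩ := key k
  rw [e]
  exact ⟨hi j hj, hi' j hj⟩

lemma PolygonParam.exists_int {p : ℝ → ℂ} (hp : PolygonParam p) {s t : ℝ} (h : p s = p t) :
    ∃ k : ℤ, s - t = k := by
  obtain ⟨-, hper, hinj, -⟩ := hp
  have h1 : ∀ x, p (Int.fract x) = p x := fun x => by
    rw [Int.fract, ← mul_one (⌊x⌋ : ℝ)]; exact hper.sub_int_mul_eq _
  have h2 := hinj (Int.fract s) ⟨Int.fract_nonneg _, Int.fract_lt_one _⟩ (Int.fract t)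
    ⟨Int.fract_nonneg _, Int.fract_lt_one _⟩ (by rw [h1, h1, h])
  exact Int.fract_eq_fract.1 h2

lemma PolygonParam.exists_isPL {p : ℝ → ℂ} (hp : PolygonParam p) :
    ∃ N : ℕ, 0 < N ∧ IsPL N (fun k => p (k / N)) p := by
  obtain ⟨-, hper, -, N, hN, h⟩ := hp
  have hN' : (0:ℝ) < N := by exact_mod_cast hN
  refine ⟨N, hN, fun k s hs => ?_⟩
  have hN0 : (N:ℤ) ≠ 0 := by exact_mod_cast hN.ne'
  obtain ⟨i, hi⟩ := Int.eq_ofNat_of_zero_le (Int.emod_nonneg k hN0)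
  have hiN : i < N := by
    have := Int.emod_lt_of_pos k (by exact_mod_cast hN : (0:ℤ) < N)
    omega
  have e : k = i + N * (k / N) := by rw [← hi, Int.emod_add_mul_ediv]
  set q := k / N with hq
  have ek : (k:ℝ) = i + N * q := by exact_mod_cast e
  have e1 : (k:ℝ) / N = i / N + q * 1 := by rw [ek]; field_simp
  have e2 : ((k:ℝ) + 1) / N = (i + 1) / N + q * 1 := by rw [ek]; field_simp; ring
  have hs' : s - q * 1 ∈ Icc ((i:ℝ) / N) ((i + 1) / N) := by
    rw [e1, e2] at hs
    exact ⟨by linarith [hs.1], by linarith [hs.2]⟩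
  have := h i hiN _ hs'
  rw [hper.sub_int_mul_eq] at this
  push_cast
  rw [e1, e2, (hper.int_mul q) _, (hper.int_mul q) _, this]
  congr 3
  ring

/-- The edges of a polygon are nondegenerate, and consecutive edges do not fold back. -/
lemma PolygonParam.exists_edges {p : ℝ → ℂ} (hp : PolygonParam p) :
    ∃ (N : ℕ) (e : ℤ → ℂ), 0 < N ∧ IsPL N (fun k => p (k / N)) p ∧
      (∀ k : ℤ, e k = p ((k + 1 : ℤ) / N) - p (k / N)) ∧
      (∀ k, e (k + N) = e k) ∧ (∀ k, e k ≠ 0) ∧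
      ∀ k, 0 < 1 + ((starRingEnd ℂ) (e k / ‖e k‖) * (e (k - 1) / ‖e (k - 1)‖)).re := by
  obtain ⟨N, hN, hPL⟩ := hp.exists_isPL
  have hN' : (0:ℝ) < N := by exact_mod_cast hN
  have hN1 : (1:ℝ) ≤ N := by exact_mod_cast hN
  set e : ℤ → ℂ := fun k => p ((k + 1 : ℤ) / N) - p (k / N) with he
  have hedge : ∀ (k : ℤ) (x : ℝ), 0 ≤ x → x ≤ 1 → p (k / N + x / N) = p (k / N) + x • e k := by
    intro k x h0 h1
    have := hPL k (k / N + x / N) ⟨by linarith [div_nonneg h0 hN'.le], by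
      rw [add_div]; gcongr⟩
    rw [this]
    congr 2
    field_simp; ring
  have he0 : ∀ k, e k ≠ 0 := by
    intro k hk
    have h1 := hedge k (1/2) (by norm_num) (by norm_num)
    rw [hk, smul_zero, add_zero] at h1
    obtain ⟨j, hj⟩ := hp.exists_int h1
    have h2 : 0 < (1 / 2 : ℝ) / N := by positivity
    have h3 : (1 / 2 : ℝ) / N < 1 := by rw [div_lt_one hN']; linarith
    rw [add_sub_cancel_left] at hj
    rw [hj] at h2 h3
    have : (0:ℤ) < j := by exact_mod_cast h2
    have : j < 1 := by exact_mod_cast h3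
    omega
  have hu : ∀ k, ‖e k / ‖e k‖‖ = 1 := fun k => by
    rw [norm_div, Complex.norm_real, norm_norm, div_self (norm_ne_zero_iff.2 (he0 k))]
  refine ⟨N, e, hN, hPL, fun k => rfl, fun k => ?_, he0, fun k => ?_⟩
  · simp only [he]
    have e1 : (((k + N + 1 : ℤ)) : ℝ) / N = ((k + 1 : ℤ) : ℝ) / N + 1 := by
      push_cast; field_simp; ring
    have e2 : (((k + N : ℤ)) : ℝ) / N = (k : ℝ) / N + 1 := by push_cast; field_simp
    rw [e1, e2, hp.2.1, hp.2.1]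
  · set u := e k / ‖e k‖ with hu1
    set w := e (k - 1) / ‖e (k - 1)‖ with hw1
    have hu' : u.re ^ 2 + u.im ^ 2 = 1 := by
      have := Complex.sq_norm u; rw [hu, Complex.normSq_apply] at this; linarith
    have hw' : w.re ^ 2 + w.im ^ 2 = 1 := by
      have := Complex.sq_norm w; rw [hu, Complex.normSq_apply] at this; linarith
    have h2 : 2 * (1 + ((starRingEnd ℂ) u * w).re) = ‖u + w‖ ^ 2 := by
      rw [Complex.sq_norm, Complex.normSq_apply]
      simp only [Complex.mul_re, Complex.conj_re, Complex.conj_im, Complex.add_re, Complex.add_im]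
      linear_combination -hu' - hw'
    by_contra hneg
    have h3 : u + w = 0 := by
      rw [← norm_eq_zero, ← sq_eq_zero_iff]
      nlinarith [sq_nonneg ‖u + w‖]
    set A := ‖e k‖
    set B := ‖e (k - 1)‖
    have hA : 0 < A := norm_pos_iff.2 (he0 k)
    have hB : 0 < B := norm_pos_iff.2 (he0 (k - 1))
    have hek : e k = A * u := by
      rw [hu1, mul_div_cancel₀]; exact_mod_cast hA.ne'
    have hek' : e (k - 1) = -(B * u) := by
      have : w = -u := by linear_combination h3
      rw [← mul_neg, ← this, hw1, mul_div_cancel₀]; exact_mod_cast hB.ne'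
    set y := B / (2 * (A + B)) with hy
    set x := A / (2 * (A + B)) with hx
    have hxy : x + y = 1 / 2 := by rw [hx, hy]; field_simp
    have hx0 : 0 < x := by positivity
    have hy0 : 0 < y := by positivity
    have h4 := hedge k y hy0.le (by linarith)
    have h5 := hedge (k - 1) (1 - x) (by linarith) (by linarith)
    have e3 : p ((k - 1 : ℤ) / N) = p (k / N) - e (k - 1) := by
      simp only [he, sub_add_cancel]; ring
    have e4 : (((k - 1 : ℤ) : ℝ) / N + (1 - x) / N) = k / N - x / N := by
      push_cast; field_simp; ring
    rw [e3, e4] at h5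
    have h6 : p (k / N + y / N) = p (k / N - x / N) := by
      rw [h4, h5, hek, hek', Complex.real_smul, Complex.real_smul, hx, hy]
      have : (A + B : ℂ) ≠ 0 := by exact_mod_cast (by positivity : A + B ≠ 0)
      push_cast
      field_simp
      ring
    obtain ⟨j, hj⟩ := hp.exists_int h6
    have e5 : (k / N + y / N - (k / N - x / N) : ℝ) = (1 / 2) / N := by
      rw [← hxy]; ring
    rw [e5] at hj
    have h2 : 0 < (1 / 2 : ℝ) / N := by positivity
    have h3 : (1 / 2 : ℝ) / N < 1 := by rw [div_lt_one hN']; linarith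
    rw [hj] at h2 h3
    have : (0:ℤ) < j := by exact_mod_cast h2
    have : j < 1 := by exact_mod_cast h3
    omega

/-- The planar cross product, as a continuous bilinear expression. -/
def cross (a b : ℂ) : ℝ := a.re * b.im - a.im * b.re

lemma cross_self_eq_zero (a : ℂ) : cross a a = 0 := by simp [cross, mul_comm]
lemma cross_add_left (a b c : ℂ) : cross (a + b) c = cross a c + cross b c := by
  simp [cross]; ring
lemma cross_sub_left (a b c : ℂ) : cross (a - b) c = cross a c - cross b c := by
  simp [cross]; ring
lemma cross_add_right (a b c : ℂ) : cross a (b + c) = cross a b + cross a c := by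
  simp [cross]; ring
lemma cross_sub_right (a b c : ℂ) : cross a (b - c) = cross a b - cross a c := by
  simp [cross]; ring
lemma cross_smul_left (x : ℝ) (a b : ℂ) : cross (x • a) b = x * cross a b := by
  simp [cross]; ring
lemma cross_smul_right (x : ℝ) (a b : ℂ) : cross a (x • b) = x * cross a b := by
  simp [cross]; ring
lemma abs_cross_le (a b : ℂ) : |cross a b| ≤ ‖a‖ * ‖b‖ := by
  have : cross a b = ((starRingEnd ℂ) a * b).im := by
    simp [cross]; ring
  rw [this, ← Complex.norm_conj a, ← norm_mul]
  exact Complex.abs_im_le_norm _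
lemma Continuous.cross {α : Type*} [TopologicalSpace α] {f g : α → ℂ} (hf : Continuous f)
    (hg : Continuous g) : Continuous fun x => _root_.cross (f x) (g x) := by
  unfold _root_.cross
  exact ((Complex.continuous_re.comp hf).mul (Complex.continuous_im.comp hg)).sub
    ((Complex.continuous_im.comp hf).mul (Complex.continuous_re.comp hg))

lemma PolygonParam.exists_transverse {p : ℝ → ℂ} (hp : PolygonParam p) :
    ∃ (v : ℝ → ℂ) (c δ Λ B : ℝ), 0 < c ∧ 0 < δ ∧ 0 ≤ Λ ∧ Continuous v ∧ Periodic v 1 ∧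
      (∀ t u, ‖v t - v u‖ ≤ Λ * |t - u|) ∧ (∀ t, ‖v t‖ ≤ B) ∧ (∀ t, v t ≠ 0) ∧
      ∀ t u w, u ≤ w → w ≤ t → t ≤ u + δ → c * (t - u) ≤ cross (p t - p u) (v w) := by
  obtain ⟨N, e, hN, hPL, he, heN, he0, hang⟩ := hp.exists_edges
  have hN' : (0:ℝ) < N := by exact_mod_cast hN
  set V : ℤ → ℂ := fun k => Complex.I * (e (k - 1) / ‖e (k - 1)‖ + e k / ‖e k‖) with hV
  have hu : ∀ k, ‖e k / ‖e k‖‖ = 1 := fun k => by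
    rw [norm_div, Complex.norm_real, norm_norm, div_self (norm_ne_zero_iff.2 (he0 k))]
  have hVN : ∀ k, V (k + N) = V k := by
    intro k
    have : k + N - 1 = (k - 1) + N := by ring
    simp only [hV, this, heN]
  have hV2 : ∀ k, ‖V k‖ ≤ 2 := by
    intro k
    simp only [hV, norm_mul, Complex.norm_I, one_mul]
    refine (norm_add_le _ _).trans ?_
    rw [hu, hu]; norm_num
  have hc1 : ∀ k, 0 < cross (e k) (V k) := by
    intro k
    have : cross (e k) (V k) = ‖e k‖ * (1 + ((starRingEnd ℂ) (e k / ‖e k‖) *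
        (e (k - 1) / ‖e (k - 1)‖)).re) := by
      have h1 : e k = (‖e k‖ : ℝ) • (e k / ‖e k‖) := by
        rw [Complex.real_smul, mul_div_cancel₀]; exact_mod_cast norm_ne_zero_iff.2 (he0 k)
      conv_lhs => rw [h1]
      rw [cross_smul_left]
      have h2 : (e k / ‖e k‖).re ^ 2 + (e k / ‖e k‖).im ^ 2 = 1 := by
        have := Complex.sq_norm (e k / ‖e k‖); rw [hu, Complex.normSq_apply] at this; linarith
      congr 1
      simp only [hV]
      generalize e k / ‖e k‖ = u at *
      generalize e (k - 1) / ‖e (k - 1)‖ = w at *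
      simp [cross]
      linear_combination h2
    rw [this]
    exact mul_pos (norm_pos_iff.2 (he0 k)) (hang k)
  have hc2 : ∀ k, 0 < cross (e k) (V (k + 1)) := by
    intro k
    have : cross (e k) (V (k + 1)) = ‖e k‖ * (1 + ((starRingEnd ℂ) (e (k + 1) / ‖e (k + 1)‖) *
        (e (k + 1 - 1) / ‖e (k + 1 - 1)‖)).re) := by
      rw [add_sub_cancel_right]
      have h1 : e k = (‖e k‖ : ℝ) • (e k / ‖e k‖) := by
        rw [Complex.real_smul, mul_div_cancel₀]; exact_mod_cast norm_ne_zero_iff.2 (he0 k)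
      conv_lhs => rw [h1]
      rw [cross_smul_left]
      have h2 : (e k / ‖e k‖).re ^ 2 + (e k / ‖e k‖).im ^ 2 = 1 := by
        have := Complex.sq_norm (e k / ‖e k‖); rw [hu, Complex.normSq_apply] at this; linarith
      congr 1
      simp only [hV, add_sub_cancel_right]
      generalize e k / ‖e k‖ = u at *
      generalize e (k + 1) / ‖e (k + 1)‖ = w at *
      simp [cross]
      linear_combination h2
    rw [this]
    exact mul_pos (norm_pos_iff.2 (he0 k)) (hang (k + 1))
  obtain ⟨c1, hc10, _, hc1'⟩ := exists_uniform_of_periodic hN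
    (f := fun k => cross (e k) (V k)) (fun k => by rw [heN, hVN]) hc1
  obtain ⟨c2, hc20, _, hc2'⟩ := exists_uniform_of_periodic hN
    (f := fun k => cross (e k) (V (k + 1))) (fun k => by rw [heN, add_right_comm, hVN]) hc2
  obtain ⟨_, _, E, hE⟩ := exists_uniform_of_periodic hN
    (f := fun k => ‖e k‖) (fun k => by rw [heN]) (fun k => norm_pos_iff.2 (he0 k))
  set v := plInterp N V with hv
  have hvPL : IsPL N V v := isPL_plInterp hN V
  have hvL := hvPL.lipschitz hN (C := 4) fun k =>
    (norm_sub_le _ _).trans (by linarith [hV2 k, hV2 (k + 1)])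
  have hE0 : 0 < E := (norm_pos_iff.2 (he0 0)).trans_le (hE 0).2
  set c := min c1 c2 with hcdef
  have hc0 : 0 < c := lt_min hc10 hc20
  have hedge : ∀ (k : ℤ) (x : ℝ), (k:ℝ) / N ≤ x → x < (k + 1) / N → c ≤ cross (e k) (v x) := by
    intro k x h1 h2
    rw [hvPL k x ⟨h1, h2.le⟩]
    set θ := (x - k / N) * N with hθ
    have hθ0 : 0 ≤ θ := mul_nonneg (by linarith) hN'.le
    have hθ1 : θ ≤ 1 := by
      have : x - k / N ≤ 1 / N := by rw [add_div] at h2; linarith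
      calc θ ≤ 1 / N * N := by rw [hθ]; gcongr
        _ = 1 := by field_simp
    rw [cross_add_right, cross_smul_right, cross_sub_right]
    have a1 : c ≤ cross (e k) (V k) := (min_le_left _ _).trans (hc1' k).1
    have a2 : c ≤ cross (e k) (V (k + 1)) := (min_le_right _ _).trans (hc2' k).1
    nlinarith
  have hvc : Continuous v := hvPL.continuous hN
  have hpc : Continuous p := hp.1
  refine ⟨v, N * (c / 2), c / (2 * E * (N * 4)), N * 4, 6, by positivity, by positivity,
    by positivity, hvc, plInterp_periodic hVN, hvL, fun t => ?_, fun t ht => ?_,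
    fun t u w huw hwt htu => ?_⟩
  · obtain ⟨k, h1, h2⟩ := exists_edge hN t
    rw [hvPL k t ⟨h1, h2.le⟩]
    set θ := (t - k / N) * N with hθ
    have hθ0 : 0 ≤ θ := mul_nonneg (by linarith) hN'.le
    have hθ1 : θ ≤ 1 := by
      have : t - k / N ≤ 1 / N := by rw [add_div] at h2; linarith
      calc θ ≤ 1 / N * N := by rw [hθ]; gcongr
        _ = 1 := by field_simp
    refine (norm_add_le _ _).trans ?_
    rw [norm_smul, Real.norm_of_nonneg hθ0]
    have := norm_sub_le (V (k + 1)) (V k)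
    have h3 : θ * ‖V (k + 1) - V k‖ ≤ 1 * 4 := by
      gcongr
      linarith [hV2 k, hV2 (k + 1)]
    linarith [hV2 k]
  · obtain ⟨k, h1, h2⟩ := exists_edge hN t
    have := hedge k t h1 h2
    rw [ht] at this
    simp [cross] at this
    linarith
  · choose k hk1 hk2 using exists_edge hN
    have hcross : ∀ (a : ℂ) {f : ℝ → ℂ} {f' : ℂ} {x : ℝ}, HasDerivWithinAt f f' (Ici x) x →
        HasDerivWithinAt (fun y => cross (f y) a) (cross f' a) (Ici x) x := by
      intro a f f' x hf
      have h1 := Complex.reCLM.hasFDerivAt.comp_hasDerivWithinAt x hf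
      have h2 := Complex.imCLM.hasFDerivAt.comp_hasDerivWithinAt x hf
      exact (h1.mul_const a.im).sub (h2.mul_const a.re)
    have key := image_le_of_deriv_right_le_deriv_boundary (a := u) (b := t)
      (f := fun x => N * (c / 2) * (x - u)) (f' := fun x => N * (c / 2))
      (B := fun x => cross (p x - p u) (v w))
      (B' := fun x => cross ((N:ℝ) • (p ((k x + 1 : ℤ) / N) - p (k x / N))) (v w))
      (by fun_prop)
      (fun x _ => by
        refine ((((hasDerivAt_id x).sub_const u).const_mul _).hasDerivWithinAt).congr_deriv ?_
        simp)
      (by simp [cross])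
      (Continuous.cross (by fun_prop) continuous_const).continuousOn
      (fun x _ => hcross _ ((hPL.hasDerivWithinAt hN (hk1 x) (hk2 x)).sub_const _))
      (fun x hx => by
        rw [cross_smul_left, ← he, mul_le_mul_iff_right₀ hN']
        have h1 := hedge (k x) x (hk1 x) (hk2 x)
        have h2 : cross (e (k x)) (v x) = cross (e (k x)) (v w) +
            cross (e (k x)) (v x - v w) := by rw [cross_sub_right]; ring
        have h3 := (le_abs_self _).trans (abs_cross_le (e (k x)) (v x - v w))
        have h4 : ‖e (k x)‖ * ‖v x - v w‖ ≤ E * (N * 4 * (c / (2 * E * (N * 4)))) := by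
          gcongr
          · exact (hE _).2
          · refine (hvL x w).trans ?_
            gcongr
            rw [abs_le]
            exact ⟨by linarith [hx.1, hx.2], by linarith [hx.1, hx.2]⟩
        have h5 : E * (N * 4 * (c / (2 * E * (N * 4)))) = c / 2 := by field_simp
        linarith)
      (x := t) ⟨huw.trans hwt, le_rfl⟩
    exact key

/-- `W` is a field along the loop `p` such that `(t, τ) ↦ p t + τ • W t` is a collar
neighbourhood of the image of `p`. -/
structure IsCollar (p W : ℝ → ℂ) : Prop where
  cont_p : Continuous p
  cont_W : Continuous W
  per_p : Periodic p 1
  per_W : Periodic W 1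
  inj : ∀ t u τ σ : ℝ, |τ| ≤ 2 → |σ| ≤ 2 → p t + τ • W t = p u + σ • W u →
    (∃ k : ℤ, t - u = k) ∧ τ = σ
  image_mem_nhds : ∀ t τ : ℝ, |τ| < 2 → ∀ O ∈ nhds (t, τ),
    (fun q : ℝ × ℝ => p q.1 + q.2 • W q.1) '' O ∈ nhds (p t + τ • W t)

lemma eq_smul_of_cross_eq_zero {a b : ℂ} (hb : b ≠ 0) (h : cross a b = 0) : ∃ τ : ℝ, a = τ • b := by
  have hn : b.re ^ 2 + b.im ^ 2 ≠ 0 := by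
    intro h0
    apply hb
    have h1 : b.re = 0 := by nlinarith [sq_nonneg b.re, sq_nonneg b.im]
    have h2 : b.im = 0 := by nlinarith [sq_nonneg b.re, sq_nonneg b.im]
    exact Complex.ext h1 h2
  refine ⟨(a.re * b.re + a.im * b.im) / (b.re ^ 2 + b.im ^ 2), ?_⟩
  unfold cross at h
  apply Complex.ext
  · simp only [Complex.real_smul, Complex.re_ofReal_mul]
    rw [div_mul_eq_mul_div, eq_div_iff hn]
    linear_combination b.im * h
  · simp only [Complex.real_smul, Complex.im_ofReal_mul]
    rw [div_mul_eq_mul_div, eq_div_iff hn]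
    linear_combination -b.re * h

theorem PolygonParam.exists_isCollar {p : ℝ → ℂ} (hp : PolygonParam p) : ∃ W, IsCollar p W := by
  obtain ⟨v, c, δ, Λ, B, hc, hδ, hΛ, hvc, hvp, hvL, hvB, hv0, hT⟩ := hp.exists_transverse
  have hpc : Continuous p := hp.1
  have hpp : Periodic p 1 := hp.2.1
  have hB : 0 < B := (norm_pos_iff.2 (hv0 0)).trans_le (hvB 0)
  obtain ⟨m, hm, hmin⟩ : ∃ m : ℝ, 0 < m ∧ ∀ t x : ℝ, δ ≤ |x| → |x| ≤ 1 / 2 →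
      m ≤ ‖p (t + x) - p t‖ := by
    have hK : IsCompact (Icc (0:ℝ) 1 ×ˢ (Icc (-(1/2):ℝ) (1/2) ∩ {x | δ ≤ |x|})) :=
      isCompact_Icc.prod (isCompact_Icc.inter_right (isClosed_le continuous_const continuous_abs))
    obtain ⟨m, hm, h⟩ := hK.exists_forall_le' (f := fun q : ℝ × ℝ => ‖p (q.1 + q.2) - p q.1‖)
      (a := 0) (by fun_prop) (fun q hq => by
        rw [norm_pos_iff, sub_ne_zero]
        intro h
        obtain ⟨k, hk⟩ := hp.exists_int h
        rw [add_sub_cancel_left] at hk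
        have h1 : |q.2| ≤ 1 / 2 := abs_le.2 hq.2.1
        have h2 : δ ≤ |q.2| := hq.2.2
        rw [hk, ← Int.cast_abs] at h1 h2
        have h3 : |k| < 1 := by
          have : ((|k| : ℤ) : ℝ) < 1 := by linarith
          exact_mod_cast this
        have h4 : 0 < |k| := by
          have : (0:ℝ) < ((|k| : ℤ) : ℝ) := by linarith
          exact_mod_cast this
        omega)
    refine ⟨m, hm, fun t x h1 h2 => ?_⟩
    have := h (Int.fract t, x) ⟨⟨Int.fract_nonneg _, (Int.fract_lt_one _).le⟩, abs_le.1 h2, h1⟩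
    have e1 : p (Int.fract t) = p t := by
      rw [Int.fract, ← mul_one (⌊t⌋ : ℝ)]; exact hpp.sub_int_mul_eq _
    have e2 : p (Int.fract t + x) = p (t + x) := by
      have : Int.fract t + x = t + x - ⌊t⌋ * 1 := by rw [Int.fract]; ring
      rw [this]; exact hpp.sub_int_mul_eq _
    simpa only [e1, e2] using this
  obtain ⟨κ, hκ, hκ1, hκ2⟩ : ∃ κ : ℝ, 0 < κ ∧ 2 * κ * Λ * B ≤ c / 2 ∧ 4 * κ * B < m := by
    refine ⟨min (c / (4 * (Λ + 1) * B)) (m / (8 * B)), by positivity, ?_, ?_⟩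
    · calc 2 * min (c / (4 * (Λ + 1) * B)) (m / (8 * B)) * Λ * B
          ≤ 2 * (c / (4 * (Λ + 1) * B)) * (Λ + 1) * B := by
            gcongr
            · exact min_le_left _ _
            · linarith
        _ = c / 2 := by field_simp; norm_num
    · calc 4 * min (c / (4 * (Λ + 1) * B)) (m / (8 * B)) * B ≤ 4 * (m / (8 * B)) * B := by
            gcongr; exact min_le_right _ _
        _ = m / 2 := by field_simp; norm_num
        _ < m := by linarith
  have key : ∀ t1 τ1 t : ℝ, |τ1| ≤ 2 → |t - t1| ≤ δ →
      c / 2 * (t1 - t) ^ 2 ≤ (t1 - t) * cross (p t1 + τ1 • κ • v t1 - p t) (v t) := by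
    intro t1 τ1 t hτ ht
    have e1 : cross (p t1 + τ1 • κ • v t1 - p t) (v t) =
        cross (p t1 - p t) (v t) + τ1 * κ * cross (v t1 - v t) (v t) := by
      simp only [cross_sub_left, cross_add_left, cross_smul_left, cross_self_eq_zero]; ring
    have h1 : c * (t1 - t) ^ 2 ≤ (t1 - t) * cross (p t1 - p t) (v t) := by
      rw [abs_le] at ht
      rcases le_total t t1 with h | h
      · have := hT t1 t t le_rfl h (by linarith)
        nlinarith
      · have := hT t t1 t h le_rfl (by linarith)
        have e : cross (p t1 - p t) (v t) = - cross (p t - p t1) (v t) := by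
          simp only [cross_sub_left]; ring
        rw [e]
        nlinarith
    have h2 : |(t1 - t) * (τ1 * κ * cross (v t1 - v t) (v t))| ≤ c / 2 * (t1 - t) ^ 2 := by
      rw [abs_mul, abs_mul, abs_mul, abs_of_pos hκ]
      calc |t1 - t| * (|τ1| * κ * |cross (v t1 - v t) (v t)|)
          ≤ |t1 - t| * (2 * κ * (Λ * |t1 - t| * B)) := by
            gcongr
            exact (abs_cross_le _ _).trans (mul_le_mul (hvL _ _) (hvB _) (norm_nonneg _)
              (by positivity))
        _ = 2 * κ * Λ * B * (t1 - t) ^ 2 := by rw [← sq_abs (t1 - t)]; ring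
        _ ≤ _ := by gcongr
    have h3 := (abs_le.1 h2).1
    rw [e1, mul_add]
    linarith
  refine ⟨fun t => κ • v t, hpc, by fun_prop, hpp, fun t => by simp only [hvp t], ?_, ?_⟩
  · intro t u τ σ hτ hσ h
    set k : ℤ := round (t - u) with hk
    have hu1 : p (u + k) = p u := by
      have := (hpp.int_mul k) u; rwa [mul_one] at this
    have hu2 : v (u + k) = v u := by
      have := (hvp.int_mul k) u; rwa [mul_one] at this
    have hd : |t - (u + k)| ≤ 1 / 2 := by
      have := abs_sub_round (t - u)
      rwa [← hk, sub_sub] at this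
    rw [← hu1, ← hu2] at h
    rcases le_total |t - (u + k)| δ with hle | hle
    · have h1 := key (u + k) σ t hσ hle
      have e1 : cross (p (u + k) + σ • κ • v (u + k) - p t) (v t) = 0 := by
        rw [← h, add_sub_cancel_left, cross_smul_left, cross_smul_left, cross_self_eq_zero]; ring
      rw [e1, mul_zero] at h1
      have h2 : (u + k - t) ^ 2 = 0 := by nlinarith [sq_nonneg (u + k - t)]
      have h3 : t = u + k := by
        have := pow_eq_zero_iff (two_ne_zero) |>.1 h2
        linarith
      refine ⟨⟨k, by rw [h3]; ring⟩, ?_⟩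
      rw [← h3, add_right_inj, smul_smul, smul_smul] at h
      have := smul_left_injective ℝ (hv0 t) h
      exact mul_right_cancel₀ hκ.ne' this
    · exfalso
      have h1 := hmin (u + k) (t - (u + k)) hle hd
      rw [add_sub_cancel] at h1
      have e1 : p t - p (u + k) = σ • κ • v (u + k) - τ • κ • v t := by
        linear_combination h
      rw [e1] at h1
      have h2 := norm_sub_le (σ • κ • v (u + k)) (τ • κ • v t)
      have h3 : ∀ (σ x : ℝ), |σ| ≤ 2 → ‖σ • κ • v x‖ ≤ 2 * (κ * B) := by
        intro σ x hσ
        rw [norm_smul, norm_smul, Real.norm_eq_abs, Real.norm_of_nonneg hκ.le]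
        gcongr
        exact hvB x
      have := h3 σ (u + k) hσ
      have := h3 τ t hτ
      linarith
  · intro t1 τ1 hτ O hO
    set z1 := p t1 + τ1 • κ • v t1 with hz1
    obtain ⟨d, hd, hdO⟩ := Metric.mem_nhds_iff.1 hO
    set w0 := κ * ‖v t1‖ / 2 with hw0
    have hw00 : 0 < w0 := by have := norm_pos_iff.2 (hv0 t1); positivity
    have hg : Continuous fun t => z1 - p t - τ1 • κ • v t := by fun_prop
    have h1 : ∀ᶠ t in nhds t1, ‖z1 - p t - τ1 • κ • v t‖ < d * w0 / 2 := by
      refine hg.norm.continuousAt.eventually_lt_const ?_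
      have : z1 - p t1 - τ1 • κ • v t1 = 0 := by rw [hz1]; ring
      change ‖z1 - p t1 - τ1 • κ • v t1‖ < _
      rw [this, norm_zero]; positivity
    have h2 : ∀ᶠ t in nhds t1, w0 < κ * ‖v t‖ := by
      have hcn : Continuous fun t => κ * ‖v t‖ := by fun_prop
      refine hcn.continuousAt.eventually_const_lt ?_
      rw [hw0]; linarith
    obtain ⟨x', hx', hxs⟩ := Metric.eventually_nhds_iff.1 (h1.and h2)
    set x := min (min (x' / 2) (d / 2)) δ with hx
    have hx0 : 0 < x := by positivity
    have hxx' : x < x' := (min_le_left _ _).trans_lt ((min_le_left _ _).trans_lt (by linarith))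
    have hxd : x < d := (min_le_left _ _).trans_lt ((min_le_right _ _).trans_lt (by linarith))
    have hxδ : x ≤ δ := min_le_right _ _
    set r := min (d * w0 / 2) (c * x / (2 * B) / 2) with hr
    have hr0 : 0 < r := by positivity
    filter_upwards [ball_mem_nhds z1 hr0] with z hz
    rw [mem_ball, dist_eq_norm] at hz
    have hB2 : ∀ t, |cross (z - z1) (v t)| < c / 2 * x := by
      intro t
      refine (abs_cross_le _ _).trans_lt ?_
      calc ‖z - z1‖ * ‖v t‖ ≤ (c * x / (2 * B) / 2) * B := by
            gcongr
            · exact hz.le.trans (min_le_right _ _)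
            · exact hvB t
        _ = c * x / 4 := by field_simp; norm_num
        _ < c / 2 * x := by nlinarith
    have hsplit : ∀ t, cross (z - p t) (v t) = cross (z1 - p t) (v t) + cross (z - z1) (v t) := by
      intro t; rw [← cross_add_left]; congr 1; ring
    have hL : 0 ≤ cross (z - p (t1 - x)) (v (t1 - x)) := by
      have := key t1 τ1 (t1 - x) hτ.le (by rw [sub_sub_cancel_left, abs_neg, abs_of_pos hx0]; exact hxδ)
      rw [← hz1, sub_sub_cancel, sq] at this
      have h3 : c / 2 * x ≤ cross (z1 - p (t1 - x)) (v (t1 - x)) :=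
        le_of_mul_le_mul_left (by linarith) hx0
      have := (abs_lt.1 (hB2 (t1 - x))).1
      rw [hsplit]; linarith
    have hR : cross (z - p (t1 + x)) (v (t1 + x)) ≤ 0 := by
      have := key t1 τ1 (t1 + x) hτ.le (by rw [add_sub_cancel_left, abs_of_pos hx0]; exact hxδ)
      rw [← hz1, sub_add_cancel_left, neg_sq, sq] at this
      have h3 : c / 2 * x ≤ - cross (z1 - p (t1 + x)) (v (t1 + x)) :=
        le_of_mul_le_mul_left (by linarith) hx0
      have := (abs_lt.1 (hB2 (t1 + x))).2
      rw [hsplit]; linarith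
    have hcont : Continuous fun t => cross (z - p t) (v t) :=
      Continuous.cross (by fun_prop) hvc
    obtain ⟨t, ht, hzero⟩ := intermediate_value_Icc' (by linarith : t1 - x ≤ t1 + x)
      hcont.continuousOn ⟨hR, hL⟩
    have hzero' : cross (z - p t) (v t) = 0 := hzero
    obtain ⟨τ, hτe⟩ := eq_smul_of_cross_eq_zero (smul_ne_zero hκ.ne' (hv0 t))
      (show cross (z - p t) (κ • v t) = 0 by rw [cross_smul_right, hzero', mul_zero])
    have htd : |t - t1| ≤ x := by rw [abs_le]; exact ⟨by linarith [ht.1], by linarith [ht.2]⟩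
    obtain ⟨h3, h4⟩ := hxs (y := t) (by rw [Real.dist_eq]; linarith)
    refine ⟨(t, τ), hdO ?_, ?_⟩
    · rw [mem_ball, Prod.dist_eq, max_lt_iff, Real.dist_eq, Real.dist_eq]
      refine ⟨by linarith, ?_⟩
      have e1 : (τ - τ1) • (κ • v t) = (z - z1) + (z1 - p t - τ1 • κ • v t) := by
        rw [sub_smul, ← hτe]; ring
      have e2 : |τ - τ1| * (κ * ‖v t‖) ≤ ‖z - z1‖ + ‖z1 - p t - τ1 • κ • v t‖ := by
        have := norm_add_le (z - z1) (z1 - p t - τ1 • κ • v t)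
        rwa [← e1, norm_smul, norm_smul, Real.norm_eq_abs, Real.norm_of_nonneg hκ.le] at this
      have h5 : ‖z - z1‖ < d * w0 / 2 := hz.trans_le (min_le_left _ _)
      have h6 : |τ - τ1| * w0 ≤ |τ - τ1| * (κ * ‖v t‖) := by gcongr
      have h7 : |τ - τ1| * w0 < d * w0 := by linarith
      exact lt_of_mul_lt_mul_right h7 hw00.le
    · change p t + τ • κ • v t = z
      rw [← hτe]; ring

lemma exists_continuous_log {A : Type} [TopologicalSpace A] [SimplyConnectedSpace A]
    [LocallyPathConnectedSpace A] {q : A → ℂ} (hq : Continuous q) (hq0 : ∀ a, q a ≠ 0) :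
    ∃ l : A → ℂ, Continuous l ∧ ∀ a, Complex.exp (l a) = q a := by
  obtain ⟨a0⟩ : Nonempty A := inferInstance
  obtain ⟨F, ⟨-, hF⟩, -⟩ := Complex.isCoveringMapOn_exp.existsUnique_continuousMap_lifts
    (f := ⟨q, hq⟩) (a₀ := a0) (e₀ := Complex.log (q a0)) (Complex.exp_log (hq0 a0)) hq0
  exact ⟨F, F.continuous, fun a => congr_fun hF a⟩

lemma exists_int_of_exp_eq {A : Type*} [TopologicalSpace A] {S : Set A} (hS : IsPreconnected S)
    {f g : A → ℂ} (hf : ContinuousOn f S) (hg : ContinuousOn g S)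
    (h : ∀ a ∈ S, Complex.exp (f a) = Complex.exp (g a)) :
    ∃ k : ℤ, ∀ a ∈ S, f a = g a + k * (2 * Real.pi * Complex.I) := by
  have h0 : (2 * Real.pi * Complex.I : ℂ) ≠ 0 := Complex.two_pi_I_ne_zero
  rcases S.eq_empty_or_nonempty with rfl | ⟨a0, ha0⟩
  · exact ⟨0, by simp⟩
  set n : A → ℝ := fun a => ((f a - g a) / (2 * Real.pi * Complex.I)).re with hn
  have hk : ∀ a ∈ S, ∃ k : ℤ, f a = g a + k * (2 * Real.pi * Complex.I) := fun a ha =>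
    Complex.exp_eq_exp_iff_exists_int.1 (h a ha)
  have hk' : ∀ a, ∀ k : ℤ, f a = g a + k * (2 * Real.pi * Complex.I) → n a = k := by
    intro a k e
    simp only [hn, e, add_sub_cancel_left, mul_div_cancel_right₀ _ h0, Complex.intCast_re]
  have hnc : ContinuousOn n S :=
    Complex.continuous_re.comp_continuousOn ((hf.sub hg).div_const _)
  obtain ⟨k0, hk0⟩ := hk a0 ha0
  refine ⟨k0, fun a ha => ?_⟩
  obtain ⟨k, e⟩ := hk a ha
  have hm : MapsTo n S (range ((↑) : ℤ → ℝ)) := fun b hb => by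
    obtain ⟨j, hj⟩ := hk b hb
    exact ⟨j, (hk' b j hj).symm⟩
  have hconst : n a = n a0 := by
    have hd : IsDiscrete (range ((↑) : ℤ → ℝ)) :=
      ⟨Int.isClosedEmbedding_coe_real.toIsEmbedding.toHomeomorph.symm.isEmbedding.discreteTopology⟩
    exact hS.constant_of_mapsTo hd hnc hm ha ha0
  rw [hk' a k e, hk' a0 k0 hk0] at hconst
  rw [e]; congr 2; exact_mod_cast hconst

/-- The loop `q` in `ℂ ∖ {0}` has winding number `σ` about the origin. -/
def Wind (q : ℝ → ℂ) (σ : ℤ) : Prop :=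
  ∃ l : ℝ → ℂ, Continuous l ∧ (∀ t, Complex.exp (l t) = q t) ∧
    ∀ t, l (t + 1) = l t + σ * (2 * Real.pi * Complex.I)

lemma Wind.ne_zero {q : ℝ → ℂ} {σ : ℤ} (h : Wind q σ) (t : ℝ) : q t ≠ 0 := by
  obtain ⟨l, -, h, -⟩ := h
  rw [← h]; exact Complex.exp_ne_zero _

lemma exists_wind {q : ℝ → ℂ} (hq : Continuous q) (hp : Periodic q 1) (h0 : ∀ t, q t ≠ 0) :
    ∃ σ, Wind q σ := by
  obtain ⟨l, hl, he⟩ := exists_continuous_log hq h0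
  obtain ⟨k, hk⟩ := exists_int_of_exp_eq (S := univ) isPreconnected_univ
    (f := fun t => l (t + 1)) (g := l) (by fun_prop) hl.continuousOn
    (fun t _ => by rw [he, he, hp])
  exact ⟨k, l, hl, he, fun t => hk t trivial⟩

lemma Wind.change {q : ℝ → ℂ} {σ : ℤ} (h : Wind q σ) {l : ℝ → ℂ} (hl : Continuous l)
    (he : ∀ t, Complex.exp (l t) = q t) (t : ℝ) :
    l (t + 1) = l t + σ * (2 * Real.pi * Complex.I) := by
  obtain ⟨l', hl', he', hs⟩ := h
  obtain ⟨k, hk⟩ := exists_int_of_exp_eq (S := univ) isPreconnected_univ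
    (f := l) (g := l') hl.continuousOn hl'.continuousOn (fun t _ => by rw [he, he'])
  rw [hk _ trivial, hk t trivial, hs]; ring

lemma Wind.unique {q : ℝ → ℂ} {σ τ : ℤ} (h : Wind q σ) (h' : Wind q τ) : σ = τ := by
  obtain ⟨l, hl, he, hs⟩ := h
  have := h'.change hl he 0
  rw [hs, add_right_inj] at this
  exact_mod_cast mul_right_cancel₀ Complex.two_pi_I_ne_zero this

lemma Wind.mul {q q' : ℝ → ℂ} {σ σ' : ℤ} (h : Wind q σ) (h' : Wind q' σ') :
    Wind (fun t => q t * q' t) (σ + σ') := by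
  obtain ⟨l, hl, he, hs⟩ := h
  obtain ⟨l', hl', he', hs'⟩ := h'
  refine ⟨fun t => l t + l' t, by fun_prop, fun t => by rw [Complex.exp_add, he, he'],
    fun t => ?_⟩
  simp only [hs, hs']
  push_cast; ring

lemma Wind.inv {q : ℝ → ℂ} {σ : ℤ} (h : Wind q σ) : Wind (fun t => (q t)⁻¹) (-σ) := by
  obtain ⟨l, hl, he, hs⟩ := h
  refine ⟨fun t => - l t, by fun_prop, fun t => by rw [Complex.exp_neg, he],
    fun t => ?_⟩
  simp only [hs]
  push_cast; ring

lemma wind_of_periodic_log {q l : ℝ → ℂ} (hl : Continuous l) (hp : Periodic l 1)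
    (he : ∀ t, Complex.exp (l t) = q t) : Wind q 0 :=
  ⟨l, hl, he, fun t => by rw [hp]; simp⟩

lemma Wind.of_norm_sub_lt {q q' : ℝ → ℂ} {σ : ℤ} (h : Wind q σ) (hq : Continuous q)
    (hp : Periodic q 1) (hq' : Continuous q')
    (hp' : Periodic q' 1) (hlt : ∀ t, ‖q t - q' t‖ < ‖q t‖) : Wind q' σ := by
  have h1 : Wind (fun t => q' t / q t) 0 := by
    have hs : ∀ t, q' t / q t ∈ Complex.slitPlane := by
      intro t
      have e : q' t / q t = 1 + (-((q t - q' t) / q t)) := by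
        have := h.ne_zero t
        field_simp; ring
      rw [e]
      apply Complex.mem_slitPlane_of_norm_lt_one
      rw [norm_neg, norm_div, div_lt_one (norm_pos_iff.2 (h.ne_zero t))]
      exact hlt t
    refine wind_of_periodic_log (l := fun t => Complex.log (q' t / q t)) ?_ ?_ ?_
    · exact (hq'.div₀ hq h.ne_zero).clog hs
    · intro t; simp only [hp t, hp' t]
    · exact fun t => Complex.exp_log (Complex.slitPlane_ne_zero (hs t))
  have h2 := h.mul h1
  rw [add_zero] at h2
  convert h2 using 2 with t
  have := h.ne_zero t
  field_simp

lemma isCompact_range_of_periodic {q : ℝ → ℂ} (hq : Continuous q) (hp : Periodic q 1) :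
    IsCompact (range q) := by
  rw [← hp.image_Icc one_pos 0]
  exact isCompact_Icc.image hq

lemma Wind.eventually {q : ℝ → ℂ} (hq : Continuous q) (hp : Periodic q 1) {z : ℂ} {σ : ℤ}
    (h : Wind (fun t => q t - z) σ) : ∀ᶠ w in nhds z, Wind (fun t => q t - w) σ := by
  have hz : z ∈ (range q)ᶜ := by
    rintro ⟨t, ht⟩
    exact h.ne_zero t (sub_eq_zero.2 ht)
  obtain ⟨d, hd, hb⟩ := Metric.isOpen_iff.1 (isCompact_range_of_periodic hq hp).isClosed.isOpen_compl
    z hz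
  filter_upwards [ball_mem_nhds z hd] with w hw
  refine h.of_norm_sub_lt (by fun_prop) (fun t => by simp only [hp t]) (by fun_prop)
    (fun t => by simp only [hp t]) fun t => ?_
  rw [sub_sub_sub_cancel_left]
  rw [mem_ball, dist_eq_norm] at hw
  refine hw.trans_le ?_
  by_contra! hlt
  exact hb (mem_ball_iff_norm.2 hlt) ⟨t, rfl⟩

lemma Wind.of_isPreconnected {q : ℝ → ℂ} (hq : Continuous q) (hp : Periodic q 1) {S : Set ℂ}
    (hS : IsPreconnected S) (hSq : Disjoint S (range q)) {z w : ℂ} (hz : z ∈ S) (hw : w ∈ S) {σ : ℤ}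
    (h : Wind (fun t => q t - z) σ) : Wind (fun t => q t - w) σ := by
  by_contra hcon
  set A := {w : ℂ | Wind (fun t => q t - w) σ}
  set B := {w : ℂ | ∃ τ, τ ≠ σ ∧ Wind (fun t => q t - w) τ}
  have hA : IsOpen A := isOpen_iff_mem_nhds.2 fun x hx => Wind.eventually hq hp hx
  have hB : IsOpen B := isOpen_iff_mem_nhds.2 fun x ⟨τ, h1, h2⟩ =>
    (Wind.eventually hq hp h2).mono fun y hy => ⟨τ, h1, hy⟩
  have hex : ∀ x ∈ S, ∃ τ, Wind (fun t => q t - x) τ := fun x hx =>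
    exists_wind (by fun_prop) (fun t => by simp only [hp t]) fun t ht =>
      hSq.le_bot ⟨hx, t, sub_eq_zero.1 ht⟩
  have hne : w ∈ B := by
    obtain ⟨τ, hτ⟩ := hex w hw
    exact ⟨τ, fun e => hcon (e ▸ hτ), hτ⟩
  obtain ⟨x, -, h1, τ, h2, h3⟩ := hS A B hA hB (fun x hx => by
    obtain ⟨τ, hτ⟩ := hex x hx
    by_cases e : τ = σ
    · subst e; exact Or.inl hτ
    · exact Or.inr ⟨τ, e, hτ⟩) ⟨z, hz, h⟩ ⟨w, hw, hne⟩
  exact h2 (h3.unique h1)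

lemma wind_zero_of_far {q : ℝ → ℂ} (hq : Continuous q) (hp : Periodic q 1) {z : ℂ}
    (hz : ∀ t, ‖q t‖ < ‖z‖) : Wind (fun t => q t - z) 0 := by
  have hz0 : z ≠ 0 := norm_pos_iff.1 ((norm_nonneg _).trans_lt (hz 0))
  have : Wind (fun _ => -z) 0 := wind_of_periodic_log (l := fun _ => Complex.log (-z))
    (by fun_prop) (fun _ => rfl) (fun _ => Complex.exp_log (neg_ne_zero.2 hz0))
  refine this.of_norm_sub_lt (by fun_prop) (fun _ => rfl) (by fun_prop)
    (fun t => by simp only [hp t]) fun t => ?_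
  rw [neg_sub_left, norm_neg, norm_neg, sub_add_cancel]
  exact hz t

/-- A point with nonzero winding number belongs to a bounded complementary component. -/
lemma mem_polyInt_of_wind {q : ℝ → ℂ} (hq : Continuous q) (hp : Periodic q 1) {z : ℂ} {σ : ℤ}
    (hσ : σ ≠ 0) (h : Wind (fun t => q t - z) σ) : z ∈ polyInt (range q) := by
  have hz : z ∉ range q := by
    rintro ⟨t, ht⟩
    exact h.ne_zero t (sub_eq_zero.2 ht)
  refine ⟨hz, ?_⟩
  obtain ⟨B, hB⟩ := (isCompact_range_of_periodic hq hp).isBounded.exists_norm_le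
  refine (isBounded_closedBall (x := (0:ℂ)) (r := B)).subset fun w hw => ?_
  rw [mem_closedBall_zero_iff]
  by_contra! hlt
  have h1 := Wind.of_isPreconnected hq hp isPreconnected_connectedComponentIn
    (disjoint_left.2 fun x hx => connectedComponentIn_subset _ _ hx)
    (mem_connectedComponentIn hz) hw h
  exact hσ (h1.unique (wind_zero_of_far hq hp fun t => (hB _ ⟨t, rfl⟩).trans_lt hlt))

lemma not_wind_of_edge {q : ℝ → ℂ} (hq : Continuous q) (hp : Periodic q 1) {t0 b η : ℝ}
    (hη : 0 < η) (hb : 0 < b) (hb1 : b < 1 / 2)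
    (hedge : ∀ x ∈ Icc (-b) b, q (t0 + x) = (x - η * Complex.I) / (x + η * Complex.I))
    (hoff : ∀ t ∈ Icc (t0 + b) (t0 - b + 1), ‖q t - 1‖ < 1) : ¬ Wind q 0 := by
  rintro ⟨l, hl, he, hs⟩
  simp only [Int.cast_zero, zero_mul, add_zero] at hs
  have him : ∀ x : ℝ, ((x:ℂ) + η * Complex.I).im = η := fun x => by simp
  have him' : ∀ x : ℝ, ((x:ℂ) - η * Complex.I).im = -η := fun x => by simp
  have hs1 : ∀ x : ℝ, (x:ℂ) + η * Complex.I ∈ Complex.slitPlane := fun x =>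
    Complex.mem_slitPlane_iff.2 (Or.inr (by rw [him]; exact hη.ne'))
  have hs2 : ∀ x : ℝ, (x:ℂ) - η * Complex.I ∈ Complex.slitPlane := fun x =>
    Complex.mem_slitPlane_iff.2 (Or.inr (by rw [him']; exact (neg_neg_of_pos hη).ne))
  obtain ⟨k, hk⟩ := exists_int_of_exp_eq (S := Icc (-b) b) isPreconnected_Icc
    (f := fun x => l (t0 + x))
    (g := fun x : ℝ => Complex.log (x - η * Complex.I) - Complex.log (x + η * Complex.I))
    (by fun_prop)
    (Continuous.continuousOn (((by fun_prop : Continuous fun x : ℝ => (x:ℂ) - η * Complex.I).clog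
      hs2).sub ((by fun_prop : Continuous fun x : ℝ => (x:ℂ) + η * Complex.I).clog hs1)))
    (fun x hx => by
      rw [he, hedge x hx, Complex.exp_sub, Complex.exp_log (Complex.slitPlane_ne_zero (hs2 x)),
        Complex.exp_log (Complex.slitPlane_ne_zero (hs1 x))])
  have hqs : ∀ t ∈ Icc (t0 + b) (t0 - b + 1), q t ∈ Complex.slitPlane := fun t ht => by
    have := Complex.mem_slitPlane_of_norm_lt_one (hoff t ht)
    rwa [add_sub_cancel] at this
  obtain ⟨j, hj⟩ := exists_int_of_exp_eq (S := Icc (t0 + b) (t0 - b + 1)) isPreconnected_Icc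
    (f := l) (g := fun t => Complex.log (q t)) hl.continuousOn
    (hq.continuousOn.clog hqs)
    (fun t ht => by rw [he, Complex.exp_log (Complex.slitPlane_ne_zero (hqs t ht))])
  set w : ℂ := b + η * Complex.I with hw
  set w' : ℂ := b - η * Complex.I with hw'
  set a := Complex.arg w with ha
  have hconj : w' = (starRingEnd ℂ) w := by
    simp [hw, hw', sub_eq_add_neg]
  have hwim : w.im = η := him b
  have hwre : w.re = b := by simp [hw]
  have hac : Complex.arg w' = -a := by
    rw [hconj, Complex.arg_conj, if_neg]
    rw [Complex.arg_eq_pi_iff, hwre]; exact fun h => by linarith [h.1]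
  have han : Complex.arg (-w) = a - Real.pi :=
    Complex.arg_neg_eq_arg_sub_pi_of_im_pos (by rw [hwim]; exact hη)
  have han' : Complex.arg (-w') = Real.pi - a := by
    rw [Complex.arg_neg_eq_arg_add_pi_of_im_neg (by rw [hw', him']; linarith), hac]; ring
  have ha0 : 0 ≤ a := Complex.arg_nonneg_iff.2 (by rw [hwim]; exact hη.le)
  have ha1 : a < Real.pi / 2 := by
    have := Complex.abs_arg_lt_pi_div_two_iff.2 (Or.inl (by rw [hwre]; exact hb) : 0 < w.re ∨ w = 0)
    exact (le_abs_self _).trans_lt this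
  have hw0 : w ≠ 0 := Complex.slitPlane_ne_zero (hs1 b)
  have hw0' : w' ≠ 0 := Complex.slitPlane_ne_zero (hs2 b)
  have hpi := Real.pi_pos
  have e1 : (Complex.log (w' / w)).im = - 2 * a := by
    have : w' / w = Complex.exp (Complex.log w' - Complex.log w) := by
      rw [Complex.exp_sub, Complex.exp_log hw0, Complex.exp_log hw0']
    have h2 : (Complex.log w' - Complex.log w).im = - 2 * a := by
      rw [Complex.sub_im, Complex.log_im, Complex.log_im, hac]; ring
    rw [this, Complex.log_exp (by rw [h2]; linarith) (by rw [h2]; linarith), h2]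
  have e2 : (Complex.log (w / w')).im = 2 * a := by
    have : w / w' = Complex.exp (Complex.log w - Complex.log w') := by
      rw [Complex.exp_sub, Complex.exp_log hw0, Complex.exp_log hw0']
    have h2 : (Complex.log w - Complex.log w').im = 2 * a := by
      rw [Complex.sub_im, Complex.log_im, Complex.log_im, hac]; ring
    rw [this, Complex.log_exp (by rw [h2]; linarith) (by rw [h2]; linarith), h2]
  have hbm : b ∈ Icc (-b) b := ⟨by linarith, le_rfl⟩
  have hbm' : -b ∈ Icc (-b) b := ⟨le_rfl, by linarith⟩
  have q1 : q (t0 + b) = w' / w := hedge b hbm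
  have q2 : q (t0 - b + 1) = w / w' := by
    rw [hp, sub_eq_add_neg, hedge (-b) hbm', hw, hw']
    push_cast
    rw [← neg_div_neg_eq]; congr 1 <;> ring
  have i1 := congrArg Complex.im (hk b hbm)
  have i2 := congrArg Complex.im (hk (-b) hbm')
  have i3 := congrArg Complex.im (hj (t0 + b) ⟨le_rfl, by linarith⟩)
  have i4 := congrArg Complex.im (hj (t0 - b + 1) ⟨by linarith, le_rfl⟩)
  have c1 : ((-b : ℝ) : ℂ) - η * Complex.I = -w := by rw [hw]; push_cast; ring
  have c2 : ((-b : ℝ) : ℂ) + η * Complex.I = -w' := by rw [hw']; push_cast; ring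
  rw [q1, Complex.add_im, e1] at i3
  rw [hs, q2, Complex.add_im, e2] at i4
  rw [Complex.add_im, Complex.sub_im, Complex.log_im, Complex.log_im, hac] at i1
  rw [c1, c2, Complex.add_im, Complex.sub_im, Complex.log_im, Complex.log_im, han, han',
    ← sub_eq_add_neg] at i2
  linarith

theorem PolygonParam.exists_wind_ne_zero {p : ℝ → ℂ} (hp : PolygonParam p) :
    ∃ t0, ∀ O ∈ nhds (p t0), ∃ z ∈ O, ∃ σ : ℤ, σ ≠ 0 ∧ Wind (fun t => p t - z) σ := by
  obtain ⟨N, hN, hPL⟩ := hp.exists_isPL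
  have hpc : Continuous p := hp.1
  have hpp : Periodic p 1 := hp.2.1
  have hN' : (0:ℝ) < N := by exact_mod_cast hN
  have hN1 : (1:ℝ) ≤ N := by exact_mod_cast hN
  set e : ℂ := p (1 / N) - p 0 with he
  set t0 : ℝ := 1 / (2 * N) with ht0
  set b : ℝ := 1 / (4 * N) with hb
  have hb0 : 0 < b := by positivity
  have hbt : t0 = 2 * b := by rw [ht0, hb]; field_simp; norm_num
  have hb4 : 4 * b ≤ 1 := by rw [hb]; field_simp; linarith
  have hbN : b * N = 1 / 4 := by rw [hb]; field_simp
  have hedge0 : ∀ s ∈ Icc (0:ℝ) (1 / N), p s = p 0 + (s * N) • e := by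
    intro s hs
    have := hPL 0 s (by simpa using hs)
    simpa [he] using this
  have hinv : 1 / (N:ℝ) = 4 * b := by rw [hb]; field_simp
  have hedge : ∀ x ∈ Icc (-b) b, p (t0 + x) = p t0 + (x * N) • e := by
    intro x hx
    rw [hedge0 (t0 + x) ⟨by linarith [hx.1], by linarith [hx.2]⟩,
      hedge0 t0 ⟨by linarith, by linarith⟩, add_mul, add_smul, add_assoc]
  have he0 : e ≠ 0 := by
    intro h0
    have h1 := hedge b ⟨by linarith, le_rfl⟩
    rw [h0, smul_zero, add_zero] at h1
    obtain ⟨j, hj⟩ := hp.exists_int h1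
    rw [add_sub_cancel_left] at hj
    have h2 : 0 < b := hb0
    have h3 : b < 1 := by linarith
    rw [hj] at h2 h3
    have : (0:ℤ) < j := by exact_mod_cast h2
    have : j < 1 := by exact_mod_cast h3
    omega
  obtain ⟨m, hm, hmin⟩ : ∃ m : ℝ, 0 < m ∧ ∀ t ∈ Icc (t0 + b) (t0 - b + 1), m ≤ ‖p t - p t0‖ := by
    obtain ⟨m, hm, h⟩ := (isCompact_Icc (a := t0 + b) (b := t0 - b + 1)).exists_forall_le'
      (f := fun t => ‖p t - p t0‖) (a := 0) (by fun_prop) (fun t ht => by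
        rw [norm_pos_iff, sub_ne_zero]
        intro h
        obtain ⟨k, hk⟩ := hp.exists_int h
        have h1 : (0:ℝ) < k := by linarith [ht.1]
        have h2 : (k:ℝ) < 1 := by linarith [ht.2]
        have : (0:ℤ) < k := by exact_mod_cast h1
        have : k < 1 := by exact_mod_cast h2
        omega)
    exact ⟨m, hm, h⟩
  refine ⟨t0, fun O hO => ?_⟩
  obtain ⟨d, hd, hdO⟩ := Metric.mem_nhds_iff.1 hO
  have hen : 0 < ‖e‖ := norm_pos_iff.2 he0
  obtain ⟨η, hη, hη1, hη2⟩ : ∃ η : ℝ, 0 < η ∧ η * N * ‖e‖ < d ∧ 3 * (η * N * ‖e‖) < m := by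
    refine ⟨min d (m / 3) / (2 * N * ‖e‖), by positivity, ?_, ?_⟩
    · have : min d (m / 3) / (2 * N * ‖e‖) * N * ‖e‖ = min d (m / 3) / 2 := by field_simp
      rw [this]; linarith [min_le_left d (m / 3)]
    · have : min d (m / 3) / (2 * N * ‖e‖) * N * ‖e‖ = min d (m / 3) / 2 := by field_simp
      rw [this]; linarith [min_le_right d (m / 3)]
  set u : ℂ := η * N * Complex.I * e with hu
  have hun : ‖u‖ = η * N * ‖e‖ := by
    simp [hu, abs_of_pos hη]
  have hne : ∀ v : ℂ, (v = u ∨ v = -u) → ∀ t, p t - (p t0 + v) ≠ 0 := by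
    intro v hv t
    have hvn : ‖v‖ = ‖u‖ := by rcases hv with rfl | rfl <;> simp
    have hv0 : ∀ x : ℝ, (x * N) • e ≠ v := by
      intro x hx
      have h3 : ((x * N : ℝ) : ℂ) * e = v := by rw [← hx, Complex.real_smul]
      have h4 : v = (((η * N : ℝ) : ℂ) * Complex.I) * e ∨ v = (-(((η * N : ℝ) : ℂ) * Complex.I)) * e := by
        rcases hv with rfl | rfl
        · left; rw [hu]; push_cast; ring
        · right; rw [hu]; push_cast; ring
      have hpos : 0 < η * N := by positivity
      rcases h4 with h4 | h4 <;> rw [h4] at h3 <;>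
        · have := congrArg Complex.im (mul_right_cancel₀ he0 h3)
          simp at this
          rcases this with h | h
          · exact hη.ne' h
          · omega
    obtain ⟨t', htt, ht'⟩ : ∃ t', p t' = p t ∧ t' ∈ Ico (t0 - b) (t0 - b + 1) := by
      obtain ⟨y, hy, hy'⟩ := hpp.exists_mem_Ico one_pos t (t0 - b)
      exact ⟨y, hy'.symm, hy⟩
    rw [← htt]
    rcases le_or_gt t' (t0 + b) with h | h
    · have := hedge (t' - t0) ⟨by linarith [ht'.1], by linarith⟩
      rw [add_sub_cancel] at this
      rw [this, add_sub_add_left_eq_sub]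
      exact sub_ne_zero.2 (hv0 _)
    · intro h0
      have := hmin t' ⟨h.le, ht'.2.le⟩
      have e1 : p t' - p t0 = v := by linear_combination h0
      rw [e1, hvn, hun] at this
      have : 0 < η * N * ‖e‖ := by positivity
      linarith
  have hwex : ∀ v : ℂ, (v = u ∨ v = -u) → ∃ σ, Wind (fun t => p t - (p t0 + v)) σ := fun v hv =>
    exists_wind (by fun_prop) (fun t => by simp only [hpp t]) (hne v hv)
  obtain ⟨σ, hσ⟩ := hwex u (Or.inl rfl)
  obtain ⟨τ, hτ⟩ := hwex (-u) (Or.inr rfl)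
  by_cases hσ0 : σ = 0
  swap
  · exact ⟨_, hdO (by rw [mem_ball_iff_norm, add_sub_cancel_left, hun]; exact hη1), σ, hσ0, hσ⟩
  by_cases hτ0 : τ = 0
  swap
  · exact ⟨_, hdO (by rw [mem_ball_iff_norm, add_sub_cancel_left, norm_neg, hun]; exact hη1),
      τ, hτ0, hτ⟩
  exfalso
  subst hσ0 hτ0
  have hw := hσ.mul hτ.inv
  refine not_wind_of_edge ?_ ?_ hη hb0 (by linarith) (t0 := t0) ?_ ?_ hw
  · exact (by fun_prop : Continuous fun t => p t - (p t0 + u)).mul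
      ((by fun_prop : Continuous fun t => p t - (p t0 + -u)).inv₀ (hne _ (Or.inr rfl)))
  · intro t; simp only [hpp t]
  · intro x hx
    have e1 : p (t0 + x) - (p t0 + u) = (N * e) * (x - η * Complex.I) := by
      rw [hedge x hx, hu, Complex.real_smul]; push_cast; ring
    have e2 : p (t0 + x) - (p t0 + -u) = (N * e) * (x + η * Complex.I) := by
      rw [hedge x hx, hu, Complex.real_smul]; push_cast; ring
    rw [e1, e2, ← div_eq_mul_inv, mul_div_mul_left]
    exact mul_ne_zero (by exact_mod_cast hN'.ne') he0
  · intro t ht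
    have h0 := hne _ (Or.inr rfl) t
    have e1 : (p t - (p t0 + u)) * (p t - (p t0 + -u))⁻¹ - 1 = (-(2 * u)) / (p t - (p t0 + -u)) := by
      field_simp; ring
    rw [e1, norm_div, div_lt_one (norm_pos_iff.2 h0), norm_neg, norm_mul, hun]
    have h1 := hmin t ht
    have h2 := norm_sub_norm_le (p t - p t0) (-u)
    rw [norm_neg, hun] at h2
    rw [← sub_sub]
    simp only [Complex.norm_ofNat]
    linarith

/-- The part of a collar of a loop `p` along the field `W` with transverse coordinate in `I`. -/
def band (p W : ℝ → ℂ) (I : Set ℝ) : Set ℂ :=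
  (fun q : ℝ × ℝ => p q.1 + q.2 • W q.1) '' (univ ×ˢ I)

lemma mem_band {p W : ℝ → ℂ} {I : Set ℝ} {z : ℂ} :
    z ∈ band p W I ↔ ∃ t, ∃ τ ∈ I, p t + τ • W t = z := by
  simp [band]

lemma band_mono {p W : ℝ → ℂ} {I J : Set ℝ} (h : I ⊆ J) : band p W I ⊆ band p W J :=
  image_mono (prod_mono_right h)

lemma range_subset_band {p W : ℝ → ℂ} {I : Set ℝ} (h : 0 ∈ I) : range p ⊆ band p W I := by
  rintro _ ⟨t, rfl⟩
  exact mem_band.2 ⟨t, 0, h, by simp⟩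

namespace IsCollar

variable {p W : ℝ → ℂ}

lemma neg (h : IsCollar p W) : IsCollar p (fun t => - W t) where
  cont_p := h.cont_p
  cont_W := h.cont_W.neg
  per_p := h.per_p
  per_W := fun t => by simp only [h.per_W t]
  inj := fun t u τ σ hτ hσ e => by
    obtain ⟨hk, e'⟩ := h.inj t u (-τ) (-σ) (by rwa [abs_neg]) (by rwa [abs_neg])
      (by simpa using e)
    exact ⟨hk, neg_injective e'⟩
  image_mem_nhds := fun t τ hτ O hO => by
    have h1 := h.image_mem_nhds t (-τ) (by rwa [abs_neg])
      ((fun q : ℝ × ℝ => (q.1, -q.2)) ⁻¹' O)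
      ((by fun_prop : Continuous fun q : ℝ × ℝ => (q.1, -q.2)).continuousAt.preimage_mem_nhds
        (by simpa using hO))
    have e : p t + τ • - W t = p t + (-τ) • W t := by simp
    rw [e]
    refine Filter.mem_of_superset h1 ?_
    rintro _ ⟨q, hq, rfl⟩
    exact ⟨_, hq, by simp⟩

lemma continuous_map (h : IsCollar p W) : Continuous fun q : ℝ × ℝ => p q.1 + q.2 • W q.1 := by
  have := h.cont_p
  have := h.cont_W
  fun_prop

lemma isOpen_image (h : IsCollar p W) {O : Set (ℝ × ℝ)} (hO : IsOpen O)
    (hO2 : ∀ q ∈ O, |q.2| < 2) : IsOpen ((fun q : ℝ × ℝ => p q.1 + q.2 • W q.1) '' O) := by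
  rw [isOpen_iff_mem_nhds]
  rintro _ ⟨q, hq, rfl⟩
  exact h.image_mem_nhds q.1 q.2 (hO2 q hq) O (hO.mem_nhds hq)

lemma isOpen_band (h : IsCollar p W) {I : Set ℝ} (hI : IsOpen I) (hI2 : ∀ τ ∈ I, |τ| < 2) :
    IsOpen (band p W I) :=
  h.isOpen_image (isOpen_univ.prod hI) fun q hq => hI2 _ hq.2

lemma isPreconnected_band (h : IsCollar p W) {I : Set ℝ} (hI : IsPreconnected I) :
    IsPreconnected (band p W I) :=
  (isPreconnected_univ.prod hI).image _ h.continuous_map.continuousOn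

lemma isCompact_band (h : IsCollar p W) {I : Set ℝ} (hI : IsCompact I) :
    IsCompact (band p W I) := by
  have : band p W I = (fun q : ℝ × ℝ => p q.1 + q.2 • W q.1) '' (Icc 0 1 ×ˢ I) := by
    refine Subset.antisymm ?_ (image_mono (prod_mono_left (subset_univ _)))
    rintro _ ⟨q, hq, rfl⟩
    refine ⟨(Int.fract q.1, q.2), ⟨⟨Int.fract_nonneg _, (Int.fract_lt_one _).le⟩, hq.2⟩, ?_⟩
    have hf : ∀ f : ℝ → ℂ, Periodic f 1 → f (Int.fract q.1) = f q.1 := fun f hf => by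
      rw [Int.fract, ← mul_one (⌊q.1⌋ : ℝ)]; exact hf.sub_int_mul_eq _
    simp only [hf p h.per_p, hf W h.per_W]
  rw [this]
  exact (isCompact_Icc.prod hI).image h.continuous_map

lemma eq_of_mem_band (h : IsCollar p W) {I J : Set ℝ} (hI : ∀ τ ∈ I, |τ| ≤ 2)
    (hJ : ∀ τ ∈ J, |τ| ≤ 2) (hIJ : Disjoint I J) : Disjoint (band p W I) (band p W J) := by
  rw [disjoint_left]
  intro z hz hz'
  obtain ⟨t, τ, hτ, rfl⟩ := mem_band.1 hz
  obtain ⟨u, σ, hσ, e⟩ := mem_band.1 hz'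
  obtain ⟨-, rfl⟩ := h.inj t u τ σ (hI _ hτ) (hJ _ hσ) e.symm
  exact hIJ.le_bot ⟨hτ, hσ⟩

lemma disjoint_range (h : IsCollar p W) {I : Set ℝ} (hI : ∀ τ ∈ I, |τ| ≤ 2) (h0 : (0:ℝ) ∉ I) :
    Disjoint (band p W I) (range p) := by
  have : range p = band p W {0} := by
    ext z; simp [mem_band]
  rw [this]
  exact h.eq_of_mem_band hI (by simp) (by simpa using h0)

end IsCollar

lemma isOpen_polyInt {P : Set ℂ} (hP : IsClosed P) : IsOpen (polyInt P) := by
  rw [isOpen_iff_mem_nhds]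
  intro z hz
  refine Filter.mem_of_superset (hP.isOpen_compl.connectedComponentIn.mem_nhds
    (mem_connectedComponentIn hz.1)) fun w hw => ⟨connectedComponentIn_subset _ _ hw, ?_⟩
  rw [← connectedComponentIn_eq hw]; exact hz.2

lemma isClosed_polyInt_union {P : Set ℂ} (hP : IsClosed P) : IsClosed (polyInt P ∪ P) := by
  rw [← isOpen_compl_iff, isOpen_iff_mem_nhds]
  intro z hz
  rw [compl_union] at hz
  refine Filter.mem_of_superset (hP.isOpen_compl.connectedComponentIn.mem_nhds
    (mem_connectedComponentIn hz.2)) fun w hw => ?_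
  rw [compl_union]
  refine ⟨fun h => hz.1 ⟨hz.2, ?_⟩, connectedComponentIn_subset _ _ hw⟩
  rw [connectedComponentIn_eq hw]; exact h.2

lemma subset_polyInt_of_isPreconnected {P S : Set ℂ} (hS : IsPreconnected S) (hSP : Disjoint S P)
    {z : ℂ} (hz : z ∈ S) (hzi : z ∈ polyInt P) : S ⊆ polyInt P := by
  intro w hw
  have h1 := hS.subset_connectedComponentIn hz (subset_compl_iff_disjoint_right.2 hSP)
  refine ⟨fun h => hSP.le_bot ⟨hw, h⟩, ?_⟩
  rw [← connectedComponentIn_eq (h1 hw)]; exact hzi.2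

lemma notMem_polyInt_of_far {P : Set ℂ} {B : ℝ} (hB : ∀ z ∈ P, ‖z‖ ≤ B) {z : ℂ} (hz : B < ‖z‖) :
    z ∉ polyInt P := by
  intro h
  have hd : Disjoint {z : ℂ | B < ‖z‖} P := disjoint_left.2 fun w hw h' =>
    (hB w h').not_gt hw
  have h1 := (isPreconnected_exterior B).subset_connectedComponentIn (x := z) hz
    (subset_compl_iff_disjoint_right.2 hd)
  exact not_isBounded_exterior B (h.2.subset h1)

lemma isBounded_polyInt {P : Set ℂ} (hP : Bornology.IsBounded P) :
    Bornology.IsBounded (polyInt P) := by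
  obtain ⟨B, hB⟩ := hP.exists_norm_le
  refine (isBounded_closedBall (x := (0:ℂ)) (r := B)).subset fun w hw => ?_
  rw [mem_closedBall_zero_iff]
  by_contra! h
  exact notMem_polyInt_of_far hB h hw

lemma connectedComponentIn_compl_meets {F O : Set ℂ} (hF : IsClosed F) (hO : IsOpen O)
    (hFO : F ⊆ O) (hFn : F.Nonempty) {z : ℂ} (hz : z ∉ F) :
    (connectedComponentIn Fᶜ z ∩ O).Nonempty := by
  by_contra hcon
  rw [not_nonempty_iff_eq_empty, ← disjoint_iff_inter_eq_empty] at hcon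
  set C := connectedComponentIn Fᶜ z with hC
  have h1 : closure C ⊆ Fᶜ := by
    have := hcon.closure_left hO
    exact fun x hx hxF => this.le_bot ⟨hx, hFO hxF⟩
  have h2 : closure C ⊆ C := (isPreconnected_connectedComponentIn.closure).subset_connectedComponentIn
    (subset_closure (mem_connectedComponentIn hz)) h1
  have h3 : IsClopen C :=
    ⟨isClosed_of_closure_subset h2, hF.isOpen_compl.connectedComponentIn⟩
  rcases isClopen_iff.1 h3 with h | h
  · exact (h ▸ mem_connectedComponentIn hz : z ∈ (∅ : Set ℂ))
  · obtain ⟨x, hx⟩ := hFn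
    exact connectedComponentIn_subset _ _ (h ▸ mem_univ x : x ∈ C) hx

/-- The two sides of a polygon: one lies in its interior, the other one outside. -/
theorem PolygonParam.exists_sided_collar {p : ℝ → ℂ} (hp : PolygonParam p) :
    ∃ W, IsCollar p W ∧ band p W (Ioo (-2) 0) ⊆ polyInt (range p) ∧
      Disjoint (band p W (Ioo 0 2)) (polyInt (range p)) := by
  obtain ⟨W, hW⟩ := hp.exists_isCollar
  have hPc : IsCompact (range p) := isCompact_range_of_periodic hp.1 hp.2.1
  have hd1 : ∀ τ ∈ Ioo (-2:ℝ) 0, |τ| ≤ 2 := fun τ h => abs_le.2 ⟨h.1.le, by linarith [h.2]⟩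
  have hd2 : ∀ τ ∈ Ioo (0:ℝ) 2, |τ| ≤ 2 := fun τ h => abs_le.2 ⟨by linarith [h.1], h.2.le⟩
  have hN : IsOpen (band p W (Ioo (-2) 2)) := hW.isOpen_band isOpen_Ioo fun τ h => abs_lt.2 h
  have hcov : band p W (Ioo (-2) 2) ⊆ band p W (Ioo (-2) 0) ∪ band p W (Ioo 0 2) ∪ range p := by
    intro z hz
    obtain ⟨t, τ, hτ, rfl⟩ := mem_band.1 hz
    rcases lt_trichotomy τ 0 with h | h | h
    · exact Or.inl (Or.inl (mem_band.2 ⟨t, τ, ⟨hτ.1, h⟩, rfl⟩))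
    · exact Or.inr ⟨t, by simp [h]⟩
    · exact Or.inl (Or.inr (mem_band.2 ⟨t, τ, ⟨h, hτ.2⟩, rfl⟩))
  have hL : ∀ z ∈ band p W (Ioo (-2) 0), z ∈ polyInt (range p) →
      band p W (Ioo (-2) 0) ⊆ polyInt (range p) := fun z hz hzi =>
    subset_polyInt_of_isPreconnected (hW.isPreconnected_band isPreconnected_Ioo)
      (hW.disjoint_range hd1 (by simp)) hz hzi
  have hR : ∀ z ∈ band p W (Ioo 0 2), z ∈ polyInt (range p) →
      band p W (Ioo 0 2) ⊆ polyInt (range p) := fun z hz hzi =>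
    subset_polyInt_of_isPreconnected (hW.isPreconnected_band isPreconnected_Ioo)
      (hW.disjoint_range hd2 (by simp)) hz hzi
  have hnot : ¬ (band p W (Ioo (-2) 0) ⊆ polyInt (range p) ∧
      band p W (Ioo 0 2) ⊆ polyInt (range p)) := by
    rintro ⟨hl, hr⟩
    have hop : IsOpen (polyInt (range p) ∪ range p) := by
      have : polyInt (range p) ∪ range p = polyInt (range p) ∪ band p W (Ioo (-2) 2) := by
        refine Subset.antisymm (union_subset_union_right _ (range_subset_band (by simp))) ?_
        refine union_subset subset_union_left (hcov.trans ?_)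
        exact union_subset_union (union_subset hl hr) Subset.rfl
      rw [this]
      exact (isOpen_polyInt hPc.isClosed).union hN
    rcases isClopen_iff.1 (⟨isClosed_polyInt_union hPc.isClosed, hop⟩ :
      IsClopen (polyInt (range p) ∪ range p)) with h | h
    · exact (h ▸ Or.inr ⟨0, rfl⟩ : p 0 ∈ (∅ : Set ℂ))
    · have hb := (isBounded_polyInt hPc.isBounded).union hPc.isBounded
      rw [h] at hb
      exact not_isBounded_exterior 0 (hb.subset (subset_univ _))
  obtain ⟨t0, ht0⟩ := hp.exists_wind_ne_zero
  obtain ⟨z, hz, σ, hσ, hwd⟩ := ht0 _ (hN.mem_nhds (range_subset_band (by simp) ⟨t0, rfl⟩))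
  have hzi := mem_polyInt_of_wind hp.1 hp.2.1 hσ hwd
  rcases hcov hz with (h | h) | h
  · refine ⟨W, hW, hL z h hzi, disjoint_left.2 fun w hw hw' => hnot ⟨hL z h hzi, hR w hw hw'⟩⟩
  · have e : ∀ I J : Set ℝ, (∀ x ∈ I, -x ∈ J) → band p (fun t => - W t) I ⊆ band p W J := by
      intro I J hIJ z hz
      obtain ⟨t, τ, hτ, rfl⟩ := mem_band.1 hz
      exact mem_band.2 ⟨t, -τ, hIJ _ hτ, by simp⟩
    refine ⟨fun t => - W t, hW.neg, (e _ _ fun x hx => ?_).trans (hR z h hzi),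
      disjoint_left.2 fun w hw hw' =>
        hnot ⟨hL w (e _ _ (fun x hx => ?_) hw) hw', hR z h hzi⟩⟩
    · exact ⟨by linarith [hx.2], by linarith [hx.1]⟩
    · exact ⟨by linarith [hx.2], by linarith [hx.1]⟩
  · exact absurd h hzi.1

/-- The interior of a polygon, enlarged by a collar of width `w`. -/
def collarDomain (p W : ℝ → ℂ) (w : ℝ) : Set ℂ :=
  polyInt (range p) ∪ band p W (Ico 0 w)

/-- `W` is a collar field of `p` which points inside on the negative side and outside on
the positive side. -/
structure IsSidedCollar (p W : ℝ → ℂ) : Prop extends IsCollar p W where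
  inner : band p W (Ioo (-2) 0) ⊆ polyInt (range p)
  outer : Disjoint (band p W (Ioo 0 2)) (polyInt (range p))

namespace IsSidedCollar

variable {p W : ℝ → ℂ}

lemma isCompact_range (h : IsSidedCollar p W) : IsCompact (range p) := isCompact_range_of_periodic h.cont_p h.per_p

lemma range_subset_closure (h : IsSidedCollar p W) : range p ⊆ closure (polyInt (range p)) := by
  rintro _ ⟨t, rfl⟩
  have h1 : Continuous fun τ : ℝ => p t + τ • W t := by fun_prop
  have h2 : MapsTo (fun τ : ℝ => p t + τ • W t) (Ioo (-2) 0) (polyInt (range p)) := fun τ hτ =>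
    h.inner (mem_band.2 ⟨t, τ, hτ, rfl⟩)
  have := h2.closure h1
  rw [closure_Ioo (by norm_num)] at this
  simpa using this (x := 0) (by simp)

lemma closure_polyInt (h : IsSidedCollar p W) : closure (polyInt (range p)) = polyInt (range p) ∪ range p :=
  Subset.antisymm (closure_minimal subset_union_left
    (isClosed_polyInt_union h.isCompact_range.isClosed))
    (union_subset subset_closure h.range_subset_closure)

lemma nonempty_polyInt (h : IsSidedCollar p W) : (polyInt (range p)).Nonempty :=
  closure_nonempty_iff.1 ⟨p 0, h.range_subset_closure ⟨0, rfl⟩⟩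

lemma collarDomain_eq (h : IsSidedCollar p W) {w : ℝ} (hw : 0 < w) (hw2 : w < 2) :
    collarDomain p W w = polyInt (range p) ∪ band p W (Ioo (-w) w) := by
  refine Subset.antisymm (union_subset_union_right _ (band_mono fun x hx =>
    ⟨by linarith [hx.1], hx.2⟩)) (union_subset subset_union_left ?_)
  intro z hz
  obtain ⟨t, τ, hτ, rfl⟩ := mem_band.1 hz
  rcases lt_or_ge τ 0 with h0 | h0
  · exact Or.inl (h.inner (mem_band.2 ⟨t, τ, ⟨by linarith [hτ.1], h0⟩, rfl⟩))
  · exact Or.inr (mem_band.2 ⟨t, τ, ⟨h0, hτ.2⟩, rfl⟩)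

lemma isOpen_collarDomain (h : IsSidedCollar p W) {w : ℝ} (hw : 0 < w) (hw2 : w < 2) : IsOpen (collarDomain p W w) := by
  rw [h.collarDomain_eq hw hw2]
  refine (isOpen_polyInt h.isCompact_range.isClosed).union
    (h.isOpen_band isOpen_Ioo fun τ hτ => abs_lt.2 ⟨by linarith [hτ.1], by linarith [hτ.2]⟩)

lemma closure_subset_collarDomain (h : IsSidedCollar p W) {w : ℝ} (hw : 0 < w) :
    closure (polyInt (range p)) ⊆ collarDomain p W w := by
  rw [h.closure_polyInt]
  exact union_subset_union_right _ (range_subset_band ⟨le_rfl, hw⟩)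

lemma isPreconnected_collarDomain (h : IsSidedCollar p W) {w : ℝ} (hw : 0 < w) (hw2 : w < 2) :
    IsPreconnected (collarDomain p W w) := by
  rw [h.collarDomain_eq hw hw2]
  have hB := h.isPreconnected_band (isPreconnected_Ioo (a := -w) (b := w))
  have hBo : IsOpen (band p W (Ioo (-w) w)) :=
    h.isOpen_band isOpen_Ioo fun τ hτ => abs_lt.2 ⟨by linarith [hτ.1], by linarith [hτ.2]⟩
  have hr : range p ⊆ band p W (Ioo (-w) w) := range_subset_band ⟨by linarith, hw⟩
  refine isPreconnected_of_forall (p 0) fun z hz => ?_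
  rcases hz with hz | hz
  · obtain ⟨x, hx1, hx2⟩ := connectedComponentIn_compl_meets h.isCompact_range.isClosed hBo hr
      (range_nonempty p) hz.1
    refine ⟨connectedComponentIn (range p)ᶜ z ∪ band p W (Ioo (-w) w), ?_, ?_, ?_, ?_⟩
    · refine union_subset_union_left _ (subset_polyInt_of_isPreconnected
        isPreconnected_connectedComponentIn ?_ (mem_connectedComponentIn hz.1) hz)
      exact subset_compl_iff_disjoint_right.1 (connectedComponentIn_subset _ _)
    · exact Or.inr (hr ⟨0, rfl⟩)
    · exact Or.inl (mem_connectedComponentIn hz.1)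
    · exact isPreconnected_connectedComponentIn.union x hx1 hx2 hB
  · exact ⟨_, subset_union_right, hr ⟨0, rfl⟩, hz, hB⟩

lemma isBounded_collarDomain (h : IsSidedCollar p W) {w : ℝ} : Bornology.IsBounded (collarDomain p W w) :=
  (isBounded_polyInt h.isCompact_range.isBounded).union
    ((h.isCompact_band isCompact_Icc).isBounded.subset (band_mono Ico_subset_Icc_self))

lemma disjoint_collarDomain (h : IsSidedCollar p W) {w : ℝ} (hw : 0 < w) :
    Disjoint (band p W (Ico w 2)) (collarDomain p W w) := by
  rw [collarDomain, disjoint_union_right]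
  refine ⟨h.outer.mono_left (band_mono (I := Ico w 2) (J := Ioo 0 2) fun x hx => ⟨hw.trans_le hx.1, hx.2⟩), ?_⟩
  by_cases hw2 : w ≤ 2
  · refine h.eq_of_mem_band (fun τ hτ => abs_le.2 ⟨by linarith [hτ.1], hτ.2.le⟩)
      (fun τ hτ => abs_le.2 ⟨by linarith [hτ.1], by linarith [hτ.2]⟩) ?_
    exact disjoint_left.2 fun x hx hx' => hx.1.not_gt hx'.2
  · rw [Ico_eq_empty (by linarith)]; simp [band]

lemma isPreconnected_compl_collarDomain (h : IsSidedCollar p W) {w : ℝ} (hw : 0 < w) (hw2 : w < 2) :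
    IsPreconnected (collarDomain p W w)ᶜ := by
  have hL : IsPreconnected (band p W (Ico w 2)) := h.isPreconnected_band isPreconnected_Ico
  have hLG : band p W (Ico w 2) ⊆ (collarDomain p W w)ᶜ :=
    subset_compl_iff_disjoint_right.2 (h.disjoint_collarDomain hw)
  have hwm : w ∈ Ico w 2 := ⟨le_rfl, hw2⟩
  have hP1 : IsClosed (band p W {w}) := (h.isCompact_band isCompact_singleton).isClosed
  have hP1L : band p W {w} ⊆ band p W (Ico w 2) := band_mono (singleton_subset_iff.2 hwm)
  have hx0 : p 0 + w • W 0 ∈ band p W (Ico w 2) := mem_band.2 ⟨0, w, hwm, rfl⟩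
  refine isPreconnected_of_forall (p 0 + w • W 0) fun z hz => ?_
  by_cases hzP : z ∈ band p W {w}
  · exact ⟨_, hLG, hx0, hP1L hzP, hL⟩
  have hBo : IsOpen (band p W (Ioo 0 2)) :=
    h.isOpen_band isOpen_Ioo fun τ hτ => abs_lt.2 ⟨by linarith [hτ.1], hτ.2⟩
  obtain ⟨x, hx1, hx2⟩ := connectedComponentIn_compl_meets hP1 hBo
    (band_mono (singleton_subset_iff.2 ⟨hw, hw2⟩)) ⟨_, mem_band.2 ⟨0, w, rfl, rfl⟩⟩ hzP
  set D := connectedComponentIn (band p W {w})ᶜ z with hD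
  have hcl : IsClosed (collarDomain p W w ∪ band p W {w}) := by
    have : collarDomain p W w ∪ band p W {w} =
        (polyInt (range p) ∪ range p) ∪ band p W (Icc 0 w) := by
      ext y
      constructor
      · rintro ((hy | hy) | hy)
        · exact Or.inl (Or.inl hy)
        · exact Or.inr (band_mono Ico_subset_Icc_self hy)
        · exact Or.inr (band_mono (J := Icc 0 w) (singleton_subset_iff.2 ⟨hw.le, le_rfl⟩) hy)
      · rintro ((hy | hy) | hy)
        · exact Or.inl (Or.inl hy)
        · exact Or.inl (Or.inr (range_subset_band (I := Ico 0 w) ⟨le_rfl, hw⟩ hy))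
        · obtain ⟨t, τ, hτ, rfl⟩ := mem_band.1 hy
          rcases eq_or_lt_of_le hτ.2 with e | e
          · exact Or.inr (mem_band.2 ⟨t, τ, e, rfl⟩)
          · exact Or.inl (Or.inr (mem_band.2 ⟨t, τ, ⟨hτ.1, e⟩, rfl⟩))
    rw [this]
    exact (isClosed_polyInt_union h.isCompact_range.isClosed).union
      (h.isCompact_band isCompact_Icc).isClosed
  have hDG : D ⊆ (collarDomain p W w ∪ band p W {w})ᶜ := by
    refine IsPreconnected.subset_right_of_subset_union (h.isOpen_collarDomain hw hw2)
      hcl.isOpen_compl ?_ ?_ ⟨z, mem_connectedComponentIn hzP, ?_⟩ isPreconnected_connectedComponentIn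
    · exact disjoint_compl_right.mono_right (compl_subset_compl.2 subset_union_left)
    · intro y hy
      by_cases hyG : y ∈ collarDomain p W w
      · exact Or.inl hyG
      · refine Or.inr ?_
        rintro (h' | h')
        · exact hyG h'
        · exact connectedComponentIn_subset _ _ hy h'
    · rintro (h' | h')
      · exact hz h'
      · exact hzP h'
  have hxL : x ∈ band p W (Ico w 2) := by
    obtain ⟨t, τ, hτ, rfl⟩ := mem_band.1 hx2
    refine mem_band.2 ⟨t, τ, ⟨?_, hτ.2⟩, rfl⟩
    by_contra! hlt
    exact hDG hx1 (Or.inl (Or.inr (mem_band.2 ⟨t, τ, ⟨hτ.1.le, hlt⟩, rfl⟩)))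
  exact ⟨D ∪ band p W (Ico w 2), union_subset (hDG.trans (compl_subset_compl.2 subset_union_left))
    hLG, Or.inr hx0, Or.inl (mem_connectedComponentIn hzP),
    isPreconnected_connectedComponentIn.union x hx1 hxL hL⟩

lemma noHoles_collarDomain (h : IsSidedCollar p W) {w : ℝ} (hw : 0 < w) (hw2 : w < 2) : NoHoles (collarDomain p W w) := by
  intro z hz hb
  obtain ⟨B, hB⟩ := (h.isBounded_collarDomain (w := w)).exists_norm_le
  refine not_isBounded_exterior B (hb.subset fun y hy => ?_)
  exact (h.isPreconnected_compl_collarDomain hw hw2).subset_connectedComponentIn (x := z) hz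
    Subset.rfl fun hyG => (hB y hyG).not_gt hy

lemma exists_collarDomain_subset (h : IsSidedCollar p W) {V : Set ℂ} (hV : IsOpen V)
    (hK : closure (polyInt (range p)) ⊆ V) : ∃ w, 0 < w ∧ w < 1 ∧ collarDomain p W w ⊆ V := by
  rw [h.closure_polyInt] at hK
  obtain ⟨δ, hδ, hδV⟩ := h.isCompact_range.exists_thickening_subset_open hV
    (subset_union_right.trans hK)
  obtain ⟨B, hB⟩ := (isCompact_range_of_periodic h.cont_W h.per_W).isBounded.exists_norm_le
  have hB0 : 0 ≤ B := (norm_nonneg _).trans (hB _ ⟨0, rfl⟩)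
  refine ⟨min (δ / (B + 1)) (1 / 2), by positivity, by linarith [min_le_right (δ / (B + 1)) (1 / 2)],
    union_subset (subset_union_left.trans hK) ?_⟩
  intro z hz
  obtain ⟨t, τ, hτ, rfl⟩ := mem_band.1 hz
  refine hδV (mem_thickening_iff.2 ⟨p t, ⟨t, rfl⟩, ?_⟩)
  rw [dist_eq_norm, add_sub_cancel_left, norm_smul, Real.norm_of_nonneg hτ.1]
  have h1 : τ < δ / (B + 1) := hτ.2.trans_le (min_le_left _ _)
  calc τ * ‖W t‖ ≤ τ * (B + 1) := by
        have := hB _ ⟨t, rfl⟩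
        have := hτ.1
        gcongr; linarith
    _ < δ := (lt_div_iff₀ (by positivity)).1 h1

end IsSidedCollar

/-- Collar coordinates along a loop contained in the collar. -/
lemma IsCollar.exists_lift {p W : ℝ → ℂ} (h : IsCollar p W) {I : Set ℝ} (hI : ∀ τ ∈ I, |τ| < 2)
    {q : ℝ → ℂ} (hq : Continuous q) (hqp : Periodic q 1) (hqI : ∀ t, q t ∈ band p W I) :
    ∃ (θ τ : ℝ → ℝ) (d : ℤ), Continuous θ ∧ Continuous τ ∧ (∀ t, θ (t + 1) = θ t + d) ∧
      Periodic τ 1 ∧ (∀ t, τ t ∈ I) ∧ ∀ t, p (θ t) + τ t • W (θ t) = q t := by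
  choose θ0 τ hτ he using fun t => mem_band.1 (hqI t)
  have huniq : ∀ t x σ, |σ| ≤ 2 → p x + σ • W x = q t → (∃ k : ℤ, θ0 t - x = k) ∧ τ t = σ :=
    fun t x σ hσ hx => h.inj _ _ _ _ (hI _ (hτ t)).le hσ ((he t).trans hx.symm)
  have h2 : (2 * Real.pi * Complex.I : ℂ) ≠ 0 := Complex.two_pi_I_ne_zero
  set E : ℝ × ℝ → ℂ × ℝ := fun x => (Complex.exp (x.1 * (2 * Real.pi * Complex.I)), x.2) with hE
  have hEc : Continuous E := by fun_prop
  have hcont : Continuous fun t => E (θ0 t, τ t) := by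
    rw [continuous_iff_continuousAt]
    intro t S hS
    have hS' : E ⁻¹' S ∩ {x : ℝ × ℝ | |x.2| < 2} ∈ nhds (θ0 t, τ t) := by
      refine Filter.inter_mem (hEc.continuousAt.preimage_mem_nhds hS) ?_
      exact (isOpen_lt (by fun_prop) continuous_const).mem_nhds (hI _ (hτ t))
    have h1 := h.image_mem_nhds (θ0 t) (τ t) (hI _ (hτ t)) _ hS'
    rw [he t] at h1
    rw [Filter.mem_map]
    filter_upwards [hq.continuousAt.preimage_mem_nhds h1] with u hu
    obtain ⟨⟨x, σ⟩, ⟨hx1, hx2⟩, hx3⟩ := hu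
    obtain ⟨⟨k, hk⟩, hτσ⟩ := huniq u x σ (le_of_lt hx2) hx3
    have : E (θ0 u, τ u) = E (x, σ) := by
      have e : θ0 u = x + k := by linarith
      simp only [hE, hτσ, e, Prod.mk.injEq, and_true]
      rw [Complex.exp_eq_exp_iff_exists_int]
      exact ⟨k, by push_cast; ring⟩
    change E (θ0 u, τ u) ∈ S
    rw [this]; exact hx1
  have hτc : Continuous τ := continuous_snd.comp hcont
  obtain ⟨L, hL, hLe⟩ := exists_continuous_log (continuous_fst.comp hcont)
    (fun t => by simp [hE])
  have hLk : ∀ t, ∃ k : ℤ, L t = (θ0 t + k) * (2 * Real.pi * Complex.I) := fun t => by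
    obtain ⟨k, hk⟩ := Complex.exp_eq_exp_iff_exists_int.1 (hLe t)
    exact ⟨k, by rw [hk]; ring⟩
  choose k hk using hLk
  set θ : ℝ → ℝ := fun t => (L t / (2 * Real.pi * Complex.I)).re with hθ
  have hθk : ∀ t, θ t = θ0 t + k t := fun t => by
    simp only [hθ]
    rw [hk t, mul_div_cancel_right₀ _ h2]
    simp
  have hLθ : ∀ t, L t = θ t * (2 * Real.pi * Complex.I) := fun t => by
    rw [hθk, hk]; push_cast; ring
  have hθq : ∀ t, p (θ t) + τ t • W (θ t) = q t := fun t => by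
    have e1 := h.per_p.int_mul (k t) (θ0 t)
    have e2 := h.per_W.int_mul (k t) (θ0 t)
    rw [mul_one] at e1 e2
    rw [hθk, e1, e2, he]
  have hθc : Continuous θ := Complex.continuous_re.comp (hL.div_const _)
  have hper : ∀ t, (∃ j : ℤ, θ0 (t + 1) - θ0 t = j) ∧ τ (t + 1) = τ t := fun t =>
    huniq (t + 1) (θ0 t) (τ t) (hI _ (hτ t)).le (by rw [he, hqp])
  obtain ⟨d, hd⟩ := exists_int_of_exp_eq (S := univ) isPreconnected_univ
    (f := fun t => L (t + 1)) (g := L) (by fun_prop) hL.continuousOn (fun t _ => by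
      obtain ⟨j, hj⟩ := (hper t).1
      rw [hk, hk t, Complex.exp_eq_exp_iff_exists_int]
      have e : θ0 (t + 1) = θ0 t + j := by linarith
      exact ⟨j + k (t + 1) - k t, by rw [e]; push_cast; ring⟩)
  refine ⟨θ, τ, d, hθc, hτc, fun t => ?_, fun t => (hper t).2, hτ, hθq⟩
  have := hd t trivial
  simp only [hLθ, ← add_mul] at this
  exact_mod_cast mul_right_cancel₀ h2 this

theorem IsSidedCollar.exists_homotopy {p W : ℝ → ℂ} (h : IsSidedCollar p W) {w : ℝ}
    (hw2 : w < 2) {z0 : ℂ} (hz0 : z0 ∈ polyInt (range p)) :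
    ∃ m : ℤ, ∀ (q : ℝ → ℂ) (σ : ℤ), Continuous q → Periodic q 1 →
      (∀ t, q t ∈ band p W (Ioo 0 w)) → Wind (fun t => q t - z0) σ →
      ∃ d : ℤ, m * d = σ ∧ (d = 1 → ∃ H : ℝ × ℝ → ℂ, Continuous H ∧ (∀ t, H (t, 0) = q t) ∧
        (∀ t, H (t, 1) = p t) ∧ (∀ t s, H (t + 1, s) = H (t, s)) ∧
        ∀ t s, H (t, s) ∈ band p W (Ico 0 w)) := by
  have hpc := h.cont_p
  have hWc := h.cont_W
  rcases le_or_gt w 0 with hw0 | hw0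
  · refine ⟨0, fun q σ _ _ hq _ => ?_⟩
    have := hq 0
    rw [Ioo_eq_empty (by linarith)] at this
    simp [band] at this
  have hne : ∀ x s : ℝ, s ∈ Icc 0 w → p x + s • W x - z0 ≠ 0 := by
    intro x s hs h0
    rw [sub_eq_zero] at h0
    rcases eq_or_lt_of_le hs.1 with e | e
    · rw [← e, zero_smul, add_zero] at h0
      exact hz0.1 ⟨x, h0⟩
    · exact h.outer.le_bot ⟨mem_band.2 ⟨x, s, ⟨e, hs.2.trans_lt hw2⟩, h0⟩, hz0⟩
  have hclm : ∀ s, max 0 (min s w) ∈ Icc 0 w := fun s =>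
    ⟨le_max_left _ _, max_le hw0.le (min_le_right _ _)⟩
  obtain ⟨l, hl, hle⟩ := exists_continuous_log
    (q := fun x : ℝ × ℝ => p x.1 + (max 0 (min x.2 w)) • W x.1 - z0) (by fun_prop)
    (fun x => hne _ _ (hclm _))
  obtain ⟨m, hm⟩ := exists_int_of_exp_eq (S := univ) isPreconnected_univ
    (f := fun x : ℝ × ℝ => l (x.1 + 1, x.2)) (g := l) (by fun_prop) hl.continuousOn
    (fun x _ => by simp only [hle, h.per_p x.1, h.per_W x.1])
  have hm1 : ∀ x s : ℝ, l (x + 1, s) = l (x, s) + m * (2 * Real.pi * Complex.I) := fun x s =>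
    hm (x, s) trivial
  have hmd : ∀ (d : ℤ) (x s : ℝ), l (x + d, s) = l (x, s) + (m * d : ℤ) * (2 * Real.pi * Complex.I) := by
    intro d
    induction d using Int.induction_on with
    | zero => simp
    | succ i ih =>
      intro x s
      have e : x + ((i + 1 : ℤ) : ℝ) = (x + (i : ℤ)) + 1 := by push_cast; ring
      rw [e, hm1, ih]; push_cast; ring
    | pred i ih =>
      intro x s
      have e := hm1 (x + ((-i - 1 : ℤ) : ℝ)) s
      have e' : x + ((-i - 1 : ℤ) : ℝ) + 1 = x + ((-i : ℤ) : ℝ) := by push_cast; ring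
      rw [e', ih] at e
      rw [← sub_eq_iff_eq_add] at e
      rw [← e]; push_cast; ring
  refine ⟨m, fun q σ hq hqp hqI hσ => ?_⟩
  obtain ⟨θ, τ, d, hθ, hτ, hθd, hτp, hτI, hqe⟩ := h.exists_lift
    (fun τ hτ => abs_lt.2 ⟨by linarith [hτ.1], by linarith [hτ.2]⟩) hq hqp hqI
  refine ⟨d, ?_, ?_⟩
  · have h1 := hσ.change (l := fun t => l (θ t, τ t)) (by fun_prop) (fun t => by
      have e : max 0 (min (τ t) w) = τ t := by
        rw [min_eq_left (hτI t).2.le, max_eq_right (hτI t).1.le]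
      simp only [hle, e, hqe]) 0
    simp only [hθd, hτp 0, hmd] at h1
    rw [add_right_inj] at h1
    exact_mod_cast mul_right_cancel₀ Complex.two_pi_I_ne_zero h1
  · rintro rfl
    set c : ℝ → ℝ := fun s => max 0 (min s 1) with hc
    have hcc : Continuous c := by fun_prop
    have hc01 : ∀ s, c s ∈ Icc 0 1 := fun s => ⟨le_max_left _ _, max_le zero_le_one (min_le_right _ _)⟩
    have hc0 : c 0 = 0 := by simp [hc]
    have hc1 : c 1 = 1 := by simp [hc]
    refine ⟨fun x => p ((1 - c x.2) * θ x.1 + c x.2 * x.1) +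
      ((1 - c x.2) * τ x.1) • W ((1 - c x.2) * θ x.1 + c x.2 * x.1), by fun_prop, ?_, ?_, ?_, ?_⟩
    · intro t; simp only [hc0, sub_zero, one_mul, zero_mul, add_zero, hqe]
    · intro t; simp [hc1]
    · intro t s
      have e : (1 - c s) * θ (t + 1) + c s * (t + 1) = ((1 - c s) * θ t + c s * t) + 1 := by
        rw [hθd]; push_cast; ring
      simp only [e, h.per_p _, h.per_W _, hτp t]
    · intro t s
      refine mem_band.2 ⟨_, _, ⟨?_, ?_⟩, rfl⟩
      · exact mul_nonneg (by linarith [(hc01 s).2]) (hτI t).1.le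
      · calc (1 - c s) * τ t ≤ 1 * τ t :=
              mul_le_mul_of_nonneg_right (by linarith [(hc01 s).1]) (hτI t).1.le
          _ < w := by rw [one_mul]; exact (hτI t).2

/-- `F` and `G` are mutually inverse conformal maps between `Ω` and the disc of radius `ρ`. -/
structure DiscChart (Ω : Set ℂ) (ρ : ℝ) (F G : ℂ → ℂ) : Prop where
  isOpen : IsOpen Ω
  one_lt : 1 < ρ
  mapsF : MapsTo F Ω (ball 0 ρ)
  mapsG : MapsTo G (ball 0 ρ) Ω
  left_inv : ∀ z ∈ Ω, G (F z) = z
  right_inv : ∀ w ∈ ball (0:ℂ) ρ, F (G w) = w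
  diffF : DifferentiableOn ℂ F Ω
  diffG : DifferentiableOn ℂ G (ball 0 ρ)
  deriv_ne : ∀ z ∈ Ω, deriv F z ≠ 0

lemma NoHoles.exists_discChart {Ω K : Set ℂ} (hΩ : NoHoles Ω) (hΩo : IsOpen Ω)
    (hΩc : IsPreconnected Ω) (hΩb : Bornology.IsBounded Ω) {z0 : ℂ} (hz0 : z0 ∈ Ω)
    (hK : IsCompact K) (hKΩ : K ⊆ Ω) :
    ∃ (ρ ρ0 : ℝ) (F G : ℂ → ℂ), DiscChart Ω ρ F G ∧ F z0 = 0 ∧ 0 < ρ0 ∧ ρ0 < 1 ∧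
      ∀ z ∈ K, ‖F z‖ ≤ ρ0 := by
  obtain ⟨f, hf, hfim⟩ := hΩ.riemann_map hΩo hΩc hΩb hz0
  obtain ⟨ψ, hψ, hψd⟩ := exists_holomorphic_inverse hΩo hf.diff hf.inj hf.deriv_ne
  obtain ⟨a, ha, ha1, haK⟩ : ∃ a : ℝ, 0 < a ∧ a < 1 ∧ ∀ z ∈ K, ‖f z‖ ≤ a := by
    have hc : ContinuousOn (fun z => ‖f z‖) K := (hf.diff.continuousOn.mono hKΩ).norm
    rcases K.eq_empty_or_nonempty with rfl | hne
    · exact ⟨1 / 2, by norm_num, by norm_num, by simp⟩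
    obtain ⟨x, hx, hmax⟩ := hK.exists_isMaxOn hne hc
    have hx1 : ‖f x‖ < 1 := by simpa using hf.maps (hKΩ hx)
    refine ⟨(‖f x‖ + 1) / 2, by positivity, by linarith, fun z hz => ?_⟩
    have : ‖f z‖ ≤ ‖f x‖ := hmax hz
    linarith
  set b : ℝ := (a + 1) / 2 with hb
  have hb0 : 0 < b := by positivity
  have hb1 : b < 1 := by linarith
  have hab : a < b := by linarith
  have hbc : (b:ℂ) ≠ 0 := by exact_mod_cast hb0.ne'
  have hd : ∀ z ∈ Ω, HasDerivAt (fun z => f z / b) (deriv f z / b) z := fun z hz =>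
    ((hf.diff.differentiableAt (hΩo.mem_nhds hz)).hasDerivAt).div_const _
  have hball : ∀ w ∈ ball (0:ℂ) (1 / b), ∃ z ∈ Ω, f z = b * w := by
    intro w hw
    have : (b:ℂ) * w ∈ f '' Ω := by
      rw [hfim, mem_ball_zero_iff, norm_mul, Complex.norm_real, Real.norm_of_nonneg hb0.le]
      rw [mem_ball_zero_iff, lt_div_iff₀ hb0] at hw
      linarith
    exact this
  refine ⟨1 / b, a / b, fun z => f z / b, fun w => ψ (b * w), ⟨hΩo, ?_, ?_, ?_, ?_, ?_, ?_, ?_, ?_⟩,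
    by simp only [hf.zero, zero_div], by positivity, by rwa [div_lt_one hb0], ?_⟩
  · rwa [lt_div_iff₀ hb0, one_mul]
  · intro z hz
    have : ‖f z‖ < 1 := by simpa using hf.maps hz
    rw [mem_ball_zero_iff, norm_div, Complex.norm_real, Real.norm_of_nonneg hb0.le]
    gcongr
  · intro w hw
    obtain ⟨z, hz, e⟩ := hball w hw
    simp only [← e, hψ z hz, hz]
  · intro z hz
    change ψ (b * (f z / b)) = z
    rw [mul_div_cancel₀ _ hbc, hψ z hz]
  · intro w hw
    obtain ⟨z, hz, e⟩ := hball w hw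
    change f (ψ (b * w)) / b = w
    rw [← e, hψ z hz, e, mul_div_cancel_left₀ _ hbc]
  · exact fun z hz => (hd z hz).differentiableAt.differentiableWithinAt
  · intro w hw
    obtain ⟨z, hz, e⟩ := hball w hw
    have h1 := hψd z hz
    rw [e] at h1
    exact (h1.differentiableAt.comp w (by fun_prop)).differentiableWithinAt
  · intro z hz
    rw [(hd z hz).deriv]
    exact div_ne_zero (hf.deriv_ne z hz) hbc
  · intro z hz
    rw [norm_div, Complex.norm_real, Real.norm_of_nonneg hb0.le]
    have := haK z hz
    gcongr

lemma uniformContinuous_of_periodic {f : ℝ → ℂ} (hf : Continuous f) (hp : Periodic f 1) :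
    UniformContinuous f := by
  rw [Metric.uniformContinuous_iff]
  intro ε hε
  have h := isCompact_Icc.uniformContinuousOn_of_continuous (hf.continuousOn (s := Icc (-1:ℝ) 2))
  rw [Metric.uniformContinuousOn_iff] at h
  obtain ⟨δ, hδ, h⟩ := h ε hε
  refine ⟨min δ 1, by positivity, fun {a b} hab => ?_⟩
  have hper : ∀ x, f (x - ⌊a⌋) = f x := fun x => by
    simpa using hp.sub_zsmul_eq (x := x) ⌊a⌋
  have h1 := Int.floor_le a
  have h2 := Int.lt_floor_add_one a
  rw [Real.dist_eq] at hab
  have h3 := abs_lt.1 (hab.trans_le (min_le_right _ _))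
  have := h (a - ⌊a⌋) ⟨by linarith, by linarith⟩ (b - ⌊a⌋) ⟨by linarith, by linarith⟩
    (by rw [Real.dist_eq]; ring_nf; ring_nf at hab; exact hab.trans_le (min_le_left _ _))
  rwa [hper, hper] at this

/-- A regular simple closed curve is approximated by polygons. -/
lemma exists_polygonParam_near {b b' : ℝ → ℂ} (hb : ∀ x, HasDerivAt b (b' x) x)
    (hb' : Continuous b') (hp : Periodic b 1) {c : ℝ} (hc : 0 < c)
    (hl : ∀ t u, |t - u| ≤ 1 / 2 → c * |t - u| ≤ ‖b t - b u‖) {δ : ℝ} (hδ : 0 < δ) :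
    ∃ p, PolygonParam p ∧ ∀ t, ‖p t - b t‖ < δ := by
  have hp' : Periodic b' 1 := by
    intro x
    have h1 : HasDerivAt b (b' (x + 1)) x := by
      have := (hb (x + 1)).scomp x ((hasDerivAt_id x).add_const 1)
      have e : b ∘ (fun y : ℝ => id y + 1) = b := by ext y; exact hp y
      rw [e] at this
      simpa using this
    exact h1.unique (hb x)
  set η : ℝ := min c δ / 2 with hη
  have hη0 : 0 < η := by have := lt_min hc hδ; positivity
  have hηc : η < c := by have := min_le_left c δ; linarith
  have hηδ : η < δ := by have := min_le_right c δ; linarith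
  obtain ⟨κ, hκ, hu⟩ := Metric.uniformContinuous_iff.1 (uniformContinuous_of_periodic hb' hp') η hη0
  obtain ⟨n, hn⟩ := exists_nat_one_div_lt hκ
  set N := n + 1 with hN
  have hN0 : 0 < N := Nat.succ_pos n
  have hNR : (0:ℝ) < N := by exact_mod_cast hN0
  have hNκ : 1 / (N:ℝ) < κ := by rw [hN]; push_cast; exact hn
  set a : ℤ → ℂ := fun k => b (k / N) with ha
  have hap : ∀ k, a (k + N) = a k := by
    intro k
    have : ((k + N : ℤ) : ℝ) / N = k / N + 1 := by push_cast; field_simp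
    simp only [ha, this, hp _]
  set p := plInterp N a with hpd
  have hPL := isPL_plInterp hN0 a
  have hper : Periodic p 1 := plInterp_periodic hap
  have hslope : ∀ (k : ℤ) (x : ℝ), (k:ℝ) / N ≤ x → x < (k + 1) / N →
      ‖(N:ℝ) • (a (k + 1) - a k) - b' x‖ ≤ η := by
    intro k x hx1 hx2
    have hlen : ((k:ℝ) + 1) / N - k / N = 1 / N := by ring
    have key := Convex.norm_image_sub_le_of_norm_hasDerivWithin_le (𝕜 := ℝ) (f := fun y => b y - y • b' x)
      (f' := fun y => b' y - b' x) (s := Icc ((k:ℝ) / N) ((k + 1) / N)) (x := (k:ℝ) / N)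
      (y := (k + 1) / N) (C := η)
      (fun y _ => (((hb y).sub ((hasDerivAt_id y).smul_const (b' x))).congr_deriv
        (by simp)).hasDerivWithinAt)
      (fun y hy => by
        have : dist y x < κ := by
          rw [Real.dist_eq, abs_lt]
          constructor <;> linarith [hy.1, hy.2]
        have := hu this
        rw [dist_eq_norm] at this
        exact this.le) (convex_Icc _ _)
      ⟨le_rfl, by linarith [one_div_pos.2 hNR]⟩ ⟨by linarith [one_div_pos.2 hNR], le_rfl⟩
    have e : (N:ℝ) • (a (k + 1) - a k) - b' x
        = (N:ℝ) • ((b (((k:ℝ) + 1) / N) - (((k:ℝ) + 1) / N) • b' x) - (b (k / N) - ((k:ℝ) / N) • b' x)) := by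
      have : (b (((k:ℝ) + 1) / N) - (((k:ℝ) + 1) / N) • b' x) - (b (k / N) - ((k:ℝ) / N) • b' x)
        = (a (k + 1) - a k) - (1 / (N:ℝ)) • b' x := by
        rw [← hlen, sub_smul]
        simp only [ha]; push_cast; abel
      rw [this, smul_sub (N:ℝ) (a (k + 1) - a k), smul_smul, mul_one_div_cancel hNR.ne', one_smul]
    rw [e, norm_smul, Real.norm_of_nonneg hNR.le]
    rw [hlen, Real.norm_of_nonneg (by positivity)] at key
    calc _ ≤ (N:ℝ) * (η * (1 / N)) := by gcongr
      _ = η := by field_simp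
  have hlip := fun t u => hPL.sub_le_of_slope hN0 hb hslope t u
  have hnode : ∀ k : ℤ, p (k / N) = b (k / N) := by
    intro k
    have := hPL k (k / N) ⟨le_rfl, by rw [add_div]; linarith [one_div_pos.2 hNR]⟩
    simpa [ha] using this
  have hclose : ∀ t, ‖p t - b t‖ < δ := by
    have h0 : p 0 = b 0 := by simpa using hnode 0
    intro t
    have hfr : ∀ {g : ℝ → ℂ}, Periodic g 1 → g t = g (Int.fract t) := fun hg => by
      have := hg.sub_zsmul_eq (x := t) ⌊t⌋
      rw [← this, Int.fract, zsmul_one]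
    rw [hfr hper, hfr hp]
    have := hlip (Int.fract t) 0
    rw [← hpd, h0, sub_self, sub_zero, sub_zero, abs_of_nonneg (Int.fract_nonneg t)] at this
    nlinarith [Int.fract_nonneg t, Int.fract_lt_one t]
  have hinj' : ∀ t u, |t - u| ≤ 1 / 2 → p t = p u → t = u := by
    intro t u htu e
    have h1 := hlip t u
    rw [← hpd, e] at h1
    have h2 := hl t u htu
    have e3 : (p u - b t) - (p u - b u) = - (b t - b u) := by ring
    rw [e3, norm_neg] at h1
    have h4 : |t - u| = 0 := by
      by_contra h0
      have : 0 < |t - u| := lt_of_le_of_ne (abs_nonneg _) (Ne.symm h0)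
      nlinarith
    linarith [abs_eq_zero.1 h4]
  have hinj : ∀ s ∈ Ico (0:ℝ) 1, ∀ t ∈ Ico (0:ℝ) 1, s ≤ t → p s = p t → s = t := by
    intro s hs t ht hst e
    by_cases h : t - s ≤ 1 / 2
    · exact hinj' s t (by rw [abs_sub_comm, abs_of_nonneg (by linarith)]; exact h) e
    · have := hinj' (s + 1) t (by
        rw [abs_le]; constructor <;> linarith [hs.1, ht.2, not_le.1 h]) (by rw [hper s, e])
      linarith [hs.1, ht.2]
  refine ⟨p, ⟨hPL.continuous hN0, hper, fun s hs t ht e => ?_, N, hN0, fun k hk s hs => ?_⟩, hclose⟩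
  · rcases le_total s t with h | h
    · exact hinj s hs t ht h e
    · exact (hinj t ht s hs h e.symm).symm
  · have h1 := hPL k s (by simpa using hs)
    have h2 := hnode k
    have h3 := hnode (k + 1)
    push_cast at h2 h3
    rw [h2, h3]
    rw [hpd, h1]
    simp [ha]

/-- The circle of radius `a` about the origin, traversed `σ` times. -/
def circ (a : ℝ) (σ : ℤ) (t : ℝ) : ℂ := a * Complex.exp (2 * Real.pi * Complex.I * σ * t)

lemma norm_circ {a : ℝ} (ha : 0 ≤ a) (σ : ℤ) (t : ℝ) : ‖circ a σ t‖ = a := by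
  rw [circ, norm_mul, Complex.norm_real, Real.norm_of_nonneg ha,
    show 2 * Real.pi * Complex.I * σ * t = ((2 * Real.pi * σ * t : ℝ) : ℂ) * Complex.I by
      push_cast; ring, Complex.norm_exp_ofReal_mul_I, mul_one]

lemma periodic_circ (a : ℝ) (σ : ℤ) : Periodic (circ a σ) 1 := by
  intro t
  rw [circ, circ, Complex.ofReal_add, Complex.ofReal_one, mul_add, mul_one, Complex.exp_add,
    show 2 * Real.pi * Complex.I * σ = σ * (2 * Real.pi * Complex.I) by ring,
    Complex.exp_int_mul_two_pi_mul_I, mul_one]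

lemma hasDerivAt_circ (a : ℝ) (σ : ℤ) (t : ℝ) :
    HasDerivAt (circ a σ) (2 * Real.pi * Complex.I * σ * circ a σ t) t := by
  have h : HasDerivAt (fun z : ℂ => a * Complex.exp (2 * Real.pi * Complex.I * σ * z))
      (2 * Real.pi * Complex.I * σ * circ a σ t) t := by
    refine (((hasDerivAt_id (t:ℂ)).const_mul (2 * Real.pi * Complex.I * σ)).cexp.const_mul
      (a:ℂ)).congr_deriv ?_
    simp only [circ, id, mul_one]; ring
  exact h.comp_ofReal

lemma wind_circ {a : ℝ} (ha : 0 < a) (σ : ℤ) : Wind (circ a σ) σ := by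
  refine ⟨fun t => (Real.log a : ℝ) + 2 * Real.pi * Complex.I * σ * t, by fun_prop, fun t => ?_,
    fun t => ?_⟩
  · rw [Complex.exp_add, ← Complex.ofReal_exp, Real.exp_log ha, circ]
  · push_cast; ring

lemma le_norm_circ_sub {a : ℝ} (ha : 0 < a) {σ : ℤ} (hσ : σ = 1 ∨ σ = -1) {t u : ℝ}
    (h : |t - u| ≤ 1 / 2) : 4 * a * |t - u| ≤ ‖circ a σ t - circ a σ u‖ := by
  have e : circ a σ t - circ a σ u
      = circ a σ u * (Complex.exp (Complex.I * ((2 * Real.pi * σ * (t - u) : ℝ) : ℂ)) - 1) := by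
    have e1 : 2 * Real.pi * Complex.I * σ * t = 2 * Real.pi * Complex.I * σ * u
        + Complex.I * ((2 * Real.pi * σ * (t - u) : ℝ) : ℂ) := by push_cast; ring
    rw [circ, circ, e1, Complex.exp_add]; ring
  have hs : |(σ:ℝ)| = 1 := by rcases hσ with rfl | rfl <;> simp
  have hx : |2 * Real.pi * σ * (t - u) / 2| = Real.pi * |t - u| := by
    rw [show 2 * Real.pi * σ * (t - u) / 2 = Real.pi * σ * (t - u) by ring, abs_mul, abs_mul, hs,
      abs_of_pos Real.pi_pos, mul_one]
  have h2 := Real.mul_abs_le_abs_sin (x := 2 * Real.pi * σ * (t - u) / 2) (by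
    rw [hx]; nlinarith [Real.pi_pos])
  rw [hx] at h2
  have h3 : 2 / Real.pi * (Real.pi * |t - u|) = 2 * |t - u| := by field_simp
  rw [h3] at h2
  rw [e, norm_mul, norm_circ ha.le, Complex.norm_exp_I_mul_ofReal_sub_one, norm_mul,
    Real.norm_eq_abs, Real.norm_eq_abs, abs_of_pos (zero_lt_two' ℝ)]
  nlinarith

namespace DiscChart
variable {Ω : Set ℂ} {ρ : ℝ} {F G : ℂ → ℂ}

lemma isCompact_image (h : DiscChart Ω ρ F G) {K : Set ℂ} (hK : IsCompact K) (hKb : K ⊆ ball 0 ρ) :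
    IsCompact (G '' K) :=
  hK.image_of_continuousOn (h.diffG.continuousOn.mono hKb)

lemma wind_level (h : DiscChart Ω ρ F G) (hΩc : IsPreconnected Ω) (hΩ : NoHoles Ω) {z0 : ℂ}
    (hz0 : z0 ∈ Ω) (hF0 : F z0 = 0) {a : ℝ} (ha : 0 < a) (ha' : a < ρ) (σ : ℤ) :
    Wind (fun t => G (circ a σ t) - z0) σ := by
  have hmem : ∀ t, circ a σ t ∈ ball (0:ℂ) ρ := fun t => by
    rw [mem_ball_zero_iff, norm_circ ha.le]; exact ha'
  have hne : ∀ z ∈ Ω, dslope F z0 z ≠ 0 := by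
    intro z hz
    rcases eq_or_ne z z0 with rfl | hzz
    · rw [dslope_same]; exact h.deriv_ne z hz
    · rw [dslope_of_ne _ hzz, slope_def_field, div_ne_zero_iff, hF0, sub_zero]
      refine ⟨fun e => hzz ?_, sub_ne_zero.2 hzz⟩
      rw [← h.left_inv z hz, e, ← hF0, h.left_inv z0 hz0]
  obtain ⟨l, hl, hle⟩ := hΩ.exists_log h.isOpen hΩc
    ((Complex.differentiableOn_dslope (h.isOpen.mem_nhds hz0)).2 h.diffF) hne
  have hGc : Continuous fun t => G (circ a σ t) :=
    h.diffG.continuousOn.comp_continuous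
      (continuous_iff_continuousAt.2 fun t => (hasDerivAt_circ a σ t).continuousAt) hmem
  have h0 : Wind (fun t => dslope F z0 (G (circ a σ t))) 0 :=
    wind_of_periodic_log (l := fun t => l (G (circ a σ t)))
      (hl.continuousOn.comp_continuous hGc fun t => h.mapsG (hmem t))
      (fun t => by simp only [periodic_circ a σ t]) (fun t => hle _ (h.mapsG (hmem t)))
  have := (wind_circ ha σ).mul h0.inv
  simp only [neg_zero, add_zero] at this
  convert this using 2 with t
  have hz := h.mapsG (hmem t)
  have hd : (G (circ a σ t) - z0) • dslope F z0 (G (circ a σ t)) = F (G (circ a σ t)) - F z0 :=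
    sub_smul_dslope F z0 _
  rw [hF0, sub_zero, h.right_inv _ (hmem t), smul_eq_mul] at hd
  exact (eq_mul_inv_iff_mul_eq₀ (hne _ hz)).2 hd

lemma exists_bilipschitz (h : DiscChart Ω ρ F G) {a : ℝ} (ha : 0 < a) (ha' : a < ρ) {σ : ℤ}
    (hσ : σ = 1 ∨ σ = -1) :
    ∃ c, 0 < c ∧ ∀ t u, |t - u| ≤ 1 / 2 → c * |t - u| ≤ ‖G (circ a σ t) - G (circ a σ u)‖ := by
  have hsub : sphere (0:ℂ) a ⊆ ball 0 ρ := fun w hw => by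
    rw [mem_sphere_zero_iff_norm] at hw
    rw [mem_ball_zero_iff, hw]; exact ha'
  have hK := h.isCompact_image (isCompact_sphere 0 a) hsub
  have hll : LocallyLipschitzOn (G '' sphere 0 a) F := by
    rintro _ ⟨w, hw, rfl⟩
    have hz := h.mapsG (hsub hw)
    obtain ⟨K, t, ht, hL⟩ := ((h.diffF.contDiffOn (n := 1) h.isOpen).contDiffAt
      (h.isOpen.mem_nhds hz)).exists_lipschitzOnWith
    exact ⟨K, t, mem_nhdsWithin_of_mem_nhds ht, hL⟩
  obtain ⟨L, hL⟩ := hll.exists_lipschitzOnWith_of_compact hK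
  refine ⟨4 * a / (L + 1), by positivity, fun t u htu => ?_⟩
  have hm : ∀ t, circ a σ t ∈ sphere (0:ℂ) a := fun t => by
    rw [mem_sphere_zero_iff_norm, norm_circ ha.le]
  have h1 := hL.norm_sub_le (mem_image_of_mem G (hm t)) (mem_image_of_mem G (hm u))
  rw [h.right_inv _ (hsub (hm t)), h.right_inv _ (hsub (hm u))] at h1
  have h2 := le_norm_circ_sub ha hσ htu
  rw [div_mul_eq_mul_div, div_le_iff₀ (by positivity)]
  nlinarith [norm_nonneg (G (circ a σ t) - G (circ a σ u))]

/-- The exterior of a closed conformal subdisc is connected. -/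
lemma isPreconnected_compl (h : DiscChart Ω ρ F G) (hΩb : Bornology.IsBounded Ω) :
    IsPreconnected (G '' closedBall 0 1)ᶜ ∧ ¬ Bornology.IsBounded (G '' closedBall 0 1)ᶜ := by
  set C := G '' closedBall 0 1 with hC
  have hρ := h.one_lt
  have hCk : IsCompact C := h.isCompact_image (isCompact_closedBall 0 1) (closedBall_subset_ball hρ)
  have hub : ¬ Bornology.IsBounded Cᶜ := fun hb => by
    have := hb.union hCk.isBounded
    rw [compl_union_self] at this
    exact (NormedSpace.unbounded_univ ℂ ℂ) this
  refine ⟨?_, hub⟩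
  set A := G '' (ball 0 ρ \ closedBall 0 1) with hA
  have hAp : IsPreconnected A := by
    refine IsPreconnected.image ?_ G (h.diffG.continuousOn.mono diff_subset)
    have e : ball (0:ℂ) ρ \ closedBall 0 1 =
        (fun p : ℝ × ℝ => (p.1 : ℂ) * Complex.exp (p.2 * Complex.I)) '' (Ioo 1 ρ ×ˢ univ) := by
      ext z
      simp only [mem_sdiff, mem_ball_zero_iff, mem_closedBall_zero_iff, not_le, mem_image, mem_prod,
        Prod.exists, mem_univ, and_true]
      constructor
      · rintro ⟨h1, h2⟩
        exact ⟨‖z‖, z.arg, ⟨h2, h1⟩, Complex.norm_mul_exp_arg_mul_I z⟩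
      · rintro ⟨a, b, ⟨h1, h2⟩, rfl⟩
        rw [norm_mul, Complex.norm_exp_ofReal_mul_I, mul_one, Complex.norm_real,
          Real.norm_of_nonneg (by linarith)]
        exact ⟨h2, h1⟩
    rw [e]
    exact (isPreconnected_Ioo.prod isPreconnected_univ).image _ (by fun_prop)
  have hCΩ : C ⊆ Ω := by
    rintro _ ⟨w, hw, rfl⟩; exact h.mapsG (closedBall_subset_ball hρ hw)
  have hΩA : Ω \ C ⊆ A := fun z hz => ⟨F z, ⟨h.mapsF hz.1, fun hc => hz.2 ⟨F z, hc, h.left_inv z hz.1⟩⟩,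
    h.left_inv z hz.1⟩
  have hAC : A ⊆ Cᶜ := by
    rintro _ ⟨w, hw, rfl⟩ ⟨v, hv, e⟩
    have : v = w := by
      rw [← h.right_inv v (closedBall_subset_ball hρ hv), e, h.right_inv w hw.1]
    exact hw.2 (this ▸ hv)
  have key : ∀ z ∈ Cᶜ, A ⊆ connectedComponentIn Cᶜ z := by
    intro z hz
    obtain ⟨y, hy, hyΩ⟩ := connectedComponentIn_compl_meets hCk.isClosed h.isOpen hCΩ
      ⟨G 0, 0, by simp, rfl⟩ hz
    rw [connectedComponentIn_eq hy]
    exact hAp.subset_connectedComponentIn (hΩA ⟨hyΩ, connectedComponentIn_subset _ _ hy⟩) hAC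
  have hAne : A.Nonempty := ⟨G ((1 + ρ) / 2 : ℝ), _, ⟨by
    rw [mem_ball_zero_iff, Complex.norm_real, Real.norm_of_nonneg (by linarith)]; linarith, by
    rw [mem_closedBall_zero_iff, Complex.norm_real, Real.norm_of_nonneg (by linarith)]; linarith⟩, rfl⟩
  obtain ⟨y, hy⟩ := hAne
  have : Cᶜ ⊆ connectedComponentIn Cᶜ y := by
    intro z hz
    have := key z hz hy
    rw [← connectedComponentIn_eq this]
    exact mem_connectedComponentIn hz
  rw [subset_antisymm this (connectedComponentIn_subset _ _)]
  exact isPreconnected_connectedComponentIn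

/-- A polygon close to the unit level curve of a conformal chart. -/
theorem exists_polygonParam (h : DiscChart Ω ρ F G) (hΩc : IsPreconnected Ω) (hΩ : NoHoles Ω)
    (hΩb : Bornology.IsBounded Ω) {z0 : ℂ} (hz0 : z0 ∈ Ω) (hF0 : F z0 = 0) {κ : ℝ} (hκ : 0 < κ)
    (hκ1 : κ < 1) {σ : ℤ} (hσ : σ = 1 ∨ σ = -1) :
    ∃ q, PolygonParam q ∧ (∀ t, q t ∈ Ω ∧ 1 - κ ≤ ‖F (q t)‖ ∧ ‖F (q t)‖ ≤ 1) ∧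
      Wind (fun t => q t - z0) σ ∧ {z ∈ Ω | ‖F z‖ < 1 - κ} ⊆ polyInt (range q) ∧
      closure (polyInt (range q)) ⊆ {z ∈ Ω | ‖F z‖ ≤ 1} := by
  have hρ := h.one_lt
  set a : ℝ := 1 - κ / 2 with ha
  have ha0 : 0 < a := by linarith
  have haρ : a < ρ := by linarith
  have hmem : ∀ t, circ a σ t ∈ ball (0:ℂ) ρ := fun t => by
    rw [mem_ball_zero_iff, norm_circ ha0.le]; exact haρ
  have hcc : Continuous (circ a σ) :=
    continuous_iff_continuousAt.2 fun t => (hasDerivAt_circ a σ t).continuousAt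
  set b : ℝ → ℂ := fun t => G (circ a σ t) with hb
  have hbc : Continuous b := h.diffG.continuousOn.comp_continuous hcc hmem
  have hbp : Periodic b 1 := fun t => by simp only [hb, periodic_circ a σ t]
  have hbd : ∀ t, HasDerivAt b (deriv G (circ a σ t) * (2 * Real.pi * Complex.I * σ * circ a σ t)) t :=
    fun t => ((h.diffG.differentiableAt (isOpen_ball.mem_nhds (hmem t))).hasDerivAt).comp t
      (hasDerivAt_circ a σ t)
  have hGd : ContinuousOn (deriv G) (ball 0 ρ) :=
    (h.diffG.deriv isOpen_ball).continuousOn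
  have hbd' : Continuous fun t => deriv G (circ a σ t) * (2 * Real.pi * Complex.I * σ * circ a σ t) :=
    (hGd.comp_continuous hcc hmem).mul (by fun_prop)
  obtain ⟨c, hc, hl⟩ := h.exists_bilipschitz ha0 haρ hσ
  have hwb := h.wind_level hΩc hΩ hz0 hF0 ha0 haρ σ
  set O : Set ℂ := {z ∈ Ω | ‖F z‖ ∈ Ioo (1 - κ) 1} with hO
  have hOo : IsOpen O := h.diffF.continuousOn.norm.isOpen_inter_preimage h.isOpen isOpen_Ioo
  have hbk := isCompact_range_of_periodic hbc hbp
  have hbO : range b ⊆ O := by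
    rintro _ ⟨t, rfl⟩
    refine ⟨h.mapsG (hmem t), ?_⟩
    rw [hb, h.right_inv _ (hmem t), norm_circ ha0.le]
    constructor <;> linarith
  obtain ⟨δ1, hδ1, hthick⟩ := hbk.exists_thickening_subset_open hOo hbO
  obtain ⟨δ2, hδ2, hfar⟩ := hbk.exists_forall_le' (f := fun z => ‖z - z0‖) (by fun_prop) (a := 0)
    (by
      rintro _ ⟨t, rfl⟩
      exact norm_pos_iff.2 (hwb.ne_zero t))
  obtain ⟨q, hq, hqb⟩ := exists_polygonParam_near hbd hbd' hbp hc hl (lt_min hδ1 hδ2)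
  have hqO : ∀ t, q t ∈ O := fun t => hthick (mem_thickening_iff.2
    ⟨b t, mem_range_self t, by rw [dist_eq_norm]; exact (hqb t).trans_le (min_le_left _ _)⟩)
  have hqw : Wind (fun t => q t - z0) σ := by
    refine hwb.of_norm_sub_lt (hbc.sub continuous_const) (fun t => by simp only [periodic_circ a σ t])
      (hq.1.sub continuous_const) (fun t => by simp only [hq.2.1 t]) fun t => ?_
    have e : G (circ a σ t) - z0 - (q t - z0) = - (q t - b t) := by simp only [hb]; ring
    rw [e, norm_neg]
    exact ((hqb t).trans_le (min_le_right _ _)).trans_le (hfar _ (mem_range_self t))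
  have hz0q := mem_polyInt_of_wind hq.1 hq.2.1 (by rcases hσ with rfl | rfl <;> decide) hqw
  have hsub1 : ball (0:ℂ) (1 - κ) ⊆ ball 0 ρ := ball_subset_ball (by linarith)
  refine ⟨q, hq, fun t => ⟨(hqO t).1, (hqO t).2.1.le, (hqO t).2.2.le⟩, hqw, ?_, ?_⟩
  · have : {z ∈ Ω | ‖F z‖ < 1 - κ} ⊆ G '' ball 0 (1 - κ) := fun z hz =>
      ⟨F z, mem_ball_zero_iff.2 hz.2, h.left_inv z hz.1⟩
    refine this.trans (subset_polyInt_of_isPreconnected (z := z0)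
      ((convex_ball 0 (1 - κ)).isPreconnected.image G (h.diffG.continuousOn.mono hsub1)) ?_
      ⟨0, mem_ball_self (by linarith), by rw [← hF0, h.left_inv z0 hz0]⟩ hz0q)
    rw [disjoint_left]
    rintro _ ⟨w, hw, rfl⟩ ⟨t, ht⟩
    have := (hqO t).2.1
    rw [ht, h.right_inv w (hsub1 hw)] at this
    rw [mem_ball_zero_iff] at hw
    linarith
  · have hCk : IsCompact (G '' closedBall 0 1) :=
      h.isCompact_image (isCompact_closedBall 0 1) (closedBall_subset_ball hρ)
    have hCe : G '' closedBall 0 1 ⊆ {z ∈ Ω | ‖F z‖ ≤ 1} := by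
      rintro _ ⟨w, hw, rfl⟩
      have hw' := closedBall_subset_ball hρ hw
      refine ⟨h.mapsG hw', ?_⟩
      rw [h.right_inv w hw']; simpa using hw
    refine (closure_minimal ?_ hCk.isClosed).trans hCe
    intro z hz
    by_contra hzC
    obtain ⟨h1, h2⟩ := h.isPreconnected_compl hΩb
    refine h2 (hz.2.subset (h1.subset_connectedComponentIn hzC ?_))
    refine compl_subset_compl.2 ?_
    rintro _ ⟨t, rfl⟩
    exact ⟨F (q t), by simpa using (hqO t).2.2.le, h.left_inv _ (hqO t).1⟩

end DiscChart

lemma hasFDerivAt_reV {Ψ : ℂ → Fin 3 → ℂ} {a : Fin 3 → ℂ} {z : ℂ} (h : HasDerivAt Ψ a z) :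
    HasFDerivAt (fun z => reV (Ψ z))
      (reV ∘L ((ContinuousLinearMap.toSpanSingleton ℂ a).restrictScalars ℝ)) z :=
  reV.hasFDerivAt.comp z (h.hasFDerivAt.restrictScalars ℝ)

lemma fderiv_reV {Ψ : ℂ → Fin 3 → ℂ} {a : Fin 3 → ℂ} {z : ℂ} (h : HasDerivAt Ψ a z) (v : ℂ) :
    fderiv ℝ (fun z => reV (Ψ z)) z v = reV (v • a) := by
  rw [(hasFDerivAt_reV h).fderiv]; simp

lemma fderiv_re {g : ℂ → ℂ} {a z : ℂ} (h : HasDerivAt g a z) (v : ℂ) :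
    fderiv ℝ (fun z => (g z).re) z v = (v * a).re := by
  have : HasFDerivAt (fun z => (g z).re)
      (Complex.reCLM ∘L ((ContinuousLinearMap.toSpanSingleton ℂ a).restrictScalars ℝ)) z :=
    Complex.reCLM.hasFDerivAt.comp z (h.hasFDerivAt.restrictScalars ℝ)
  rw [this.fderiv]; simp

lemma cdot_self_eq_zero {a : Fin 3 → ℂ} {c : ℝ} (h : ∀ v : ℂ, ‖reV (v • a)‖ = c * ‖v‖) :
    cdot a a = 0 := by
  have h1 := congrArg (· ^ 2) (h 1)
  have h2 := congrArg (· ^ 2) (h Complex.I)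
  have h3 := congrArg (· ^ 2) (h (1 + Complex.I))
  have e : ‖1 + Complex.I‖ ^ 2 = 2 := by
    rw [Complex.sq_norm, Complex.normSq_apply]; norm_num
  simp only [norm_sq_R3, mul_pow, e] at h1 h2 h3
  simp only [reV_apply, Pi.smul_apply, smul_eq_mul, Complex.mul_re, Complex.I_re, Complex.I_im,
    Complex.add_re, Complex.add_im, Complex.one_re, Complex.one_im, norm_one, Complex.norm_I,
    one_pow, mul_one, one_mul, zero_mul, zero_sub, sub_zero, zero_add, add_zero] at h1 h2 h3
  apply Complex.ext
  · simp only [cdot, Complex.add_re, Complex.mul_re, Complex.zero_re]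
    linear_combination h1 - h2
  · simp only [cdot, Complex.add_im, Complex.mul_im, Complex.zero_im]
    linear_combination h1 + h2 - h3

/-- The real part of a null holomorphic curve is a conformal minimal immersion. -/
lemma confMinImmOn_reV {V : Set ℂ} (hV : IsOpen V) {Ψ ψ : ℂ → Fin 3 → ℂ}
    (hΨ : ∀ z ∈ V, HasDerivAt Ψ (ψ z) z) (hn : ∀ z ∈ V, cdot (ψ z) (ψ z) = 0)
    (h0 : ∀ z ∈ V, ψ z ≠ 0) : ConfMinImmOn (fun z => reV (Ψ z)) V := by
  have hd : DifferentiableOn ℂ Ψ V := fun z hz => (hΨ z hz).differentiableAt.differentiableWithinAt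
  refine ⟨?_, fun i z hz => ?_, fun z hz => ?_⟩
  · exact reV.contDiff.comp_contDiffOn ((hd.contDiffOn hV).restrict_scalars ℝ)
  · have hi : ∀ w ∈ V, HasDerivAt (fun w => Ψ w i) (ψ w i) w := fun w hw =>
      hasDerivAt_pi.1 (hΨ w hw) i
    have hdi : DifferentiableOn ℂ (fun w => Ψ w i) V := fun w hw =>
      (hi w hw).differentiableAt.differentiableWithinAt
    have hdd : DifferentiableOn ℂ (fun w => ψ w i) V :=
      (hdi.deriv hV).congr fun w hw => (hi w hw).deriv.symm
    have hz' := (hdd.differentiableAt (hV.mem_nhds hz)).hasDerivAt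
    have key : ∀ v : ℂ, fderiv ℝ (fun w => fderiv ℝ (fun z => reV (Ψ z) i) w v) z v
        = (v * (v * deriv (fun w => ψ w i) z)).re := by
      intro v
      have : (fun w => fderiv ℝ (fun z => reV (Ψ z) i) w v) =ᶠ[nhds z] fun w => (v * ψ w i).re := by
        filter_upwards [hV.mem_nhds hz] with w hw
        exact fderiv_re (hi w hw) v
      rw [this.fderiv_eq]
      exact fderiv_re (hz'.const_mul v) v
    rw [key, key, ← Complex.add_re, ← mul_assoc, ← mul_assoc, Complex.I_mul_I]
    simp
  · refine ⟨‖reV (ψ z)‖, norm_pos_iff.2 (reV_ne_zero (hn z hz) (h0 z hz)), fun v => ?_⟩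
    rw [fderiv_reV (hΨ z hz), norm_reV_smul (hn z hz), mul_comm]

lemma HarmOn.harmonicAt {f : ℂ → ℝ} {Ω : Set ℂ} (hΩ : IsOpen Ω)
    (hf : ContDiffOn ℝ (⊤ : ℕ∞) f Ω) (h : HarmOn f Ω) {z : ℂ} (hz : z ∈ Ω) :
    InnerProductSpace.HarmonicAt f z := by
  have two_le : (2 : WithTop ℕ∞) ≤ ((⊤ : ℕ∞) : WithTop ℕ∞) := WithTop.coe_le_coe.2 le_top
  refine ⟨(hf.contDiffAt (hΩ.mem_nhds hz)).of_le two_le, ?_⟩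
  filter_upwards [hΩ.mem_nhds hz] with w hw
  have hd : DifferentiableAt ℝ (fderiv ℝ f) w :=
    ((hf.contDiffAt (hΩ.mem_nhds hw)).fderiv_right (m := 1)
      two_le).differentiableAt one_ne_zero
  have e := h w hw
  rw [fderiv_clm_apply hd (by fun_prop), fderiv_clm_apply hd (by fun_prop)] at e
  simpa [InnerProductSpace.laplacian_eq_iteratedFDeriv_complexPlane, iteratedFDeriv_two_apply] using e

/-- A conformal minimal immersion of a domain without holes is the real part of a null
holomorphic curve. -/
theorem ConfMinImmOn.exists_null {Ω : Set ℂ} (hΩ : NoHoles Ω) (hΩo : IsOpen Ω)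
    (hΩc : IsPreconnected Ω) {X : ℂ → R3} (hX : ConfMinImmOn X Ω) :
    ∃ Ψ ψ : ℂ → Fin 3 → ℂ, (∀ z ∈ Ω, HasDerivAt Ψ (ψ z) z) ∧ (∀ z ∈ Ω, cdot (ψ z) (ψ z) = 0) ∧
      (∀ z ∈ Ω, ψ z ≠ 0) ∧ ∀ z ∈ Ω, reV (Ψ z) = X z := by
  obtain ⟨hXs, hXh, hXc⟩ := hX
  have hXi : ∀ i : Fin 3, ContDiffOn ℝ (⊤ : ℕ∞) (fun z => X z i) Ω := fun i =>
    (EuclideanSpace.proj (𝕜 := ℝ) i).contDiff.comp_contDiffOn hXs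
  have hex : ∀ i : Fin 3, ∃ Φ φ : ℂ → ℂ, (∀ z ∈ Ω, HasDerivAt Φ (φ z) z) ∧
      ∀ z ∈ Ω, (Φ z).re = X z i := by
    intro i
    set f : ℂ → ℝ := fun z => X z i with hf
    set φ : ℂ → ℂ := fun z => fderiv ℝ f z 1 - Complex.I * fderiv ℝ f z Complex.I with hφ
    obtain ⟨Φ, hΦ⟩ := hΩ.exists_primitive hΩo hΩc (h := φ) fun z hz =>
      (HarmonicAt.differentiableAt_complex_partial
        ((hXh i).harmonicAt hΩo (hXi i) hz)).differentiableWithinAt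
    have hfd : ∀ z ∈ Ω, DifferentiableAt ℝ f z := fun z hz =>
      ((hXi i).contDiffAt (hΩo.mem_nhds hz)).differentiableAt (by simp)
    have hΦd : ∀ z ∈ Ω, DifferentiableAt ℝ (fun z => (Φ z).re) z := fun z hz =>
      Complex.reCLM.differentiableAt.comp z ((hΦ z hz).differentiableAt.restrictScalars ℝ)
    obtain ⟨c, hc⟩ := hΩo.exists_eq_add_of_fderiv_eq hΩc
      (fun z hz => (hfd z hz).differentiableWithinAt)
      (fun z hz => (hΦd z hz).differentiableWithinAt) (fun z hz => by
        ext v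
        rw [fderiv_re (hΦ z hz)]
        have hv : v = v.re • (1:ℂ) + v.im • Complex.I := by
          rw [Complex.real_smul, Complex.real_smul, mul_one, Complex.re_add_im]
        conv_lhs => rw [hv, map_add, map_smul, map_smul]
        simp [hφ])
    refine ⟨fun z => Φ z + (c:ℝ), φ, fun z hz => (hΦ z hz).add_const _, fun z hz => ?_⟩
    have := hc hz
    simp only at this
    simp [← this, hf]
  choose Φ φ h1 h2 using hex
  have hΨ : ∀ z ∈ Ω, HasDerivAt (fun z i => Φ i z) (fun i => φ i z) z := fun z hz =>
    hasDerivAt_pi.2 fun i => h1 i z hz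
  have hre : ∀ z ∈ Ω, reV (fun i => Φ i z) = X z := fun z hz => by
    ext i; exact h2 i z hz
  have hnorm : ∀ z ∈ Ω, ∃ c : ℝ, 0 < c ∧ ∀ v : ℂ, ‖reV (v • fun i => φ i z)‖ = c * ‖v‖ := by
    intro z hz
    obtain ⟨c, hc, h⟩ := hXc z hz
    refine ⟨c, hc, fun v => ?_⟩
    rw [← h v, ← fderiv_reV (hΨ z hz) v]
    have : (fun z => reV fun i => Φ i z) =ᶠ[nhds z] X := by
      filter_upwards [hΩo.mem_nhds hz] with w hw using hre w hw
    rw [this.fderiv_eq]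
  refine ⟨fun z i => Φ i z, fun z i => φ i z, hΨ, fun z hz => ?_, fun z hz h0 => ?_, hre⟩
  · obtain ⟨c, -, h⟩ := hnorm z hz
    exact cdot_self_eq_zero h
  · obtain ⟨c, hc, h⟩ := hnorm z hz
    have := h 1
    simp only at h0
    rw [h0] at this
    simp at this
    exact hc.ne' this.symm

namespace HomotopicLoopsIn
variable {T T' : Set R3} {f g h : ℝ → R3}

lemma mono (hfg : HomotopicLoopsIn T f g) (hT : T ⊆ T') : HomotopicLoopsIn T' f g := by
  obtain ⟨H, h1, h2, h3, h4, h5⟩ := hfg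
  exact ⟨H, h1, h2, h3, h4, fun t s hs => hT (h5 t s hs)⟩

lemma symm (hfg : HomotopicLoopsIn T f g) : HomotopicLoopsIn T g f := by
  obtain ⟨H, h1, h2, h3, h4, h5⟩ := hfg
  refine ⟨fun q => H (q.1, 1 - q.2), by fun_prop, fun t => by simp [h3], fun t => by simp [h2],
    fun t s => h4 _ _, fun t s hs => h5 _ _ ⟨by linarith [hs.2], by linarith [hs.1]⟩⟩

lemma trans (hfg : HomotopicLoopsIn T f g) (hgh : HomotopicLoopsIn T g h) :
    HomotopicLoopsIn T f h := by
  obtain ⟨H, h1, h2, h3, h4, h5⟩ := hfg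
  obtain ⟨K, k1, k2, k3, k4, k5⟩ := hgh
  refine ⟨fun q => if q.2 ≤ 1 / 2 then H (q.1, 2 * q.2) else K (q.1, 2 * q.2 - 1), ?_, fun t => ?_,
    fun t => ?_, fun t s => ?_, fun t s hs => ?_⟩
  · refine Continuous.if_le (by fun_prop) (by fun_prop) (by fun_prop) (by fun_prop) ?_
    rintro ⟨t, s⟩ hs
    simp only at hs
    subst hs
    norm_num [h3, k2]
  · simp [h2]
  · norm_num [k3]
  · simp only [h4, k4]
  · simp only
    split_ifs with h
    · exact h5 _ _ ⟨by linarith [hs.1], by linarith⟩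
    · exact k5 _ _ ⟨by linarith, by linarith [hs.2]⟩

lemma of_segment (hf : Continuous f) (hg : Continuous g) (hfp : Periodic f 1) (hgp : Periodic g 1)
    (hT : ∀ t, ∀ s ∈ Icc (0:ℝ) 1, f t + s • (g t - f t) ∈ T) : HomotopicLoopsIn T f g :=
  ⟨fun q => f q.1 + q.2 • (g q.1 - f q.1), by fun_prop, by simp, by simp,
    fun t s => by simp only [hfp t, hgp t], fun t s hs => hT t s hs⟩

end HomotopicLoopsIn

lemma segment_mem_thickening {A : Set R3} {r ε : ℝ} {x y : R3} (hx : x ∈ thickening r A)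
    (hxy : ‖x - y‖ < ε) {t : ℝ} (ht : t ∈ Icc (0:ℝ) 1) :
    x + t • (y - x) ∈ thickening (r + ε) A := by
  obtain ⟨z, hz, hd⟩ := mem_thickening_iff.1 hx
  refine mem_thickening_iff.2 ⟨z, hz, ?_⟩
  have h1 : dist (x + t • (y - x)) x ≤ ‖x - y‖ := by
    rw [dist_eq_norm, add_sub_cancel_left, norm_smul, Real.norm_of_nonneg ht.1, norm_sub_rev x y]
    exact mul_le_of_le_one_left (norm_nonneg _) ht.2
  have := dist_triangle (x + t • (y - x)) x z
  linarith

lemma ConfMinImmOn.mono {X : ℂ → R3} {U V : Set ℂ} (h : ConfMinImmOn X U) (hVU : V ⊆ U) :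
    ConfMinImmOn X V :=
  ⟨h.1.mono hVU, fun i z hz => h.2.1 i z (hVU hz), fun z hz => h.2.2 z (hVU hz)⟩

/-- The stretching construction, transported to a domain by a conformal chart. -/
theorem DiscChart.exists_stretching {Ω : Set ℂ} {ρ ρ0 r s R ε : ℝ} {F G : ℂ → ℂ}
    (h : DiscChart Ω ρ F G) (hΩ : NoHoles Ω) (hΩc : IsPreconnected Ω) (hρ0 : 0 < ρ0)
    (hρ1 : ρ0 < 1) {X : ℂ → R3} (hX : ConfMinImmOn X Ω) {Γ : Set R3} (hΓ : Γ.Nonempty) (hr : 0 < r)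
    (hs : 0 < s) (hR : Real.sqrt ((2 * s) ^ 2 + r ^ 2) < R)
    (hT : ∀ z ∈ Ω, ρ0 ≤ ‖F z‖ → X z ∈ thickening r Γ) (hε : 0 < ε) :
    ∃ Y : ℂ → R3, ConfMinImmOn Y Ω ∧ (∀ z ∈ Ω, ‖F z‖ ≤ ρ0 → ‖X z - Y z‖ < ε) ∧
      (∀ z ∈ Ω, ρ0 ≤ ‖F z‖ → ‖F z‖ ≤ 1 → ∀ t ∈ Icc (0:ℝ) 1,
        X z + t • (Y z - X z) ∈ thickening R Γ) ∧
      ∃ κ : ℝ, 0 < κ ∧ κ < 1 - ρ0 ∧ ∀ (W S : Set ℂ), W ⊆ {z ∈ Ω | ‖F z‖ ≤ 1} →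
        (∀ z ∈ S, ‖F z‖ ≤ ρ0) → ∀ z, 1 - κ ≤ ‖F z‖ → ENNReal.ofReal s < intrinsicDist Y W z S := by
  obtain ⟨Ψ, ψ, hΨ, hn, h0, hre⟩ := hX.exists_null hΩ h.isOpen hΩc
  have hGd : ∀ w ∈ ball (0:ℂ) ρ, HasDerivAt G (deriv G w) w := fun w hw =>
    (h.diffG.differentiableAt (isOpen_ball.mem_nhds hw)).hasDerivAt
  have hFd : ∀ z ∈ Ω, HasDerivAt F (deriv F z) z := fun z hz =>
    (h.diffF.differentiableAt (h.isOpen.mem_nhds hz)).hasDerivAt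
  have hG0 : ∀ w ∈ ball (0:ℂ) ρ, deriv G w ≠ 0 := by
    intro w hw h0
    have h1 := (hFd _ (h.mapsG hw)).comp w (hGd w hw)
    have h2 : F ∘ G =ᶠ[nhds w] id := by
      filter_upwards [isOpen_ball.mem_nhds hw] with v hv using h.right_inv v hv
    have h3 := h1.unique ((hasDerivAt_id w).congr_of_eventuallyEq h2)
    rw [h0, mul_zero] at h3
    exact zero_ne_one h3
  obtain ⟨Θ, φ, h1, h2, h3, h4, h5, κ, s', hκ, hκ1, hss, h6⟩ :=
    _root_.exists_stretching (Θ := fun w => Ψ (G w)) (φ := fun w => deriv G w • ψ (G w))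
      h.one_lt hρ0 hρ1
      (fun w hw => (hΨ _ (h.mapsG hw)).scomp w (hGd w hw))
      (fun w hw => by rw [cdot_smul_smul, hn _ (h.mapsG hw), mul_zero])
      (fun w hw => smul_ne_zero (hG0 w hw) (h0 _ (h.mapsG hw))) hΓ hr hs hR
      (fun w hw1 hw2 => by
        have hw : w ∈ ball (0:ℂ) ρ := mem_ball_zero_iff.2 (hw2.trans_lt h.one_lt)
        rw [hre _ (h.mapsG hw)]
        exact hT _ (h.mapsG hw) (by rwa [h.right_inv w hw])) hε
  have e : ∀ z ∈ Ω, reV (Ψ (G (F z))) = X z := fun z hz => by rw [h.left_inv z hz, hre z hz]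
  refine ⟨fun z => reV (Θ (F z)), confMinImmOn_reV h.isOpen
    (Ψ := fun z => Θ (F z)) (ψ := fun z => deriv F z • φ (F z))
    (fun z hz => (h1 _ (h.mapsF hz)).scomp z (hFd z hz))
    (fun z hz => by rw [cdot_smul_smul, h2 _ (h.mapsF hz), mul_zero])
    (fun z hz => smul_ne_zero (h.deriv_ne z hz) (h3 _ (h.mapsF hz))), fun z hz hz' => ?_,
    fun z hz hz' hz1 t ht => ?_, κ, hκ, hκ1, fun W S hW hS z hz => ?_⟩
  · rw [← e z hz]; exact h4 _ hz'
  · rw [← e z hz]; exact h5 _ hz' hz1 t ht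
  · refine lt_of_lt_of_le ((ENNReal.ofReal_lt_ofReal_iff (hs.trans hss)).2 hss) ?_
    refine le_iInf fun α => le_iInf fun hα => le_iInf fun hm => le_iInf fun ha0 => le_iInf fun ha1 => ?_
    exact h6 (F ∘ α) (h.diffF.continuousOn.comp hα fun t ht => (hW (hm ht)).1)
      (fun t ht => mem_closedBall_zero_iff.2 (hW (hm ht)).2) (by rwa [comp_apply, ha0]) (hS _ ha1)

/-- **Completeness Lemma.** Given a smooth Jordan curve `Γ = range γ`, nested polygons
`P' ⊆ P`, and a conformal minimal immersion `X` on a neighborhood of `closure (Int P)`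
mapping the annular region into `T(Γ, r)` with `X|P'` homotopic to `γ` there, for every
`s > 0` there is a polygon `P̃` between `P'` and `P` and a conformal minimal immersion `X̃`
close to `X` on `Int P'`, with intrinsic distance from `P̃` to `P'` greater than `s`, whose
annular image lies in `T(Γ, R)`, `R = √((2s)² + r²) + ε`, preserving the homotopy data. -/
theorem statement4 (γ : ℝ → R3) (hγ : SmoothJordan γ)
    (p p' : ℝ → ℂ) (hp : PolygonParam p) (hp' : PolygonParam p')
    (hPP : closure (polyInt (range p')) ⊆ polyInt (range p))
    (U : Set ℂ) (hUo : IsOpen U) (hPU : closure (polyInt (range p)) ⊆ U)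
    (X : ℂ → R3) (hX : ConfMinImmOn X U)
    (r ε : ℝ) (hr : 0 < r) (hε : 0 < ε)
    (h1 : X '' (closure (polyInt (range p)) \ polyInt (range p')) ⊆
      thickening r (range γ))
    (h2 : HomotopicLoopsIn (thickening r (range γ)) (X ∘ p') γ)
    (s : ℝ) (hs : 0 < s) :
    ∃ (pt : ℝ → ℂ) (Xt : ℂ → R3) (V : Set ℂ),
      PolygonParam pt ∧
      IsOpen V ∧ closure (polyInt (range pt)) ⊆ V ∧ ConfMinImmOn Xt V ∧
      -- (a.1)
      polyInt (range p') ⊆ polyInt (range pt) ∧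
      closure (polyInt (range pt)) ⊆ polyInt (range p) ∧
      -- (a.2)
      (∀ z ∈ polyInt (range p'), ‖X z - Xt z‖ < ε) ∧
      -- (a.3)
      (∀ z ∈ range pt,
        ENNReal.ofReal s <
          intrinsicDist Xt (closure (polyInt (range pt))) z (range p')) ∧
      -- (a.4)
      Xt '' (closure (polyInt (range pt)) \ polyInt (range p')) ⊆
        thickening (Real.sqrt ((2*s)^2 + r^2) + ε) (range γ) ∧
      -- (a.5)
      HomotopicLoopsIn (thickening (Real.sqrt ((2*s)^2 + r^2) + ε) (range γ))
        (X ∘ p') (Xt ∘ p') ∧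
      -- (a.6)
      HomotopicLoopsIn (thickening (Real.sqrt ((2*s)^2 + r^2) + ε) (range γ))
        (Xt ∘ pt) γ := by
  set R : ℝ := Real.sqrt ((2*s)^2 + r^2) + ε with hRdef
  have hrR : r + ε ≤ R := by
    have : r ≤ Real.sqrt ((2*s)^2 + r^2) := Real.le_sqrt_of_sq_le (by nlinarith [sq_nonneg (2*s)])
    linarith
  have hTR : thickening (r + ε) (range γ) ⊆ thickening R (range γ) := thickening_mono hrR _
  have hTr : thickening r (range γ) ⊆ thickening R (range γ) := thickening_mono (by linarith) _
  obtain ⟨W, hW0, hW1, hW2⟩ := hp'.exists_sided_collar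
  have hW : IsSidedCollar p' W := ⟨hW0, hW1, hW2⟩
  have hpo : IsOpen (polyInt (range p)) :=
    isOpen_polyInt (isCompact_range_of_periodic hp.1 hp.2.1).isClosed
  obtain ⟨w, hw0, hw1, hwV⟩ := hW.exists_collarDomain_subset hpo hPP
  have hw2 : w < 2 := by linarith
  set Ω := collarDomain p' W w with hΩdef
  have hΩo : IsOpen Ω := hW.isOpen_collarDomain hw0 hw2
  have hΩc : IsPreconnected Ω := hW.isPreconnected_collarDomain hw0 hw2
  have hΩb : Bornology.IsBounded Ω := hW.isBounded_collarDomain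
  have hΩ : NoHoles Ω := hW.noHoles_collarDomain hw0 hw2
  have hΩU : Ω ⊆ U := hwV.trans (subset_closure.trans hPU)
  have hXΩ : ConfMinImmOn X Ω := hX.mono hΩU
  set K := closure (polyInt (range p')) with hK
  have hKΩ : K ⊆ Ω := hW.closure_subset_collarDomain hw0
  have hKc : IsCompact K := (isBounded_polyInt hW.isCompact_range.isBounded).isCompact_closure
  have hp'K : ∀ t, p' t ∈ K := fun t => hW.range_subset_closure (mem_range_self t)
  obtain ⟨z0, hz0⟩ := hW.nonempty_polyInt
  have hz0Ω : z0 ∈ Ω := hKΩ (subset_closure hz0)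
  obtain ⟨ρ, ρ1, F, G, hFG, hF0, hρ10, hρ11, hρK⟩ :=
    hΩ.exists_discChart hΩo hΩc hΩb hz0Ω hKc hKΩ
  set ρ0 : ℝ := (ρ1 + 1) / 2 with hρ0
  have hFK : ∀ z ∈ K, ‖F z‖ < ρ0 := fun z hz => by have := hρK z hz; linarith
  have hXT : ∀ z ∈ Ω, z ∉ polyInt (range p') → X z ∈ thickening r (range γ) := fun z hz hz' =>
    h1 ⟨z, ⟨subset_closure (hwV hz), hz'⟩, rfl⟩
  obtain ⟨Y, hY, hYc, hYs, κ, hκ, hκ1, hYd⟩ := hFG.exists_stretching (ρ0 := ρ0) (R := R) hΩ hΩc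
    (by linarith) (by linarith) hXΩ (range_nonempty γ) hr hs (by linarith)
    (fun z hz hz' => hXT z hz fun hc => (hFK z (subset_closure hc)).not_ge hz') hε
  have hcontX : ContinuousOn X Ω := hXΩ.1.continuousOn
  have hcontY : ContinuousOn Y Ω := hY.1.continuousOn
  have hpoly := fun σ hσ => hFG.exists_polygonParam hΩc hΩ hΩb hz0Ω hF0 hκ (by linarith)
    (σ := σ) hσ
  have hqband : ∀ z ∈ Ω, 1 - κ ≤ ‖F z‖ → z ∈ band p' W (Ioo 0 w) := by
    intro z hz hz'
    have hzK : z ∉ K := fun hc => by have := hFK z hc; linarith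
    rcases hz with hz | hz
    · exact absurd (subset_closure hz) hzK
    · obtain ⟨t, τ, hτ, e⟩ := mem_band.1 hz
      refine mem_band.2 ⟨t, τ, ⟨lt_of_le_of_ne hτ.1 fun h0 => hzK ?_, hτ.2⟩, e⟩
      rw [← e, ← h0, zero_smul, add_zero]; exact hp'K t
  obtain ⟨m, hm⟩ := hW.exists_homotopy (w := w) hw2 hz0
  have hm1 : m = 1 ∨ m = -1 := by
    obtain ⟨q, hq, hqm, hqw, -⟩ := hpoly 1 (Or.inl rfl)
    obtain ⟨d, hd, -⟩ := hm q 1 hq.1 hq.2.1 (fun t => hqband _ (hqm t).1 (hqm t).2.1) hqw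
    exact Int.isUnit_iff.1 (IsUnit.of_mul_eq_one d hd)
  obtain ⟨q, hq, hqm, hqw, hq1, hq2⟩ := hpoly m hm1
  obtain ⟨d, hd, hH⟩ := hm q m hq.1 hq.2.1 (fun t => hqband _ (hqm t).1 (hqm t).2.1) hqw
  have hd1 : d = 1 := by rcases hm1 with rfl | rfl <;> omega
  obtain ⟨H, hHc, hH0, hH1, hHp, hHb⟩ := hH hd1
  have hbandΩ : band p' W (Ico 0 w) ⊆ Ω := subset_union_right
  have hbandX : ∀ z ∈ band p' W (Ico 0 w), X z ∈ thickening r (range γ) := by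
    intro z hz
    refine hXT z (hbandΩ hz) fun hc => ?_
    obtain ⟨t, τ, hτ, rfl⟩ := mem_band.1 hz
    rcases hτ.1.eq_or_lt with h0 | h0
    · rw [← h0, zero_smul, add_zero] at hc
      exact hc.1 (mem_range_self t)
    · exact disjoint_left.1 hW2 (mem_band.2 ⟨t, τ, ⟨h0, by linarith [hτ.2]⟩, rfl⟩) hc
  have hXq : Continuous (X ∘ q) := hcontX.comp_continuous hq.1 fun t => (hqm t).1
  have hYq : Continuous (Y ∘ q) := hcontY.comp_continuous hq.1 fun t => (hqm t).1
  have hXp : Continuous (X ∘ p') := hcontX.comp_continuous hp'.1 fun t => hKΩ (hp'K t)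
  have hYp : Continuous (Y ∘ p') := hcontY.comp_continuous hp'.1 fun t => hKΩ (hp'K t)
  refine ⟨q, Y, Ω, hq, hΩo, fun z hz => (hq2 hz).1, hY, fun z hz => hq1 ⟨hKΩ (subset_closure hz), ?_⟩,
    fun z hz => hwV (hq2 hz).1, fun z hz => ?_, ?_, ?_, ?_, ?_⟩
  · have := hFK z (subset_closure hz); linarith
  · exact hYc z (hKΩ (subset_closure hz)) (hFK z (subset_closure hz)).le
  · rintro _ ⟨t, rfl⟩
    refine hYd _ _ hq2 ?_ _ (hqm t).2.1
    rintro _ ⟨u, rfl⟩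
    exact (hFK _ (hp'K u)).le
  · rintro _ ⟨z, ⟨hz, hz'⟩, rfl⟩
    obtain ⟨hzΩ, hz1⟩ := hq2 hz
    rcases le_total ‖F z‖ ρ0 with hle | hle
    · have := segment_mem_thickening (hXT z hzΩ hz') (hYc z hzΩ hle) (t := 1) (by simp)
      rw [one_smul, add_sub_cancel] at this
      exact hTR this
    · have := hYs z hzΩ hle hz1 1 (by simp)
      rwa [one_smul, add_sub_cancel] at this
  · refine HomotopicLoopsIn.of_segment hXp hYp (hp'.2.1.comp X) (hp'.2.1.comp Y) fun t a ha => ?_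
    exact hTR (segment_mem_thickening
      (hXT _ (hKΩ (hp'K t)) fun hc => hc.1 (mem_range_self t))
      (hYc _ (hKΩ (hp'K t)) (hFK _ (hp'K t)).le) ha)
  · have hXYq : HomotopicLoopsIn (thickening R (range γ)) (X ∘ q) (Y ∘ q) :=
      HomotopicLoopsIn.of_segment hXq hYq (hq.2.1.comp X) (hq.2.1.comp Y) fun t a ha =>
        hYs _ (hqm t).1 (by linarith [(hqm t).2.1]) (hqm t).2.2 a ha
    have hXqp : HomotopicLoopsIn (thickening r (range γ)) (X ∘ q) (X ∘ p') :=
      ⟨fun x => X (H x), hcontX.comp_continuous hHc fun x => hbandΩ (hHb x.1 x.2),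
        fun t => by simp only [hH0, comp_apply], fun t => by simp only [hH1, comp_apply],
        fun t a => by simp only [hHp], fun t a _ => hbandX _ (hHb t a)⟩
    exact hXYq.symm.trans ((hXqp.trans h2).mono hTr)
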